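/- arXiv:1609.03631 — 3 statements merged into one kernel-verified Lean document; each statement's English description precedes it below -/
import Mathlib

section
/- Let k ≥ 1 and let A ⊂ ℕ have positive upper density. Then for Lebesgue-almost every θ > 0 and every γ ∈ ℝ there exist m, n ∈ ℕ such that d := ⌊θn+γ⌋ ≥ 1 and m + j·d ∈ A for all j ∈ {0,1,…,k}; that is, A contains a (k+1)-term arithmetic progression whose common difference lies in the Beatty sequence {⌊θn+γ⌋ : n ∈ ℕ}. -/
open MeasureTheory Filter Finset

/-- The upper density `d̄(A) = limsup_N |A ∩ {1,…,N}|/N` of a set of naturals. -/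
noncomputable def upperDensity (A : Set ℕ) : ℝ :=
  Filter.limsup
    (fun N : ℕ => (∑ n ∈ Finset.Icc 1 N, Set.indicator A (fun _ => (1 : ℝ)) n) / N)
    Filter.atTop

namespace DensityHalesJewett

section Average

variable {X Y : Type*} [Finite X] [Finite Y]

/-- The average of a real function over a finite type. -/
noncomputable def avg (f : X → ℝ) : ℝ :=
  letI := Fintype.ofFinite X
  (∑ x, f x) / Fintype.card X

/-- The uniform density of a subset of a finite type. -/
noncomputable def density (A : Set X) : ℝ := avg (A.indicator 1)

lemma avg_eq [Fintype X] (f : X → ℝ) : avg f = (∑ x, f x) / Fintype.card X := by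
  unfold avg
  congr!

lemma avg_add (f g : X → ℝ) : avg (fun x => f x + g x) = avg f + avg g := by
  have := Fintype.ofFinite X
  simp only [avg_eq, Finset.sum_add_distrib, add_div]

lemma avg_sub (f g : X → ℝ) : avg (fun x => f x - g x) = avg f - avg g := by
  have := Fintype.ofFinite X
  simp only [avg_eq, Finset.sum_sub_distrib, sub_div]

lemma avg_const_mul (c : ℝ) (f : X → ℝ) : avg (fun x => c * f x) = c * avg f := by
  have := Fintype.ofFinite X
  simp only [avg_eq, ← Finset.mul_sum, mul_div_assoc]

lemma avg_const [Nonempty X] (c : ℝ) : avg (fun _ : X => c) = c := by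
  have := Fintype.ofFinite X
  simp [avg_eq]

lemma avg_mono {f g : X → ℝ} (h : ∀ x, f x ≤ g x) : avg f ≤ avg g := by
  have := Fintype.ofFinite X
  simp only [avg_eq]
  gcongr
  exact h _

lemma avg_nonneg {f : X → ℝ} (h : ∀ x, 0 ≤ f x) : 0 ≤ avg f := by
  have := Fintype.ofFinite X
  simp only [avg_eq]
  exact div_nonneg (Finset.sum_nonneg fun x _ => h x) (by positivity)

lemma avg_nonpos {f : X → ℝ} (h : ∀ x, f x ≤ 0) : avg f ≤ 0 := by
  have := Fintype.ofFinite X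
  simp only [avg_eq]
  exact div_nonpos_of_nonpos_of_nonneg (Finset.sum_nonpos fun x _ => h x) (by positivity)

lemma avg_comp_equiv (e : X ≃ Y) (f : Y → ℝ) : avg (fun x => f (e x)) = avg f := by
  have := Fintype.ofFinite X
  have := Fintype.ofFinite Y
  simp only [avg_eq, Fintype.card_congr e, Equiv.sum_comp e f]

lemma avg_prod (f : X × Y → ℝ) : avg f = avg (fun x => avg (fun y => f (x, y))) := by
  have := Fintype.ofFinite X
  have := Fintype.ofFinite Y
  simp only [avg_eq, Fintype.sum_prod_type, Fintype.card_prod, Nat.cast_mul, ← Finset.sum_div,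
    div_div, mul_comm]

lemma avg_comm (f : X → Y → ℝ) :
    avg (fun x => avg (fun y => f x y)) = avg (fun y => avg (fun x => f x y)) := by
  rw [← avg_prod (fun p : X × Y => f p.1 p.2), ← avg_prod (fun p : Y × X => f p.2 p.1)]
  exact (avg_comp_equiv (Equiv.prodComm X Y) (fun p : Y × X => f p.2 p.1))

lemma avg_sum_arrow {ι κ β : Type*} [Finite ι] [Finite κ] [Finite β] (f : (ι ⊕ κ → β) → ℝ) :
    avg f = avg (fun u : ι → β => avg (fun v : κ → β => f (Sum.elim u v))) := by
  rw [← avg_prod (fun p : (ι → β) × (κ → β) => f (Sum.elim p.1 p.2)),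
    ← avg_comp_equiv (Equiv.sumArrowEquivProdArrow ι κ β).symm f]
  rfl

lemma avg_finset_sum {V : Type*} (s : Finset V) (f : V → X → ℝ) :
    avg (fun x => ∑ v ∈ s, f v x) = ∑ v ∈ s, avg (f v) := by
  have := Fintype.ofFinite X
  simp only [avg_eq]
  rw [Finset.sum_comm, Finset.sum_div]

lemma density_nonneg (A : Set X) : 0 ≤ density A :=
  avg_nonneg fun x => Set.indicator_nonneg (fun _ _ => zero_le_one) x

lemma density_mono {A B : Set X} (h : A ⊆ B) : density A ≤ density B :=
  avg_mono fun x => Set.indicator_le_indicator_of_subset h (fun _ => zero_le_one) x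

lemma density_le_one (A : Set X) : density A ≤ 1 := by
  rcases isEmpty_or_nonempty X with h | h
  · simp [density, avg]
  · calc density A ≤ avg (fun _ : X => (1 : ℝ)) :=
          avg_mono fun x => Set.indicator_le_self' (fun _ _ => zero_le_one) x
      _ = 1 := avg_const 1

lemma density_pos_nonempty {A : Set X} (h : 0 < density A) : A.Nonempty := by
  by_contra h2
  rw [Set.not_nonempty_iff_eq_empty] at h2
  subst h2
  simp [density, avg] at h

lemma density_eq [Fintype X] (A : Set X) [DecidablePred (· ∈ A)] :
    density A = (#{x | x ∈ A} : ℝ) / Fintype.card X := by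
  rw [density, avg_eq]
  congr 1
  simp [Set.indicator_apply]

lemma density_singleton (x : X) : density {x} = 1 / Nat.card X := by
  have := Fintype.ofFinite X
  rw [density, avg_eq, Finset.sum_eq_single x]
  · simp
  · intro y _ hy
    simp [hy]
  · simp

/-- Over each point `x`, the slices of a set average to its density. -/
lemma density_sum_arrow {ι κ β : Type*} [Finite ι] [Finite κ] [Finite β]
    (A : Set (ι ⊕ κ → β)) :
    density A = avg (fun u : ι → β => density {v : κ → β | Sum.elim u v ∈ A}) :=
  avg_sum_arrow _

lemma avg_density_comm (P : X → Y → Prop) :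
    avg (fun x => density {y | P x y}) = avg (fun y => density {x | P x y}) :=
  avg_comm fun x y => ({y | P x y} : Set Y).indicator 1 y

/-- A function bounded by one with average at least `2 * δ` is at least `δ` on a set of density
at least `δ`. -/
lemma le_density_of_le_avg [Nonempty X] {f : X → ℝ} {δ : ℝ} (h1 : ∀ x, f x ≤ 1)
    (hf : 2 * δ ≤ avg f) (hδ : 0 ≤ δ) : δ ≤ density {x | δ ≤ f x} := by
  have h : avg f ≤ avg (fun x => δ + ({x | δ ≤ f x} : Set X).indicator 1 x) := by
    refine avg_mono fun x => ?_
    by_cases hx : δ ≤ f x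
    · simp [Set.indicator, hx]
      linarith [h1 x]
    · simp [Set.indicator, hx]
      linarith
  rw [avg_add, avg_const] at h
  rw [density]
  linarith

lemma exists_density_ge_of_cover {V : Type*} [Finite V] {A : Set X} (T : V → Set X)
    (hA : 0 < density A) (hT : ∀ x ∈ A, ∃ v, x ∈ T v) :
    ∃ v, density A / Nat.card V ≤ density (T v) := by
  have := Fintype.ofFinite V
  have hV : Nonempty V := by
    obtain ⟨x, hx⟩ := density_pos_nonempty hA
    exact ⟨(hT x hx).choose⟩
  have h : density A ≤ ∑ v, density (T v) := by
    rw [density]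
    simp only [density]
    rw [← avg_finset_sum]
    refine avg_mono fun x => ?_
    by_cases hx : x ∈ A
    · obtain ⟨v, hv⟩ := hT x hx
      rw [Set.indicator_of_mem hx]
      calc (1 : X → ℝ) x = (T v).indicator 1 x := by rw [Set.indicator_of_mem hv]
        _ ≤ _ := Finset.single_le_sum (f := fun v => (T v).indicator (1 : X → ℝ) x)
            (fun v _ => Set.indicator_nonneg (fun _ _ => zero_le_one) x) (Finset.mem_univ v)
    · rw [Set.indicator_of_notMem hx]
      exact Finset.sum_nonneg fun v _ => Set.indicator_nonneg (fun _ _ => zero_le_one) x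
  by_contra! hlt
  have h2 : ∑ v, density (T v) < ∑ _v : V, density A / Nat.card V :=
    Finset.sum_lt_sum_of_nonempty Finset.univ_nonempty fun v _ => hlt v
  rw [Finset.sum_const, Finset.card_univ, nsmul_eq_mul, Nat.card_eq_fintype_card,
    mul_div_cancel₀] at h2
  · linarith
  · simp

end Average

section Words

variable {α β ι κ η μ : Type}

/-- Substitute the letter `a` for the variable (`none`) in a word. -/
def fill (a : β) (w : ι → Option β) : ι → β := fun i => (w i).getD a

/-- The parametrization of the combinatorial subspace given by a word `g` over letters and
variables. -/
def sub (g : ι → β ⊕ η) (x : η → β) : ι → β := fun i => (g i).elim id x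

/-- Every variable occurs in the word `g`. -/
def Proper (g : ι → β ⊕ η) : Prop := ∀ e, ∃ i, g i = Sum.inr e

/-- The set `A` contains a combinatorial line. -/
def HasLine (A : Set (ι → β)) : Prop :=
  ∃ w : ι → Option β, (∃ i, w i = none) ∧ ∀ a, fill a w ∈ A

/-- Composition of substitutions. -/
def subComp (g : ι → β ⊕ κ) (h : κ → β ⊕ η) : ι → β ⊕ η := fun i => (g i).elim Sum.inl h

lemma sub_subComp (g : ι → β ⊕ κ) (h : κ → β ⊕ η) (x : η → β) :
    sub (subComp g h) x = sub g (sub h x) := by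
  funext i
  simp only [sub, subComp]
  rcases g i with a | e <;> rfl

lemma Proper.subComp {g : ι → β ⊕ κ} {h : κ → β ⊕ η} (hg : Proper g) (hh : Proper h) :
    Proper (subComp g h) := by
  intro e
  obtain ⟨k, hk⟩ := hh e
  obtain ⟨i, hi⟩ := hg k
  exact ⟨i, by simp [DensityHalesJewett.subComp, hi, hk]⟩

lemma Proper.sub_injective {g : ι → β ⊕ η} (hg : Proper g) : Function.Injective (sub g) := by
  intro x y h
  funext e
  obtain ⟨i, hi⟩ := hg e
  simpa [sub, hi] using congrFun h i

lemma HasLine.of_sub {A : Set (ι → β)} {g : ι → β ⊕ η} (hg : Proper g)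
    (h : HasLine (sub g ⁻¹' A)) : HasLine A := by
  obtain ⟨w, ⟨e, he⟩, hw⟩ := h
  obtain ⟨i, hi⟩ := hg e
  refine ⟨fun i => (g i).elim some w, ⟨i, by simp [hi, he]⟩, fun a => ?_⟩
  have h : fill a (fun i => (g i).elim some w) = sub g (fill a w) := by
    funext i
    simp only [fill, sub]
    rcases g i with a | e <;> rfl
  rw [h]
  exact hw a

/-- The subspace obtained by fixing the second block of coordinates. -/
def fixRight (y : κ → β) : ι ⊕ κ → β ⊕ ι := Sum.elim Sum.inr (fun j => Sum.inl (y j))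

/-- The subspace obtained by fixing the first block of coordinates. -/
def fixLeft (x : ι → β) : ι ⊕ κ → β ⊕ κ := Sum.elim (fun j => Sum.inl (x j)) Sum.inr

lemma proper_fixRight (y : κ → β) : Proper (fixRight (ι := ι) y) := fun e => ⟨Sum.inl e, rfl⟩

lemma proper_fixLeft (x : ι → β) : Proper (fixLeft (κ := κ) x) := fun e => ⟨Sum.inr e, rfl⟩

lemma sub_fixRight (y : κ → β) (x : ι → β) : sub (fixRight y) x = Sum.elim x y := by
  funext i
  rcases i with i | i <;> rfl

lemma sub_fixLeft (x : ι → β) (y : κ → β) : sub (fixLeft x) y = Sum.elim x y := by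
  funext i
  rcases i with i | i <;> rfl

/-- The density Hales-Jewett property of the alphabet `β` at density `δ`. -/
def DHJAt (β : Type) [Finite β] (δ : ℝ) : Prop :=
  ∃ (ι : Type) (_ : Finite ι), ∀ A : Set (ι → β), δ ≤ density A → HasLine A

/-- The density Hales-Jewett property of the alphabet `β`. -/
def DHJ (β : Type) [Finite β] : Prop := ∀ δ > 0, DHJAt β δ

/-- If the slices of a relation have average density `2 * δ`, then the relation contains
a combinatorial line for many values of the parameter. -/
lemma exists_line_density_ge {Y : Type} [Finite Y] [Nonempty Y] [Finite α] [Nonempty α] [Finite ι]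
    {δ : ℝ} (hδ : 0 < δ) (hι : ∀ A : Set (ι → α), δ ≤ density A → HasLine A)
    (P : (ι → α) → Y → Prop) (hP : 2 * δ ≤ avg (fun u => density {y | P u y})) :
    ∃ w : ι → Option α, (∃ i, w i = none) ∧
      δ / Nat.card (ι → Option α) ≤ density {y | ∀ a, P (fill a w) y} := by
  rw [avg_density_comm] at hP
  have h1 := le_density_of_le_avg (fun y => density_le_one _) hP hδ.le
  obtain ⟨w, hw⟩ := exists_density_ge_of_cover
    (fun w : ι → Option α => {y | (∃ i, w i = none) ∧ ∀ a, P (fill a w) y})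
    (hδ.trans_le h1) fun y hy => by
      obtain ⟨w, h2, h3⟩ := hι _ hy
      exact ⟨w, h2, h3⟩
  have h4 : δ / Nat.card (ι → Option α) ≤
      density {y | (∃ i, w i = none) ∧ ∀ a, P (fill a w) y} :=
    le_trans (by gcongr) hw
  have h5 : (0 : ℝ) < Nat.card (ι → Option α) := by exact_mod_cast Nat.card_pos
  obtain ⟨y, hy, -⟩ := density_pos_nonempty ((div_pos hδ h5).trans_le h4)
  exact ⟨w, hy, h4.trans (density_mono fun y hy => hy.2)⟩

/-- The multidimensional density Hales-Jewett property. -/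
lemma DHJ.exists_subspace [Finite α] [Nonempty α] (h : DHJ α) (η : Type) [Finite η] :
    ∀ δ > 0, ∃ (ι : Type) (_ : Finite ι), ∀ A : Set (ι → α), δ ≤ density A →
      ∃ g : ι → α ⊕ η, Proper g ∧ ∀ x, sub g x ∈ A := by
  induction η using Finite.induction_empty_option with
  | of_equiv e ih =>
    intro δ hδ
    obtain ⟨ι, hι, H⟩ := ih δ hδ
    refine ⟨ι, hι, fun A hA => ?_⟩
    obtain ⟨g, hg, hA⟩ := H A hA
    refine ⟨fun i => (g i).map id e, fun b => ?_, fun x => ?_⟩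
    · obtain ⟨i, hi⟩ := hg (e.symm b)
      exact ⟨i, by simp [hi]⟩
    · have h : sub (fun i => (g i).map id e) x = sub g (x ∘ e) := by
        funext i
        simp only [sub]
        rcases g i with a | e <;> rfl
      rw [h]
      exact hA (x ∘ e)
  | h_empty =>
    intro δ hδ
    refine ⟨Empty, inferInstance, fun A hA => ?_⟩
    obtain ⟨x, hx⟩ := density_pos_nonempty (hδ.trans_le hA)
    refine ⟨Empty.elim, fun e => e.elim, fun y => ?_⟩
    convert hx
  | @h_option η _ ih =>
    intro δ hδ
    obtain ⟨ι₁, hι₁, H₁⟩ := h (δ / 2) (by positivity)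
    have h5 : (0 : ℝ) < Nat.card (ι₁ → Option α) := by exact_mod_cast Nat.card_pos
    obtain ⟨ι₂, hι₂, H₂⟩ := ih (δ / 2 / Nat.card (ι₁ → Option α)) (by positivity)
    refine ⟨ι₁ ⊕ ι₂, inferInstance, fun A hA => ?_⟩
    rw [density_sum_arrow] at hA
    obtain ⟨w, ⟨i₀, hi₀⟩, hw⟩ := exists_line_density_ge (half_pos hδ) H₁
      (fun u (v : ι₂ → α) => Sum.elim u v ∈ A) (by linarith)
    obtain ⟨g, hg, hgA⟩ := H₂ _ hw
    refine ⟨Sum.elim (fun i => (w i).elim (Sum.inr none) Sum.inl) fun j => (g j).map id some,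
      fun e => ?_, fun x => ?_⟩
    · rcases e with _ | e
      · exact ⟨Sum.inl i₀, by simp [hi₀]⟩
      · obtain ⟨j, hj⟩ := hg e
        exact ⟨Sum.inr j, by simp [hj]⟩
    · have h : sub (Sum.elim (fun i => (w i).elim (Sum.inr none) Sum.inl)
          fun j => (g j).map id some) x =
          Sum.elim (fill (x none) w) (sub g fun e => x (some e)) := by
        funext i
        rcases i with i | j
        · simp only [sub, fill, Sum.elim_inl]
          rcases w i <;> rfl
        · simp only [sub, Sum.elim_inr]
          rcases g j <;> rfl
      rw [h]
      exact hgA (fun e => x (some e)) (x none)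

end Words

section Insensitive

variable {α ι κ η μ ν : Type}

/-- The set `E` does not distinguish the letter `b` from the letter `none`. -/
def Insensitive (b : α) (E : Set (ι → Option α)) : Prop :=
  ∀ w w' : ι → Option α, (∀ i, (w i).getD b = (w' i).getD b) → w ∈ E → w' ∈ E

lemma Insensitive.compl {b : α} {E : Set (ι → Option α)} (h : Insensitive b E) :
    Insensitive b Eᶜ :=
  fun _ _ hw h1 h2 => h1 (h _ _ (fun i => (hw i).symm) h2)

lemma Insensitive.inter {b : α} {E F : Set (ι → Option α)} (h : Insensitive b E)
    (h' : Insensitive b F) : Insensitive b (E ∩ F) :=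
  fun _ _ hw h1 => ⟨h _ _ hw h1.1, h' _ _ hw h1.2⟩

lemma Insensitive.sub {b : α} {E : Set (ι → Option α)} (h : Insensitive b E)
    (g : ι → Option α ⊕ η) : Insensitive b (sub g ⁻¹' E) := by
  refine fun w w' hw h1 => h _ _ (fun i => ?_) h1
  simp only [DensityHalesJewett.sub]
  rcases g i with a | e
  · rfl
  · exact hw e

lemma density_eq_natCard {X : Type*} [Finite X] (A : Set X) :
    density A = (Nat.card A : ℝ) / Nat.card X := by
  classical
  have := Fintype.ofFinite X
  rw [density_eq, Nat.card_eq_fintype_card, Nat.card_eq_fintype_card, Fintype.card_subtype]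

/-- Words whose column `x` consists of a given letter are rare. -/
lemma density_column_const_le {β : Type} [Finite β] [Finite ν] (b : β) (N : ℕ) (x : ν) :
    density {w : Fin N × ν → β | ∀ j, w (j, x) = b} ≤ (1 / (Nat.card β : ℝ)) ^ N := by
  classical
  have := Nonempty.intro b
  have hb : (0 : ℝ) < Nat.card β := by exact_mod_cast Nat.card_pos
  have hX : (0 : ℝ) < Nat.card (Fin N × ν → β) := by exact_mod_cast Nat.card_pos
  rw [density_eq_natCard, one_div, inv_pow, div_le_iff₀ hX, ← div_eq_inv_mul,
    le_div_iff₀ (by positivity)]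
  have h : Nat.card ({w : Fin N × ν → β | ∀ j, w (j, x) = b} × (Fin N → β)) ≤
      Nat.card (Fin N × ν → β) := by
    refine Nat.card_le_card_of_injective
      (fun p i => if i.2 = x then p.2 i.1 else p.1.1 i) fun p q h => ?_
    refine Prod.ext (Subtype.ext (funext fun i => ?_)) (funext fun j => ?_)
    · by_cases hi : i.2 = x
      · rw [show i = (i.1, x) by rw [← hi], p.1.2, q.1.2]
      · simpa [hi] using congrFun h i
    · simpa using congrFun h (j, x)
  rw [Nat.card_prod, Nat.card_fun, Nat.card_fin] at h
  exact_mod_cast h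

open Classical in
/-- A selected index satisfying the predicate, if there is one. -/
noncomputable def slot {N : ℕ} (p : Fin N → Prop) : Option (Fin N) :=
  if h : ∃ j, p j then some h.choose else none

lemma slot_spec {N : ℕ} {p : Fin N → Prop} {j : Fin N} (h : slot p = some j) : p j := by
  unfold slot at h
  split_ifs at h with h1
  rw [← Option.some.inj h]
  exact h1.choose_spec

lemma exists_slot {N : ℕ} {p : Fin N → Prop} (h : ∃ j, p j) : ∃ j, slot p = some j := by
  unfold slot
  rw [dif_pos h]
  exact ⟨_, rfl⟩

/-- The selected index of each column carrying a letter of `α`. -/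
noncomputable def colSlot {N : ℕ} (w : Fin N × ν → Option α) (x : ν) : Option (Fin N) :=
  slot fun j => w (j, x) ≠ none

/-- Write the letters of `u` into the selected places of `w`. -/
noncomputable def refresh {N : ℕ} (w : Fin N × ν → Option α) (u : ν → α) :
    Fin N × ν → Option α :=
  fun i => if colSlot w i.2 = some i.1 then some (u i.2) else w i

lemma colSlot_refresh {N : ℕ} (w : Fin N × ν → Option α) (u : ν → α) :
    colSlot (refresh w u) = colSlot w := by
  funext x
  unfold colSlot
  congr 1
  funext j
  simp only [refresh]
  split_ifs with h
  · simpa using slot_spec h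
  · rfl

/-- Exchange the letters of `u` with those in the selected places of `w`. -/
noncomputable def swapLetters {N : ℕ} (p : (Fin N × ν → Option α) × (ν → α)) :
    (Fin N × ν → Option α) × (ν → α) :=
  (refresh p.1 p.2,
    fun x => (colSlot p.1 x).elim (p.2 x) fun j => (p.1 (j, x)).getD (p.2 x))

lemma swapLetters_involutive {N : ℕ} :
    Function.Involutive (swapLetters (α := α) (ν := ν) (N := N)) := by
  rintro ⟨w, u⟩
  refine Prod.ext (funext fun i => ?_) (funext fun x => ?_)
  · change (if colSlot (refresh w u) i.2 = some i.1 then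
      some ((colSlot w i.2).elim (u i.2) fun j => (w (j, i.2)).getD (u i.2))
      else refresh w u i) = w i
    rw [colSlot_refresh]
    split_ifs with h
    · have h1 : w (i.1, i.2) ≠ none := slot_spec h
      obtain ⟨a, ha⟩ := Option.ne_none_iff_exists'.mp h1
      rw [h, Option.elim_some, ha, Option.getD_some]
    · simp [refresh, h]
  · simp only [swapLetters, colSlot_refresh]
    rcases h : colSlot w x with _ | j
    · simp
    · simp [refresh, h]

lemma avg_refresh {N : ℕ} [Finite α] [Nonempty α] [Finite ν] (F : (Fin N × ν → Option α) → ℝ) :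
    avg (fun w => avg fun u : ν → α => F (refresh w u)) = avg F := by
  have h := avg_comp_equiv (swapLetters_involutive (α := α) (ν := ν) (N := N)).toPerm
    (fun p => F p.1)
  rw [avg_prod, avg_prod] at h
  simp only [avg_const] at h
  exact h

/-- A dense insensitive set contains a subspace. -/
lemma DHJ.exists_subspace_of_insensitive [Finite α] (h : DHJ α) (b : α) (η : Type) [Finite η]
    {ε : ℝ} (hε : 0 < ε) : ∃ (μ : Type) (_ : Finite μ), ∀ E : Set (μ → Option α),
      Insensitive b E → ε ≤ density E →
      ∃ g : μ → Option α ⊕ η, Proper g ∧ ∀ x, sub g x ∈ E := by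
  classical
  have := Nonempty.intro b
  obtain ⟨ν, hν, H⟩ := h.exists_subspace η (ε / 2) (by positivity)
  have := Fintype.ofFinite ν
  have hβ : 1 < Nat.card (Option α) := Finite.one_lt_card
  have hβ' : (1 : ℝ) / Nat.card (Option α) < 1 := by
    rw [div_lt_one (by positivity)]
    exact_mod_cast hβ
  obtain ⟨N, hN⟩ := exists_pow_lt_of_lt_one
    (show 0 < ε / 2 / (Fintype.card ν + 1) by positivity) hβ'
  refine ⟨Fin N × ν, inferInstance, fun E hE hd => ?_⟩
  obtain ⟨w, hw, hwE⟩ : ∃ w : Fin N × ν → Option α, (∀ x, ∃ j, w (j, x) ≠ none) ∧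
      ε / 2 ≤ density {u : ν → α | refresh w u ∈ E} := by
    by_contra! hcon
    have h1 : density E ≤ avg (fun w : Fin N × ν → Option α => ε / 2 +
        ∑ x, ({w | ∀ j, w (j, x) = none} : Set (Fin N × ν → Option α)).indicator 1 w) := by
      rw [density, ← avg_refresh]
      refine avg_mono fun w => ?_
      have hnn : ∀ x, (0 : ℝ) ≤ ({w | ∀ j, w (j, x) = none} :
          Set (Fin N × ν → Option α)).indicator 1 w :=
        fun x => Set.indicator_nonneg (fun _ _ => zero_le_one) w
      by_cases hw : ∀ x, ∃ j, w (j, x) ≠ none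
      · have h2 := hcon w hw
        have h3 := Finset.sum_nonneg fun x (_ : x ∈ Finset.univ) => hnn x
        change density {u : ν → α | refresh w u ∈ E} ≤ _
        linarith
      · push Not at hw
        obtain ⟨x, hx⟩ := hw
        have h3 := Finset.single_le_sum (fun x _ => hnn x) (Finset.mem_univ x)
        rw [Set.indicator_of_mem (by exact hx), Pi.one_apply] at h3
        have h4 := density_le_one {u : ν → α | refresh w u ∈ E}
        change density {u : ν → α | refresh w u ∈ E} ≤ _
        linarith
    rw [avg_add, avg_const, avg_finset_sum] at h1
    have h5 : ∑ x, density {w : Fin N × ν → Option α | ∀ j, w (j, x) = none} ≤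
        ∑ _x : ν, ε / 2 / (Fintype.card ν + 1) :=
      Finset.sum_le_sum fun x _ => (density_column_const_le none N x).trans hN.le
    have h6 : ∑ _x : ν, ε / 2 / (Fintype.card ν + 1) < ε / 2 := by
      rw [Finset.sum_const, Finset.card_univ, nsmul_eq_mul, mul_div_assoc',
        div_lt_iff₀ (by positivity)]
      nlinarith
    simp only [density] at h1 h5 hd
    linarith
  obtain ⟨g, hg, hgE⟩ := H _ hwE
  refine ⟨fun i => if colSlot w i.2 = some i.1 then (g i.2).map some id else Sum.inl (w i),
    fun e => ?_, fun y => ?_⟩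
  · obtain ⟨x, hx⟩ := hg e
    obtain ⟨j, hj⟩ := exists_slot (hw x)
    refine ⟨(j, x), ?_⟩
    have hj' : colSlot w x = some j := hj
    simp [hj', hx]
  · refine hE _ _ (fun i => ?_) (hgE fun e => (y e).getD b)
    simp only [refresh, sub]
    split_ifs with hs
    · rcases g i.2 with a | e <;> simp
    · simp

/-- The function `f` has nonpositive average on every subspace of dimension `η`. -/
def NonposOn {β : Type} [Finite β] (η : Type) [Finite η] (f : (ι → β) → ℝ) : Prop :=
  ∀ g : ι → β ⊕ η, Proper g → avg (fun x => f (sub g x)) ≤ 0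

lemma NonposOn.comp_sub {β : Type} [Finite β] [Finite η] {f : (ι → β) → ℝ} (hf : NonposOn η f)
    {g : ι → β ⊕ κ} (hg : Proper g) : NonposOn η (fun x => f (sub g x)) := by
  intro h hh
  simpa only [sub_subComp] using hf _ (hg.subComp hh)

lemma avg_indicator_range_nonpos {X Y : Type*} [Finite X] [Finite Y] {φ : X → Y}
    (hφ : Function.Injective φ) {f : Y → ℝ} (hf : avg (fun x => f (φ x)) ≤ 0) :
    avg ((Set.range φ).indicator f) ≤ 0 := by
  classical
  have := Fintype.ofFinite X
  have := Fintype.ofFinite Y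
  rcases isEmpty_or_nonempty X with hX | hX
  · simp [avg]
  rw [avg_eq, div_le_iff₀ (by positivity), zero_mul] at hf
  rw [avg_eq]
  refine div_nonpos_of_nonpos_of_nonneg ?_ (by positivity)
  calc ∑ y, (Set.range φ).indicator f y = ∑ y ∈ Finset.univ.image φ, f y := by
        simp only [Set.indicator_apply, ← Finset.sum_filter]
        congr 1
        ext y
        simp
    _ = ∑ x, f (φ x) := Finset.sum_image fun x _ y _ h => hφ h
    _ ≤ 0 := hf

/-- Insensitive sets in some dimension can be tiled by subspaces of dimension `η`, up to a set of
density at most `D`. -/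
def TileAt [Finite α] (b : α) (η : Type) [Finite η] (D : ℝ) : Prop :=
  ∃ (κ : Type) (_ : Finite κ), ∀ E : Set (κ → Option α), Insensitive b E →
    ∃ E' ⊆ E, density E' ≤ D ∧ ∀ f, NonposOn η f → avg ((E \ E').indicator f) ≤ 0

end Insensitive

section Tiling

variable {α ι κ η μ ν : Type}

lemma density_diff {X : Type*} [Finite X] {A B : Set X} (h : B ⊆ A) :
    density (A \ B) = density A - density B := by
  rw [density, density, density, ← avg_sub]
  congr 1
  funext x
  by_cases hA : x ∈ A <;> by_cases hB : x ∈ B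
  · simp [hA, hB]
  · simp [hA, hB]
  · exact absurd (h hB) hA
  · simp [hA, hB]

lemma TileAt.step [Finite α] {b : α} [Finite η] {ε D : ℝ} (hε : 0 < ε) [Finite μ]
    (hμ : ∀ E : Set (μ → Option α), Insensitive b E → ε ≤ density E →
      ∃ g : μ → Option α ⊕ η, Proper g ∧ ∀ x, sub g x ∈ E)
    (h : TileAt b η D) :
    TileAt b η ((1 - 1 / Nat.card (μ → Option α)) * D + 1 / Nat.card (μ → Option α) * ε) := by
  classical
  obtain ⟨κ, hκ, H⟩ := h
  choose! T hTsub hTd hTf using H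
  choose! G hG hGE using hμ
  have hcard : (1 : ℝ) ≤ Nat.card (μ → Option α) := by exact_mod_cast Nat.card_pos
  set c : ℝ := 1 / Nat.card (μ → Option α) with hc
  have hc0 : 0 < c := by positivity
  have hc1 : c ≤ 1 := by rw [hc, div_le_one (by positivity)]; exact hcard
  refine ⟨κ ⊕ μ, inferInstance, fun E hE => ?_⟩
  set S : (μ → Option α) → Set (κ → Option α) := fun v => {u | Sum.elim u v ∈ E} with hS
  have hSins : ∀ v, Insensitive b (S v) := by
    intro v u u' hu h1
    refine hE _ _ (fun i => ?_) h1
    rcases i with i | i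
    · exact hu i
    · rfl
  have hScongr : ∀ v v' : μ → Option α, (∀ i, (v i).getD b = (v' i).getD b) → S v = S v' := by
    intro v v' hv
    ext u
    constructor
    · intro h1
      refine hE _ _ (fun i => ?_) h1
      rcases i with i | i
      · rfl
      · exact hv i
    · intro h1
      refine hE _ _ (fun i => ?_) h1
      rcases i with i | i
      · rfl
      · exact (hv i).symm
  set E₁ : (κ → Option α) → Set (μ → Option α) := fun u => {v | u ∈ T (S v)} with hE₁
  have hE₁ins : ∀ u, Insensitive b (E₁ u) := by
    intro u v v' hv h1
    change u ∈ T (S v')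
    rw [← hScongr v v' hv]
    exact h1
  set R : (κ → Option α) → Set (μ → Option α) := fun u =>
    if ε ≤ density (E₁ u) then Set.range (sub (G (E₁ u))) else ∅ with hR
  have hRsub : ∀ u, R u ⊆ E₁ u := by
    intro u
    simp only [hR]
    split_ifs with h1
    · rintro _ ⟨x, rfl⟩
      exact hGE _ (hE₁ins u) h1 x
    · exact Set.empty_subset _
  refine ⟨{z | z ∘ Sum.inr ∈ E₁ (z ∘ Sum.inl) \ R (z ∘ Sum.inl)}, ?_, ?_, ?_⟩
  · intro z hz
    have h1 := hTsub _ (hSins _) hz.1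
    rw [hS, Set.mem_ofPred_eq, Sum.elim_comp_inl_inr] at h1
    exact h1
  · rw [density_sum_arrow]
    simp only [Set.mem_ofPred_eq, Sum.elim_comp_inl, Sum.elim_comp_inr]
    have h1 : ∀ u, density (E₁ u \ R u) ≤ (1 - c) * density (E₁ u) + c * ε := by
      intro u
      rw [density_diff (hRsub u)]
      have h2 := density_le_one (E₁ u)
      by_cases h3 : ε ≤ density (E₁ u)
      · have h4 : c ≤ density (R u) := by
          rw [hc, ← density_singleton (sub (G (E₁ u)) fun _ => none)]
          refine density_mono ?_
          rw [Set.singleton_subset_iff, hR]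
          simp only [h3, if_true]
          exact ⟨_, rfl⟩
        nlinarith
      · have h4 := density_nonneg (R u)
        push Not at h3
        nlinarith
    calc avg (fun u => density (E₁ u \ R u))
        ≤ avg (fun u => (1 - c) * density (E₁ u) + c * ε) := avg_mono h1
      _ = (1 - c) * avg (fun v => density (T (S v))) + c * ε := by
          rw [avg_add, avg_const_mul, avg_const]
          congr 2
          exact avg_density_comm fun u v => u ∈ T (S v)
      _ ≤ (1 - c) * avg (fun _ : μ → Option α => D) + c * ε := by
          have : 0 ≤ 1 - c := by linarith
          gcongr
          exact avg_mono fun v => hTd _ (hSins v)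
      _ = (1 - c) * D + c * ε := by rw [avg_const]
  · intro f hf
    rw [avg_sum_arrow]
    have h1 : ∀ u v, (E \ {z | z ∘ Sum.inr ∈ E₁ (z ∘ Sum.inl) \ R (z ∘ Sum.inl)}).indicator f
        (Sum.elim u v) = (S v \ T (S v)).indicator (fun u => f (Sum.elim u v)) u +
          (R u).indicator (fun v => f (Sum.elim u v)) v := by
      intro u v
      have h2 : Sum.elim u v ∈ E ↔ u ∈ S v := Iff.rfl
      have h3 : u ∈ T (S v) → u ∈ S v := fun h => hTsub _ (hSins v) h
      have h4 : v ∈ R u → u ∈ T (S v) := fun h => hRsub u h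
      have h5 : v ∈ E₁ u ↔ u ∈ T (S v) := Iff.rfl
      simp only [Set.indicator_apply, Set.mem_sdiff, Set.mem_ofPred_eq, Sum.elim_comp_inl,
        Sum.elim_comp_inr, h2, h5]
      by_cases h6 : v ∈ R u
      · simp [h6, h4 h6, h3 (h4 h6)]
      · by_cases h7 : u ∈ T (S v)
        · simp [h6, h7]
        · simp [h6, h7]
    simp only [h1, avg_add]
    have h2 : avg (fun u => avg fun v =>
        (S v \ T (S v)).indicator (fun u => f (Sum.elim u v)) u) ≤ 0 := by
      rw [avg_comm]
      refine avg_nonpos fun v => hTf _ (hSins v) _ ?_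
      simpa only [sub_fixRight] using hf.comp_sub (proper_fixRight (ι := κ) v)
    have h3 : avg (fun u => avg fun v =>
        (R u).indicator (fun v => f (Sum.elim u v)) v) ≤ 0 := by
      refine avg_nonpos fun u => ?_
      by_cases h4 : ε ≤ density (E₁ u)
      · have h5 : R u = Set.range (sub (G (E₁ u))) := by simp [hR, h4]
        have h6 := hG _ (hE₁ins u) h4
        rw [h5]
        refine avg_indicator_range_nonpos h6.sub_injective ?_
        have h7 := hf.comp_sub (proper_fixLeft (κ := μ) u)
        simp only [sub_fixLeft] at h7
        exact h7 _ h6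
      · have h5 : R u = ∅ := by simp [hR, h4]
        simp [h5, avg_nonpos]
    linarith

lemma DHJ.exists_tileAt [Finite α] (h : DHJ α) (b : α) (η : Type) [Finite η] {ε : ℝ} (hε : 0 < ε) :
    ∃ D ≤ ε, TileAt b η D := by
  obtain ⟨μ, hμ, H⟩ := h.exists_subspace_of_insensitive b η (half_pos hε)
  have hcard : (1 : ℝ) ≤ Nat.card (μ → Option α) := by exact_mod_cast Nat.card_pos
  set c : ℝ := 1 / Nat.card (μ → Option α) with hc
  have hc0 : 0 < c := by positivity
  have h1 : ∀ n : ℕ, TileAt b η (ε / 2 + (1 - c) ^ n) := by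
    intro n
    induction n with
    | zero =>
      refine ⟨Empty, inferInstance, fun E _ => ⟨E, le_rfl, ?_, fun f _ => ?_⟩⟩
      · have := density_le_one E
        rw [pow_zero]
        linarith
      · simp [avg_nonpos]
    | succ n ih =>
      convert TileAt.step (half_pos hε) H ih using 1
      rw [← hc]
      ring
  obtain ⟨n, hn⟩ := exists_pow_lt_of_lt_one (half_pos hε) (show 1 - c < 1 by linarith)
  exact ⟨_, by linarith, h1 n⟩

/-- A function bounded by one which is nonpositive on average on every subspace has small average
over any insensitive set. -/
lemma DHJ.avg_insensitive_le [Finite α] (h : DHJ α) (b : α) (η : Type) [Finite η]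
    {ε : ℝ} (hε : 0 < ε) : ∃ (κ : Type) (_ : Finite κ), ∀ f : (κ → Option α) → ℝ, (∀ x, f x ≤ 1) →
      NonposOn η f → ∀ E, Insensitive b E → avg (E.indicator f) ≤ ε := by
  obtain ⟨D, hD, κ, hκ, H⟩ := h.exists_tileAt b η hε
  refine ⟨κ, hκ, fun f hf1 hf E hE => ?_⟩
  obtain ⟨E', hE', hd, hE'f⟩ := H E hE
  have h1 : avg (E.indicator f) ≤ avg (fun x => (E \ E').indicator f x + E'.indicator 1 x) := by
    refine avg_mono fun x => ?_
    by_cases hx : x ∈ E'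
    · simp [hx, hE' hx, hf1 x]
    · by_cases hxE : x ∈ E <;> simp [hx, hxE]
  rw [avg_add] at h1
  have := hE'f f hf
  rw [density] at hd
  linarith

/-- The same for intersections of sets insensitive to various letters. -/
lemma DHJ.avg_iInter_insensitive_le [Finite α] (h : DHJ α) (s : Finset α) :
    ∀ (η : Type) [Finite η] (ε : ℝ), 0 < ε → ∃ (κ : Type) (_ : Finite κ),
      ∀ f : (κ → Option α) → ℝ, (∀ x, f x ≤ 1) → NonposOn η f →
        ∀ E : α → Set (κ → Option α), (∀ a, Insensitive a (E a)) →
          avg ((⋂ a ∈ s, E a).indicator f) ≤ ε := by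
  classical
  induction s using Finset.induction_on with
  | empty =>
    intro η _ ε hε
    refine ⟨η, inferInstance, fun f _ hf E _ => ?_⟩
    have h1 := hf Sum.inr fun e => ⟨e, rfl⟩
    simp only [Finset.notMem_empty, Set.iInter_of_empty, Set.iInter_univ, Set.indicator_univ]
    exact h1.trans hε.le
  | insert b s _ ih =>
    intro η _ ε hε
    obtain ⟨κ₁, _, H₁⟩ := ih η (ε / 2) (half_pos hε)
    obtain ⟨κ, hκ, H⟩ := h.avg_insensitive_le b κ₁ (half_pos hε)
    refine ⟨κ, hκ, fun f hf1 hf E hE => ?_⟩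
    have h1 := H (fun x => (⋂ a ∈ s, E a).indicator f x - ε / 2) (fun x => ?_) (fun g hg => ?_)
      (E b) (hE b)
    · have h2 : avg ((⋂ a ∈ insert b s, E a).indicator f) ≤
          avg (fun x => (E b).indicator (fun x => (⋂ a ∈ s, E a).indicator f x - ε / 2) x
            + ε / 2) := by
        refine avg_mono fun x => ?_
        rw [Finset.set_biInter_insert]
        by_cases hx : x ∈ E b
        · simp only [Set.indicator_apply, Set.mem_inter_iff, hx, true_and, if_true]
          linarith
        · simp only [Set.indicator_apply, Set.mem_inter_iff, hx, false_and, if_false]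
          linarith
      rw [avg_add, avg_const] at h2
      linarith
    · by_cases hx : x ∈ ⋂ a ∈ s, E a
      · rw [Set.indicator_of_mem hx]
        linarith [hf1 x]
      · rw [Set.indicator_of_notMem hx]
        linarith
    · rw [avg_sub, avg_const]
      have h3 := H₁ (fun x => f (sub g x)) (fun x => hf1 _) (hf.comp_sub hg)
        (fun a => sub g ⁻¹' E a) fun a => (hE a).sub g
      have h4 : (⋂ a ∈ s, sub g ⁻¹' E a).indicator (fun x => f (sub g x)) =
          fun x => (⋂ a ∈ s, E a).indicator f (sub g x) := by
        funext x
        simp [Set.indicator_apply]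
      rw [h4] at h3
      linarith

/-- The same for complements of intersections. -/
lemma DHJ.avg_compl_iInter_insensitive_le [Fintype α] (h : DHJ α) (η : Type) [Finite η]
    {ε : ℝ} (hε : 0 < ε) : ∃ (κ : Type) (_ : Finite κ), ∀ f : (κ → Option α) → ℝ, (∀ x, f x ≤ 1) →
      NonposOn η f → ∀ D : α → Set (κ → Option α), (∀ a, Insensitive a (D a)) →
        avg ((⋂ a, D a)ᶜ.indicator f) ≤ Fintype.card α * ε := by
  classical
  obtain ⟨κ, hκ, H⟩ := h.avg_iInter_insensitive_le Finset.univ η ε hε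
  refine ⟨κ, hκ, fun f hf1 hf D hD => ?_⟩
  simp only [Finset.mem_univ, Set.iInter_true] at H
  have key : ∀ (s : Finset α) (F : α → Set (κ → Option α)), (∀ a, Insensitive a (F a)) →
      avg (((⋂ a, F a) \ ⋂ a ∈ s, D a).indicator f) ≤ #s * ε := by
    intro s
    induction s using Finset.induction_on with
    | empty => intro F _; simp [avg_nonpos]
    | insert b s hb ih =>
      intro F hF
      have h1 : ∀ B, Insensitive b B →
          ∀ a, Insensitive a (Function.update F b (F b ∩ B) a) := by
        intro B hB a
        by_cases ha : a = b
        · subst ha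
          simpa using (hF a).inter hB
        · simpa [ha] using hF a
      have h2 : ∀ B, (⋂ a, Function.update F b (F b ∩ B) a) = (⋂ a, F a) ∩ B := by
        intro B
        ext x
        simp only [Set.mem_iInter, Set.mem_inter_iff]
        constructor
        · intro hx
          have hxb := hx b
          simp only [Function.update_self, Set.mem_inter_iff] at hxb
          refine ⟨fun a => ?_, hxb.2⟩
          by_cases ha : a = b
          · exact ha ▸ hxb.1
          · simpa [ha] using hx a
        · rintro ⟨hx, hxB⟩ a
          by_cases ha : a = b
          · subst ha
            simpa using ⟨hx a, hxB⟩
          · simpa [ha] using hx a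
      have h3 := H f hf1 hf _ (h1 _ (hD b).compl)
      have h4 := ih _ (h1 _ (hD b))
      rw [h2] at h3 h4
      have h5 : ((⋂ a, F a) \ ⋂ a ∈ insert b s, D a).indicator f = fun x =>
          ((⋂ a, F a) ∩ (D b)ᶜ).indicator f x +
            (((⋂ a, F a) ∩ D b) \ ⋂ a ∈ s, D a).indicator f x := by
        funext x
        rw [Finset.set_biInter_insert]
        by_cases hx : x ∈ D b <;> by_cases hx2 : x ∈ ⋂ a, F a <;>
          simp [Set.indicator_apply, hx, hx2, -Set.mem_iInter]
      rw [h5, avg_add, Finset.card_insert_of_notMem hb]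
      push_cast
      linarith
  have h1 := key Finset.univ (fun _ => Set.univ) fun a _ _ _ _ => trivial
  simpa [Set.compl_eq_univ_sdiff] using h1

end Tiling

section GrahamRothschild

variable {α ι κ η μ ν : Type}

/-- Extend a subspace over `α` to the alphabet `Option α`. -/
def lift (g : ι → α ⊕ η) : ι → Option α ⊕ η := fun i => (g i).map some id

lemma Proper.lift {g : ι → α ⊕ η} (hg : Proper g) : Proper (lift g) := by
  intro e
  obtain ⟨i, hi⟩ := hg e
  exact ⟨i, by simp [DensityHalesJewett.lift, hi]⟩

lemma sub_lift_subComp (g : ι → α ⊕ κ) (h : κ → α ⊕ η) (w : η → Option α) :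
    sub (lift (subComp g h)) w = sub (lift g) (sub (lift h) w) := by
  funext i
  simp only [sub, lift, subComp]
  rcases g i with a | e <;> rfl

lemma fill_some_sub_lift (g : ι → α ⊕ η) (w : η → Option α) (a : α) :
    fill a (sub (lift g) w) = sub g (fill a w) := by
  funext i
  simp only [sub, lift, fill]
  rcases g i with a | e <;> rfl

/-- In high dimension, every colouring of variable words restricts to a subspace on which the colour
only depends on the places of the variable. -/
lemma exists_subspace_color_isNone [Finite α] [Nonempty α] (η : Type) [Finite η] :
    ∀ (C : Type) [Finite C], ∃ (ι : Type) (_ : Finite ι), ∀ c : (ι → Option α) → C,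
      ∃ g : ι → α ⊕ η, Proper g ∧ ∀ w w' : η → Option α, (∀ e, w e = none ↔ w' e = none) →
        c (sub (lift g) w) = c (sub (lift g) w') := by
  induction η using Finite.induction_empty_option with
  | of_equiv e ih =>
    intro C _
    obtain ⟨ι, hι, H⟩ := ih C
    refine ⟨ι, hι, fun c => ?_⟩
    obtain ⟨g, hg, hc⟩ := H c
    refine ⟨fun i => (g i).map id e, fun b => ?_, fun w w' hw => ?_⟩
    · obtain ⟨i, hi⟩ := hg (e.symm b)
      exact ⟨i, by simp [hi]⟩
    · have h : ∀ w, sub (lift fun i => (g i).map id e) w = sub (lift g) (w ∘ e) := by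
        intro w
        funext i
        simp only [sub, lift]
        rcases g i with a | e <;> rfl
      rw [h, h]
      exact hc _ _ fun b => hw (e b)
  | h_empty =>
    intro C _
    refine ⟨Empty, inferInstance, fun c => ⟨Empty.elim, fun e => e.elim, fun w w' _ => ?_⟩⟩
    congr 1
    funext i
    exact i.elim
  | @h_option η _ ih =>
    intro C _
    obtain ⟨ι₁, hι₁, H₁⟩ := ih (C × C)
    obtain ⟨ι₂, hι₂, H₂⟩ :=
      Combinatorics.Line.exists_mono_in_high_dimension α ((ι₁ → Option α) → C)
    refine ⟨ι₁ ⊕ ι₂, inferInstance, fun c => ?_⟩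
    obtain ⟨l, d, hl⟩ := H₂ fun v u => c (Sum.elim u fun j => some (v j))
    have a₀ : α := Classical.arbitrary α
    set pt : Option α → ι₂ → Option α := fun x j => (l.idxFun j).elim x some with hpt
    have hptc : ∀ a u, c (Sum.elim u (pt (some a))) = d u := by
      intro a u
      rw [← hl a]
      congr 2
      funext j
      simp only [hpt, Combinatorics.Line.coe_apply]
      rcases l.idxFun j <;> rfl
    obtain ⟨g, hg, hc⟩ := H₁ fun u => (c (Sum.elim u (pt none)), d u)
    refine ⟨Sum.elim (fun i => (g i).map id some)
      (fun j => (l.idxFun j).elim (Sum.inr none) Sum.inl), fun e => ?_, fun w w' hw => ?_⟩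
    · rcases e with _ | e
      · obtain ⟨j, hj⟩ := l.proper
        exact ⟨Sum.inr j, by simp [hj]⟩
      · obtain ⟨i, hi⟩ := hg e
        exact ⟨Sum.inl i, by simp [hi]⟩
    · have h : ∀ w, sub (lift (Sum.elim (fun i => (g i).map id some)
          (fun j => (l.idxFun j).elim (Sum.inr none) Sum.inl))) w =
          Sum.elim (sub (lift g) fun e => w (some e)) (pt (w none)) := by
        intro w
        funext i
        rcases i with i | j
        · simp only [sub, lift, Sum.elim_inl]
          rcases g i <;> rfl
        · simp only [sub, lift, Sum.elim_inr, hpt]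
          rcases l.idxFun j <;> rfl
      rw [h, h]
      have h2 := hc (fun e => w (some e)) (fun e => w' (some e)) fun e => hw (some e)
      rw [Prod.mk.injEq] at h2
      rcases hx : w none with _ | a
      · rw [(hw none).mp hx]
        exact h2.1
      · rcases hx' : w' none with _ | a'
        · rw [(hw none).mpr hx'] at hx
          cases hx
        · rw [hptc, hptc]
          exact h2.2

/-- The indicator of the union of the blocks of `g` selected by `s`. -/
def blocks (g : ι → Option η) (s : η → Bool) : ι → Bool := fun i => (g i).elim false s

lemma exists_blocks (κ : Type) [Finite κ] (η : Type) [Finite η] :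
    ∃ (ι : Type) (_ : Finite ι), ∀ c : (ι → Bool) → Prop,
      (∃ g : ι → Option (Option κ), (∀ e, ∃ i, g i = some e) ∧
        ∀ s : κ → Bool, c (blocks g fun o => o.elim true s)) ∨
      ∃ g : ι → Option η, (∀ e, ∃ i, g i = some e) ∧
        ∀ s : η → Bool, (∃ e, s e = true) → ¬ c (blocks g s) := by
  induction η using Finite.induction_empty_option with
  | of_equiv e ih =>
    obtain ⟨ι, hι, H⟩ := ih
    refine ⟨ι, hι, fun c => (H c).imp_right ?_⟩
    rintro ⟨g, hg, hc⟩
    refine ⟨fun i => (g i).map e, fun b => ?_, ?_⟩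
    · obtain ⟨i, hi⟩ := hg (e.symm b)
      exact ⟨i, by simp [hi]⟩
    · rintro s ⟨b, hb⟩
      have h : blocks (fun i => (g i).map e) s = blocks g (s ∘ e) := by
        funext i
        simp only [blocks]
        rcases g i <;> rfl
      rw [h]
      exact hc _ ⟨e.symm b, by simpa using hb⟩
  | h_empty =>
    exact ⟨Empty, inferInstance, fun c => Or.inr ⟨Empty.elim, fun e => e.elim,
      fun s ⟨e, _⟩ => e.elim⟩⟩
  | @h_option η _ ih =>
    obtain ⟨ι₁, hι₁, H₁⟩ := ih
    obtain ⟨ι₂, hι₂, H₂⟩ :=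
      Combinatorics.Subspace.exists_mono_in_high_dimension Bool Prop (κ ⊕ ι₁)
    refine ⟨Option ι₂, inferInstance, fun c => ?_⟩
    obtain ⟨U, d, hU⟩ := H₂ fun t => c fun o => o.elim true t
    by_cases hd : d
    · left
      refine ⟨fun o => o.elim (some none) fun i => (U.idxFun i).elim
        (fun b => if b then some none else none) (fun e => e.elim (fun x => some (some x))
          fun _ => none), fun e => ?_, fun s => ?_⟩
      · rcases e with _ | e
        · exact ⟨none, rfl⟩
        · obtain ⟨i, hi⟩ := U.proper (Sum.inl e)
          exact ⟨some i, by simp [hi]⟩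
      · have h1 := (hU (Sum.elim s fun _ => false)).symm ▸ hd
        convert h1 using 1
        funext o
        rcases o with _ | i
        · rfl
        · simp only [blocks, Option.elim_some, Combinatorics.Subspace.coe_apply]
          rcases U.idxFun i with b | e | e
          · cases b <;> rfl
          · rfl
          · rfl
    · have hbad : ∀ t, ¬ c fun o => o.elim true (U t) := by
        intro t h1
        exact hd ((hU t) ▸ h1)
      set V : (ι₁ → Bool) → Option ι₂ → Bool := fun t o => o.elim false fun i =>
        (U.idxFun i).elim (fun _ => false) (fun e => e.elim (fun _ => false) t) with hV
      rcases H₁ (fun t => c (V t)) with ⟨g, hg, hc⟩ | ⟨g, hg, hc⟩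
      · left
        refine ⟨fun o => o.elim none fun i => (U.idxFun i).elim (fun _ => none)
          (fun e => e.elim (fun _ => none) g), fun e => ?_, fun s => ?_⟩
        · obtain ⟨j, hj⟩ := hg e
          obtain ⟨i, hi⟩ := U.proper (Sum.inr j)
          exact ⟨some i, by simp [hi, hj]⟩
        · convert hc s using 1
          funext o
          rcases o with _ | i
          · rfl
          · simp only [blocks, hV, Option.elim_some]
            rcases U.idxFun i with b | e | e <;> rfl
      · right
        refine ⟨fun o => o.elim (some none) fun i => (U.idxFun i).elim
          (fun b => if b then some none else none) (fun e => e.elim (fun _ => none)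
            fun j => (g j).map some), fun e => ?_, fun s hs => ?_⟩
        · rcases e with _ | e
          · exact ⟨none, rfl⟩
          · obtain ⟨j, hj⟩ := hg e
            obtain ⟨i, hi⟩ := U.proper (Sum.inr j)
            exact ⟨some i, by simp [hi, hj]⟩
        · rcases hs0 : s none with _ | _
          · have h1 : ∃ e, s (some e) = true := by
              obtain ⟨e, he⟩ := hs
              rcases e with _ | e
              · rw [hs0] at he
                cases he
              · exact ⟨e, he⟩
            convert hc (fun e => s (some e)) h1 using 2
            funext o
            rcases o with _ | i
            · exact hs0
            · simp only [blocks, hV, Option.elim_some]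
              rcases U.idxFun i with b | e | e
              · cases b
                · rfl
                · exact hs0
              · rfl
              · simp only [Sum.elim_inr, blocks]
                rcases g e <;> rfl
          · convert hbad (Sum.elim (fun _ => false) (blocks g fun e => s (some e))) using 2
            funext o
            rcases o with _ | i
            · exact hs0
            · simp only [blocks, Option.elim_some, Combinatorics.Subspace.coe_apply]
              rcases U.idxFun i with b | e | e
              · cases b
                · rfl
                · exact hs0
              · rfl
              · simp only [Sum.elim_inr, blocks]
                rcases g e <;> rfl

/-- A two-colour, asymmetric form of the Graham-Rothschild theorem for variable words. -/
lemma exists_good_or_bad_subspace [Finite α] [Nonempty α] (κ η : Type) [Finite κ] [Finite η] :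
    ∃ (ι : Type) (_ : Finite ι), ∀ good : (ι → Option α) → Prop,
      (∃ g : ι → α ⊕ Option κ, Proper g ∧
        ∀ w : κ → Option α, good (sub (lift g) fun o => o.elim none w)) ∨
      ∃ g : ι → α ⊕ η, Proper g ∧
        ∀ w : η → Option α, (∃ e, w e = none) → ¬ good (sub (lift g) w) := by
  obtain ⟨μ, hμ, H₂⟩ := exists_blocks κ η
  obtain ⟨ι, hι, H₁⟩ := exists_subspace_color_isNone (α := α) μ Prop
  refine ⟨ι, hι, fun good => ?_⟩
  have a₀ : α := Classical.arbitrary α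
  obtain ⟨g, hg, hc⟩ := H₁ good
  have key : ∀ {X : Type} (h : μ → Option X) (w : X → Option α),
      good (sub (lift (subComp g fun i => (h i).elim (Sum.inl a₀) Sum.inr)) w) =
        good (sub (lift g) fun i => if blocks h (fun e => (w e).isNone) i then none
          else some a₀) := by
    intro X h w
    rw [sub_lift_subComp]
    refine hc _ _ fun i => ?_
    rcases hi : h i with _ | e
    · simp [sub, lift, blocks, hi]
    · rcases hw : w e <;> simp [sub, lift, blocks, hi, hw]
  have hproper : ∀ {X : Type} (h : μ → Option X), (∀ e, ∃ i, h i = some e) →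
      Proper (subComp g fun i => (h i).elim (Sum.inl a₀) Sum.inr) := by
    intro X h hh
    refine hg.subComp fun e => ?_
    obtain ⟨i, hi⟩ := hh e
    exact ⟨i, by simp [hi]⟩
  rcases H₂ fun s => good (sub (lift g) fun i => if s i then none else some a₀) with
    ⟨h, hh, hgood⟩ | ⟨h, hh, hbad⟩
  · left
    refine ⟨_, hproper h hh, fun w => ?_⟩
    rw [key]
    convert hgood (fun e => (w e).isNone) using 7 with i o
    rcases o <;> rfl
  · right
    refine ⟨_, hproper h hh, fun w hw => ?_⟩
    rw [key]
    obtain ⟨e, he⟩ := hw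
    exact hbad _ ⟨e, by simp [he]⟩

end GrahamRothschild

section Step

variable {α ι κ η μ : Type}

lemma hasLine_of_slice {β : Type} {A : Set (ι ⊕ μ → β)} (x : ι → β)
    (h : HasLine {y | Sum.elim x y ∈ A}) : HasLine A := by
  refine HasLine.of_sub (proper_fixLeft (κ := μ) x) ?_
  convert h using 1
  ext y
  simp [sub_fixLeft]

/-- If a word containing `none` lies in `A`, together with all its fillings, then `A` contains
a line. -/
lemma hasLine_of_forall_fill {A : Set (ι ⊕ μ → Option α)} {W : ι → Option α} {y : μ → Option α}
    (hW : ∃ i, W i = none) (h : Sum.elim W y ∈ A)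
    (h' : ∀ a, Sum.elim (fun i => some (fill a W i)) y ∈ A) : HasLine A := by
  obtain ⟨i₀, hi₀⟩ := hW
  refine ⟨Sum.elim (fun i => (W i).map some) fun j => some (y j), ⟨Sum.inl i₀, by simp [hi₀]⟩, ?_⟩
  rintro (_ | a)
  · convert h using 1
    funext i
    rcases i with i | j
    · simp only [fill, Sum.elim_inl]
      rcases W i <;> rfl
    · rfl
  · convert h' a using 1
    funext i
    rcases i with i | j
    · simp only [fill, Sum.elim_inl]
      rcases W i <;> rfl
    · rfl

lemma hasLine_of_lift_none {A : Set (ι ⊕ μ → Option α)} {g : ι → α ⊕ Option κ} (hg : Proper g)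
    (y : μ → Option α)
    (h : HasLine {w : κ → Option α | Sum.elim (sub (lift g) fun o => o.elim none w) y ∈ A}) :
    HasLine A := by
  refine HasLine.of_sub (g := Sum.elim (fun i => (g i).elim (fun a => Sum.inl (some a))
    fun o => o.elim (Sum.inl none) Sum.inr) fun j => Sum.inl (y j)) (fun e => ?_) ?_
  · obtain ⟨i, hi⟩ := hg (some e)
    exact ⟨Sum.inl i, by simp [hi]⟩
  · convert h using 1
    ext w
    simp only [Set.mem_preimage, Set.mem_ofPred_eq]
    convert Iff.rfl using 2
    funext i
    rcases i with i | j
    · simp only [sub, lift, Sum.elim_inl]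
      rcases g i with a | _ | e <;> rfl
    · rfl

/-- A function whose average is close to its upper bound is everywhere close to it. -/
lemma le_of_le_avg {X : Type} [Finite X] [Nonempty X] {f : X → ℝ} {c γ : ℝ}
    (hf : ∀ x, f x ≤ c + γ) (h : c - γ ≤ avg f) (x : X) : c - 2 * Nat.card X * γ ≤ f x := by
  classical
  have := Fintype.ofFinite X
  have hX : (0 : ℝ) < Nat.card X := by exact_mod_cast Nat.card_pos
  have h1 : c + γ - f x ≤ ∑ z, (c + γ - f z) :=
    Finset.single_le_sum (f := fun z => c + γ - f z) (fun z _ => sub_nonneg.2 (hf z))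
      (Finset.mem_univ x)
  have h2 : ∑ z, f z = Nat.card X * avg f := by
    rw [avg_eq, Nat.card_eq_fintype_card]
    rw [Nat.card_eq_fintype_card] at hX
    field_simp
  rw [Finset.sum_sub_distrib, h2, Finset.sum_const, Finset.card_univ, ← Nat.card_eq_fintype_card,
    nsmul_eq_mul] at h1
  have h3 : f x ≤ c + γ := hf x
  have h4 : Nat.card X * (c - γ) ≤ Nat.card X * avg f := by gcongr
  have h7 : 0 ≤ γ := by
    have h8 := avg_mono (fun z => hf z)
    rw [avg_const] at h8
    linarith
  linarith

/-- In a line-free set, the slices over a subspace have no density increment off the set where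
all fillings lie in the set. -/
lemma density_slice_le [Fintype α] [Finite ι] [Finite μ] {A : Set (ι ⊕ μ → Option α)}
    (hA : ¬ HasLine A) {c ε : ℝ} (hc : 0 ≤ c) [Finite η]
    (hη : ∀ B : Set (η → Option α), c ≤ density B → HasLine B) [Finite κ]
    (hκ : ∀ f : (κ → Option α) → ℝ, (∀ x, f x ≤ 1) → NonposOn η f →
      ∀ D : α → Set (κ → Option α), (∀ a, Insensitive a (D a)) →
        avg ((⋂ a, D a)ᶜ.indicator f) ≤ Fintype.card α * ε)
    {g : ι → α ⊕ Option κ} (hg : Proper g) (y : μ → Option α) :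
    density {w : κ → Option α | Sum.elim (sub (lift g) fun o => o.elim none w) y ∈ A} ≤
      c * (1 - density {w : κ → Option α | ∀ a, Sum.elim
        (fun i => some (fill a (sub (lift g) fun o => o.elim none w) i)) y ∈ A}) +
        Fintype.card α * ε := by
  set W : (κ → Option α) → ι → Option α := fun w => sub (lift g) fun o => o.elim none w with hW
  set A' : Set (κ → Option α) := {w | Sum.elim (W w) y ∈ A} with hA'
  set D : α → Set (κ → Option α) :=
    fun a => {w | Sum.elim (fun i => some (fill a (W w) i)) y ∈ A} with hD
  have hD' : {w : κ → Option α | ∀ a, Sum.elim (fun i => some (fill a (W w) i)) y ∈ A} =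
      ⋂ a, D a := by
    ext w
    simp [hD]
  have hdisj : ∀ w ∈ A', w ∉ ⋂ a, D a := by
    intro w hw h
    obtain ⟨i, hi⟩ := hg none
    exact hA (hasLine_of_forall_fill (W := W w) ⟨i, by simp [hW, sub, lift, hi]⟩ hw
      (Set.mem_iInter.1 h))
  have hins : ∀ a, Insensitive a (D a) := by
    intro a w w' hww' hw
    have h : fill a (W w) = fill a (W w') := by
      simp only [hW, fill_some_sub_lift]
      congr 1
      funext o
      rcases o with _ | e
      · rfl
      · exact hww' e
    simp only [hD, Set.mem_ofPred_eq] at hw ⊢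
    rwa [← h]
  have hnon : NonposOn η fun w => A'.indicator (1 : (κ → Option α) → ℝ) w - c := by
    intro g' hg'
    rw [avg_sub, avg_const]
    have h : ¬ c ≤ density (sub g' ⁻¹' A') :=
      fun h => hA (hasLine_of_lift_none hg y (HasLine.of_sub hg' (hη _ h)))
    have h2 : avg (fun x => A'.indicator (1 : (κ → Option α) → ℝ) (sub g' x)) =
        density (sub g' ⁻¹' A') := rfl
    linarith
  have hf1 : ∀ w, A'.indicator (1 : (κ → Option α) → ℝ) w - c ≤ 1 := fun w => by
    have h : A'.indicator (1 : (κ → Option α) → ℝ) w ≤ 1 :=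
      Set.indicator_le_self' (fun _ _ => zero_le_one) w
    linarith
  have h := hκ _ hf1 hnon D hins
  have h2 : (⋂ a, D a)ᶜ.indicator (fun w => A'.indicator (1 : (κ → Option α) → ℝ) w - c) =
      fun w => A'.indicator (1 : (κ → Option α) → ℝ) w -
        c * (1 - (⋂ a, D a).indicator (1 : (κ → Option α) → ℝ) w) := by
    funext w
    by_cases h3 : w ∈ ⋂ a, D a
    · have h4 : w ∉ A' := fun h4 => hdisj w h4 h3
      rw [Set.indicator_of_notMem (Set.notMem_compl_iff.2 h3), Set.indicator_of_notMem h4,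
        Set.indicator_of_mem h3]
      simp
    · rw [Set.indicator_of_mem (Set.mem_compl h3), Set.indicator_of_notMem h3]
      simp
  rw [h2, avg_sub, avg_const_mul, avg_sub, avg_const] at h
  rw [hD']
  change density A' - c * (1 - density (⋂ a, D a)) ≤ _ at h
  linarith

/-- The density Hales-Jewett property passes to an alphabet with one more letter. -/
lemma DHJ.option [Fintype α] [Nonempty α] (h : DHJ α) : DHJ (Option α) := by
  by_contra hcon
  simp only [DHJ, not_forall] at hcon
  obtain ⟨δ₀, hδ₀, hbad⟩ := hcon
  set S : Set ℝ := {δ | DHJAt (Option α) δ} with hS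
  have hup : ∀ δ ∈ S, ∀ δ' ≥ δ, δ' ∈ S := by
    rintro δ ⟨ι, hι, H⟩ δ' hδ'
    exact ⟨ι, hι, fun A hA => H A (hδ'.le.trans hA)⟩
  have h2S : (2 : ℝ) ∈ S :=
    ⟨Unit, inferInstance, fun A hA => by linarith [density_le_one A]⟩
  have hlow : ∀ δ ∈ S, δ₀ ≤ δ := by
    intro δ hδ
    by_contra! h'
    exact hbad (hup _ hδ _ h'.le)
  set δ : ℝ := sInf S with hδ
  have hδpos : 0 < δ := hδ₀.trans_le (le_csInf ⟨2, h2S⟩ hlow)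
  have habove : ∀ γ > 0, DHJAt (Option α) (δ + γ) := by
    intro γ hγ
    obtain ⟨δ', h1, h2⟩ := exists_lt_of_csInf_lt ⟨2, h2S⟩ (lt_add_of_pos_right δ hγ)
    exact hup _ h1 _ h2.le
  have hbelow : ∀ γ > 0, ∀ (ι : Type) [Finite ι],
      ∃ A : Set (ι → Option α), δ - γ ≤ density A ∧ ¬ HasLine A := by
    intro γ hγ ι hι
    by_contra! h'
    have h1 : δ ≤ δ - γ := csInf_le ⟨δ₀, hlow⟩ ⟨ι, hι, h'⟩
    linarith
  obtain ⟨ι₀, hι₀, H₀⟩ := h (δ / 4) (by positivity)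
  set θ : ℝ := δ / 4 / Nat.card (ι₀ → Option α) with hθ
  have hθpos : 0 < θ := by
    have : (0 : ℝ) < Nat.card (ι₀ → Option α) := by exact_mod_cast Nat.card_pos
    positivity
  have hcard : (0 : ℝ) < Fintype.card α := by exact_mod_cast Fintype.card_pos
  obtain ⟨η, hη, Hη⟩ := habove (δ * θ / 4) (by positivity)
  obtain ⟨κ, hκ, Hκ⟩ := h.avg_compl_iInter_insensitive_le η
    (ε := δ * θ / (4 * Fintype.card α)) (by positivity)
  obtain ⟨ι, hι, Hι⟩ := exists_good_or_bad_subspace (α := α) κ ι₀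
  have hn : (0 : ℝ) < Nat.card (ι → Option α) := by exact_mod_cast Nat.card_pos
  set γ : ℝ := δ * θ / (16 * Nat.card (ι → Option α)) with hγ
  have hγpos : 0 < γ := by positivity
  obtain ⟨μ, hμ, Hμ⟩ := habove γ hγpos
  obtain ⟨A, hA, hAl⟩ := hbelow γ hγpos (ι ⊕ μ)
  rw [density_sum_arrow] at hA
  have hθ1 : θ ≤ δ / 4 := div_le_self (by positivity) (by exact_mod_cast Nat.card_pos)
  have hslice : ∀ x : ι → Option α, δ - δ * θ / 8 ≤ density {y | Sum.elim x y ∈ A} := by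
    intro x
    have h1 := le_of_le_avg (fun x => le_of_not_ge fun h' => hAl (hasLine_of_slice x (Hμ _ h')))
      hA x
    have h2 : 2 * Nat.card (ι → Option α) * γ = δ * θ / 8 := by
      rw [hγ]
      field_simp
      norm_num
    rwa [h2] at h1
  have hδ2 : δ ≤ 2 := csInf_le ⟨δ₀, hlow⟩ h2S
  have hhalf : δ * θ / 8 ≤ δ / 2 := by nlinarith
  rcases Hι fun w => θ ≤ density {y | ∀ a, Sum.elim (fun i => some (fill a w i)) y ∈ A} with
    ⟨g, hg, hgood⟩ | ⟨g, hg, hgbad⟩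
  · have h1 : δ - δ * θ / 8 ≤ avg fun y => density {w : κ → Option α |
        Sum.elim (sub (lift g) fun o => o.elim none w) y ∈ A} := by
      rw [← avg_density_comm fun (w : κ → Option α) y =>
        Sum.elim (sub (lift g) fun o => o.elim none w) y ∈ A]
      exact (avg_const _).symm.le.trans (avg_mono fun w => hslice _)
    have h2 : θ ≤ avg fun y => density {w : κ → Option α | ∀ a, Sum.elim
        (fun i => some (fill a (sub (lift g) fun o => o.elim none w) i)) y ∈ A} := by
      rw [← avg_density_comm fun (w : κ → Option α) y => ∀ a, Sum.elim
        (fun i => some (fill a (sub (lift g) fun o => o.elim none w) i)) y ∈ A]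
      exact (avg_const _).symm.le.trans (avg_mono hgood)
    have h3 := avg_mono fun y => density_slice_le hAl (by positivity) Hη Hκ hg y
    rw [avg_add, avg_const_mul, avg_sub, avg_const, avg_const] at h3
    have h4 : Fintype.card α * (δ * θ / (4 * Fintype.card α)) = δ * θ / 4 := by
      field_simp
    rw [h4] at h3
    have h5 : 0 < δ * θ := by positivity
    nlinarith
  · obtain ⟨w, hw, hd⟩ := exists_line_density_ge (by positivity) H₀
      (fun u y => Sum.elim (fun i => some (sub g u i)) y ∈ A) (by
        refine le_trans ?_ (avg_mono fun u => hslice _)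
        rw [avg_const]
        linarith)
    refine hgbad w hw (hd.trans_eq ?_)
    simp only [fill_some_sub_lift]

end Step

section Main

/-- The density Hales-Jewett theorem. -/
theorem dhj (α : Type) [Finite α] [Nonempty α] : DHJ α := by
  refine Finite.induction_empty_option (P := fun α => ∀ _ : Finite α, Nonempty α → DHJ α)
    ?_ ?_ ?_ α ‹_› ‹_›
  · intro α β e ih hβ' hβ δ hδ
    have := Finite.of_equiv β e.symm
    have hα : Nonempty α := e.nonempty
    obtain ⟨ι, hι, H⟩ := ih inferInstance hα δ hδ
    refine ⟨ι, hι, fun A hA => ?_⟩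
    obtain ⟨w, hw, h⟩ := H ((fun x i => e (x i)) ⁻¹' A) (hA.trans_eq
      (avg_comp_equiv (Equiv.piCongrRight fun _ : ι => e) (A.indicator 1)).symm)
    refine ⟨fun i => (w i).map e, ?_, fun b => ?_⟩
    · obtain ⟨i, hi⟩ := hw
      exact ⟨i, by simp [hi]⟩
    · have h1 : fill b (fun i => (w i).map e) = fun i => e (fill (e.symm b) w i) := by
        funext i
        simp only [fill]
        rcases w i <;> simp
      rw [h1]
      exact h _
  · exact fun _ h => h.elim PEmpty.elim
  · intro α _ ih _ _
    rcases isEmpty_or_nonempty α with hα | hα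
    · intro δ hδ
      refine ⟨Unit, inferInstance, fun A hA => ?_⟩
      obtain ⟨x, hx⟩ := density_pos_nonempty (hδ.trans_le hA)
      refine ⟨fun _ => none, ⟨(), rfl⟩, fun a => ?_⟩
      rwa [Subsingleton.elim (fill a fun _ => none) x]
    · exact (ih inferInstance hα).option

/-- Sets of positive upper density contain progressions with arbitrarily large differences. -/
theorem exists_ap_of_upperDensity_pos (k : ℕ) {A : Set ℕ} (hA : 0 < upperDensity A)
    (L : ℕ) : ∃ d ≥ L, ∃ m : ℕ, ∀ j ≤ k, m + j * d ∈ A := by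
  classical
  set u : ℕ → ℝ := fun N => (∑ n ∈ Finset.Icc 1 N, A.indicator (fun _ => (1 : ℝ)) n) / N with hu
  set δ := upperDensity A with hδ
  replace hδ : δ = limsup u atTop := hδ
  obtain ⟨ι, hι, H⟩ := dhj (Fin (k + 1)) (δ / 8) (by positivity)
  have := Fintype.ofFinite ι
  set φ : (ι → Fin (k + 1)) → ℕ := fun x => (L + 1) * ∑ i, (x i : ℕ) with hφ
  obtain ⟨T, hT⟩ := (Set.finite_range φ).bddAbove
  replace hT : ∀ x, φ x ≤ T := fun x => hT ⟨x, rfl⟩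
  have hfreq : ∃ᶠ N in atTop, δ / 2 < u N := by
    refine Filter.frequently_lt_of_lt_limsup ?_ ((half_lt_self hA).trans_eq hδ)
    exact (isBoundedUnder_of ⟨0, fun N => div_nonneg (Finset.sum_nonneg fun n _ =>
      Set.indicator_nonneg (fun _ _ => zero_le_one) n) (Nat.cast_nonneg N)⟩).isCoboundedUnder_le
  obtain ⟨N, hN, hNT⟩ := (hfreq.and_eventually
    (eventually_ge_atTop (max 1 ⌈4 * T / δ⌉₊))).exists
  have hN1 : (1 : ℝ) ≤ N := by exact_mod_cast (le_max_left _ _).trans hNT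
  have hTN : 4 * T / δ ≤ N := (Nat.le_ceil _).trans (by exact_mod_cast (le_max_right _ _).trans hNT)
  have hsum : δ / 2 * N < ∑ n ∈ Finset.Icc 1 N, A.indicator (fun _ => (1 : ℝ)) n := by
    rwa [hu, lt_div_iff₀ (by linarith)] at hN
  rw [div_le_iff₀ hA] at hTN
  have hx : ∀ x, δ / 4 * N ≤
      ∑ m ∈ Finset.range (N + 1), A.indicator (fun _ => (1 : ℝ)) (m + φ x) := by
    intro x
    have h1 : ∑ n ∈ Finset.Icc 1 N, A.indicator (fun _ => (1 : ℝ)) n ≤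
        ∑ n ∈ Finset.range (φ x + (N + 1)), A.indicator (fun _ => (1 : ℝ)) n := by
      refine Finset.sum_le_sum_of_subset_of_nonneg (fun n hn => ?_) fun n _ _ =>
        Set.indicator_nonneg (fun _ _ => zero_le_one) n
      rw [Finset.mem_Icc] at hn
      rw [Finset.mem_range]
      omega
    have h2 : ∑ n ∈ Finset.range (φ x), A.indicator (fun _ => (1 : ℝ)) n ≤ T := by
      refine (Finset.sum_le_card_nsmul _ _ 1 fun n _ =>
        Set.indicator_le_self' (fun _ _ => zero_le_one) n).trans ?_
      simpa using hT x
    rw [Finset.sum_range_add] at h1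
    simp only [add_comm (φ x)] at h1
    linarith
  have hm : ∃ m, δ / 8 ≤ density {x | m + φ x ∈ A} := by
    by_contra! h'
    have h1 := avg_mono hx
    rw [avg_const, avg_finset_sum] at h1
    have h2 : ∑ m ∈ Finset.range (N + 1), avg (fun x => A.indicator (fun _ => (1 : ℝ)) (m + φ x))
        < ∑ m ∈ Finset.range (N + 1), δ / 8 :=
      Finset.sum_lt_sum_of_nonempty (by simp) fun m _ => h' m
    rw [Finset.sum_const, Finset.card_range, nsmul_eq_mul] at h2
    push_cast at h2
    nlinarith
  obtain ⟨m, hm⟩ := hm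
  obtain ⟨w, ⟨i₀, hi₀⟩, hw⟩ := H _ hm
  refine ⟨(L + 1) * #{i | w i = none}, ?_, m + φ (fill 0 w), fun j hj => ?_⟩
  · have h1 : 1 ≤ #{i | w i = none} := Finset.card_pos.2 ⟨i₀, by simp [hi₀]⟩
    nlinarith
  · have h1 : ∀ i, ((fill (⟨j, by omega⟩ : Fin (k + 1)) w i : Fin (k + 1)) : ℕ) =
        (fill 0 w i : Fin (k + 1)) + if w i = none then j else 0 := by
      intro i
      rcases hi : w i <;> simp [fill, hi]
    have h2 : m + φ (fill ⟨j, by omega⟩ w) ∈ A := hw ⟨j, by omega⟩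
    simp only [hφ, h1, Finset.sum_add_distrib, ← Finset.sum_filter, Finset.sum_const, smul_eq_mul]
      at h2 ⊢
    convert h2 using 1
    ring

end Main
end DensityHalesJewett

section Metric

open Topology

/-- For almost every `x`, the fractional parts of `d * x` with `d` in an infinite set visit a given
interval. -/
lemma volume_fract_notMem_eq_zero {D : Set ℕ} (hD : ∀ L, ∃ d ≥ L, d ∈ D) {a b : ℝ} (ha : 0 ≤ a)
    (hab : a < b) (hb : b ≤ 1) (L : ℕ) :
    volume {x : ℝ | ∀ d ∈ D, L ≤ d → Int.fract (d * x) ∉ Set.Ioo a b} = 0 := by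
  set S : Set ℝ := {x : ℝ | ∀ d ∈ D, L ≤ d → Int.fract (d * x) ∉ Set.Ioo a b} with hS
  have h := Besicovitch.ae_tendsto_measure_inter_div (volume : Measure ℝ) S
  have h2 : ∀ᵐ x ∂(volume.restrict S), False := by
    filter_upwards [h] with x hx
    have hlt : ENNReal.ofReal (1 - (b - a) / 2) < 1 := by
      rw [ENNReal.ofReal_lt_one]
      linarith
    have h3 := hx.eventually (lt_mem_nhds hlt)
    rw [eventually_nhdsWithin_iff, Metric.eventually_nhds_iff] at h3
    obtain ⟨ε, hε, h3⟩ := h3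
    obtain ⟨N, hN⟩ := exists_nat_gt (1 / ε)
    obtain ⟨d, hd, hdD⟩ := hD (max L N)
    have hNd : (N : ℝ) ≤ d := by exact_mod_cast (le_max_right _ _).trans hd
    have hd0 : (0 : ℝ) < d := (by positivity : 0 < 1 / ε).trans (hN.trans_le hNd)
    have hdε : 1 / (d : ℝ) < ε := by
      rw [div_lt_comm₀ hd0 hε]
      exact hN.trans_le hNd
    have h4 := h3 (y := 1 / (d : ℝ))
      (by rwa [Real.dist_eq, sub_zero, abs_of_pos (by positivity)]) (by simpa using hd0)
    refine absurd h4 (not_lt.2 ?_)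
    set p : ℤ := ⌊d * x⌋
    have hp1 : (p : ℝ) ≤ d * x := Int.floor_le _
    have hp2 : d * x < (p : ℝ) + 1 := Int.lt_floor_add_one _
    set I : Set ℝ := Set.Ioo ((p + a) / d) ((p + b) / d) with hI
    have hIB : I ⊆ Metric.closedBall x (1 / d) := by
      intro y hy
      rw [Real.closedBall_eq_Icc]
      obtain ⟨h5, h6⟩ := hy
      rw [div_lt_iff₀ hd0] at h5
      rw [lt_div_iff₀ hd0] at h6
      have h7 : 1 / (d : ℝ) * d = 1 := by field_simp
      constructor
      · refine le_of_mul_le_mul_right ?_ hd0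
        nlinarith
      · refine le_of_mul_le_mul_right ?_ hd0
        nlinarith
    have hIS : S ∩ Metric.closedBall x (1 / d) ⊆ Metric.closedBall x (1 / d) \ I := by
      rintro y ⟨hyS, hyB⟩
      refine ⟨hyB, fun hyI => hyS d hdD ((le_max_left _ _).trans hd) ?_⟩
      obtain ⟨h5, h6⟩ := hyI
      rw [div_lt_iff₀ hd0] at h5
      rw [lt_div_iff₀ hd0] at h6
      have h7 : Int.fract (d * y) = d * y - p := by
        rw [Int.fract, Int.floor_eq_iff (z := p).2 ⟨by linarith, by linarith⟩]
      rw [h7]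
      constructor <;> linarith
    refine ENNReal.div_le_of_le_mul ((measure_mono hIS).trans ?_)
    rw [measure_sdiff hIB measurableSet_Ioo.nullMeasurableSet (by simp [hI]), hI,
      Real.volume_closedBall, Real.volume_Ioo, ← ENNReal.ofReal_mul (by linarith),
      ← ENNReal.ofReal_sub _ (by rw [← sub_div]; exact div_nonneg (by linarith) hd0.le)]
    refine le_of_eq ?_
    congr 1
    field_simp
    ring
  rw [← Measure.restrict_eq_zero, ← ae_eq_bot]
  exact eventually_false_iff_eq_bot.1 h2

/-- For almost every `x`, the fractional parts of `d * x` with `d` in an infinite set are dense in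
the unit interval. -/
lemma ae_exists_fract_mem {D : Set ℕ} (hD : ∀ L, ∃ d ≥ L, d ∈ D) :
    ∀ᵐ x : ℝ, ∀ a b : ℝ, 0 ≤ a → a < b → b ≤ 1 → ∀ L : ℕ,
      ∃ d ∈ D, L ≤ d ∧ Int.fract (d * x) ∈ Set.Ioo a b := by
  have h : ∀ᵐ x : ℝ, ∀ (a b : ℚ) (L : ℕ), 0 ≤ (a : ℝ) → (a : ℝ) < b → (b : ℝ) ≤ 1 →
      ∃ d ∈ D, L ≤ d ∧ Int.fract (d * x) ∈ Set.Ioo (a : ℝ) b := by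
    simp only [ae_all_iff]
    intro a b L ha hab hb
    have h1 := volume_fract_notMem_eq_zero hD ha hab hb L
    filter_upwards [compl_mem_ae_iff.2 h1] with x hx
    simpa using hx
  filter_upwards [h] with x hx a b ha hab hb L
  obtain ⟨c, hac, hcb⟩ := exists_rat_btwn hab
  obtain ⟨e, hce, heb⟩ := exists_rat_btwn hcb
  obtain ⟨d, hd, hL, h1, h2⟩ := hx c e L (by linarith) hce (by linarith)
  exact ⟨d, hd, hL, by linarith, by linarith⟩

/-- Inversion preserves almost everywhere statements on the positive half line. -/
lemma ae_restrict_Ioi_inv {p : ℝ → Prop} (h : ∀ᵐ x : ℝ, p x) :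
    ∀ᵐ x ∂(volume.restrict (Set.Ioi (0 : ℝ))), p x⁻¹ := by
  rw [ae_restrict_iff' measurableSet_Ioi, ae_iff]
  refine measure_mono_null (t := (fun x : ℝ => x⁻¹) '' ({x | ¬ p x} ∩ Set.Ioi 0)) ?_ ?_
  · intro x hx
    simp only [Set.mem_Ioi, not_forall, Set.mem_ofPred_eq] at hx
    obtain ⟨h1, h2⟩ := hx
    exact ⟨x⁻¹, ⟨h2, inv_pos.2 h1⟩, inv_inv x⟩
  · refine addHaar_image_eq_zero_of_differentiableOn_of_addHaar_eq_zero _ ?_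
      (measure_mono_null Set.inter_subset_left (ae_iff.1 h))
    exact fun x hx => (differentiableAt_inv hx.2.ne').differentiableWithinAt

/-- If the fractional parts of the multiples `d * θ⁻¹` are dense, then some `d` lies in the
Beatty sequence. -/
lemma exists_floor_mul_add_eq {D : Set ℕ} {θ : ℝ} (hθ : 0 < θ)
    (h : ∀ a b : ℝ, 0 ≤ a → a < b → b ≤ 1 → ∀ L : ℕ,
      ∃ d ∈ D, L ≤ d ∧ Int.fract (d * θ⁻¹) ∈ Set.Ioo a b) (γ : ℝ) :
    ∃ d ∈ D, 1 ≤ d ∧ ∃ n : ℕ, ⌊θ * n + γ⌋ = d := by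
  set q : ℤ := ⌈γ * θ⁻¹⌉ - 1 with hq
  set t : ℝ := γ * θ⁻¹ - q with ht
  have ht0 : 0 < t := by
    have h1 := Int.ceil_lt_add_one (γ * θ⁻¹)
    rw [ht, hq]
    push_cast
    linarith
  have ht1 : t ≤ 1 := by
    have h1 := Int.le_ceil (γ * θ⁻¹)
    rw [ht, hq]
    push_cast
    linarith
  have hθ' : 0 < θ⁻¹ := inv_pos.2 hθ
  obtain ⟨d, hd, hL, h1, h2⟩ := h (max 0 (t - θ⁻¹)) t (le_max_left _ _)
    (max_lt ht0 (by linarith)) ht1 (max 1 ⌈γ⌉₊)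
  have h3 : t - θ⁻¹ < Int.fract (d * θ⁻¹) := (le_max_right _ _).trans_lt h1
  have hγd : γ ≤ d := (Nat.le_ceil γ).trans (by exact_mod_cast (le_max_right _ _).trans hL)
  have h4 : (⌊d * θ⁻¹⌋ : ℝ) = d * θ⁻¹ - Int.fract (d * θ⁻¹) := by
    linarith [Int.floor_add_fract ((d : ℝ) * θ⁻¹)]
  have hn : 0 ≤ ⌊d * θ⁻¹⌋ - q := by
    have h5 : γ * θ⁻¹ ≤ d * θ⁻¹ := by gcongr
    have h6 : (-1 : ℝ) < (⌊d * θ⁻¹⌋ - q : ℤ) := by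
      push_cast
      linarith
    have h7 : (-1 : ℤ) < ⌊d * θ⁻¹⌋ - q := by exact_mod_cast h6
    omega
  refine ⟨d, hd, (le_max_left _ _).trans hL, (⌊d * θ⁻¹⌋ - q).toNat, ?_⟩
  have h5 : (((⌊d * θ⁻¹⌋ - q).toNat : ℕ) : ℝ) = d * θ⁻¹ - Int.fract (d * θ⁻¹) - q := by
    rw [← h4]
    exact_mod_cast Int.toNat_of_nonneg hn
  have h6 : θ * (d * θ⁻¹ - Int.fract (d * θ⁻¹) - q) + γ =
      d + θ * (t - Int.fract (d * θ⁻¹)) := by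
    rw [ht]
    field_simp
    ring
  have h7 : θ * (t - Int.fract (d * θ⁻¹)) < θ * θ⁻¹ := by
    gcongr
    linarith
  rw [mul_inv_cancel₀ hθ.ne'] at h7
  have h8 : 0 < θ * (t - Int.fract (d * θ⁻¹)) := mul_pos hθ (by linarith)
  rw [h5, h6, Int.floor_eq_iff]
  push_cast
  constructor <;> linarith

end Metric

/-- a set of positive upper density contains, for a.e. `θ > 0` and every `γ`,
a `(k+1)`-term arithmetic progression whose common difference lies in the Beatty sequence
`{⌊θn+γ⌋ : n ∈ ℕ}`. -/
theorem ap_with_beatty_common_difference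
    (k : ℕ) (hk : 1 ≤ k) (A : Set ℕ) (hA : 0 < upperDensity A) :
    ∀ᵐ θ ∂(MeasureTheory.volume.restrict (Set.Ioi (0 : ℝ))), ∀ γ : ℝ,
      ∃ m n : ℕ, 1 ≤ ⌊θ * (n : ℝ) + γ⌋ ∧
        ∀ j : ℕ, j ≤ k → m + j * (⌊θ * (n : ℝ) + γ⌋).toNat ∈ A := by
  have h := ae_restrict_Ioi_inv (ae_exists_fract_mem (D := {d | ∃ m : ℕ, ∀ j ≤ k, m + j * d ∈ A})
    (DensityHalesJewett.exists_ap_of_upperDensity_pos k hA))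
  filter_upwards [h, self_mem_ae_restrict measurableSet_Ioi] with θ hθ hθ0 γ
  obtain ⟨d, ⟨m, hm⟩, hd, n, hn⟩ := exists_floor_mul_add_eq hθ0 hθ γ
  refine ⟨m, n, by rw [hn]; exact_mod_cast hd, ?_⟩
  rw [hn]
  exact hm
end

section
/- Let k ≥ 1 and let A ⊂ ℕ have positive upper density. Then for Lebesgue-almost every θ > 0 and every γ ∈ ℝ there exists a syndetic set S ⊂ ℕ such that for every n ∈ S with ⌊θn+γ⌋ ≥ 1, the set A_n := {m ∈ ℕ : m + j·⌊θn+γ⌋ ∈ A for all j ∈ {0,1,…,k}} has positive upper density. -/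
open MeasureTheory Filter Finset

/-- A set `S ⊆ ℕ` is syndetic if it has bounded gaps. -/
def Syndetic (S : Set ℕ) : Prop :=
  ∃ r : ℕ, 0 < r ∧ ∀ n : ℕ, ∃ s ∈ S, n < s ∧ s ≤ n + r

namespace DensityHJ

open scoped BigOperators

section Mean

variable {X Y W : Type*} [Finite X] [Finite Y] [Finite W]

/-- The average of a real function over a finite type. -/
noncomputable def mean (f : X → ℝ) : ℝ :=
  letI := Fintype.ofFinite X
  𝔼 x, f x

open scoped Classical in
/-- The indicator of a proposition, as a real number. -/
noncomputable def ind (p : Prop) : ℝ := if p then 1 else 0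

/-- The density of a subset of a finite type. -/
noncomputable def dens (A : Set X) : ℝ := mean fun x => ind (x ∈ A)

@[simp] lemma ind_true : ind True = 1 := by simp [ind]

@[simp] lemma ind_false : ind False = 0 := by simp [ind]

lemma ind_of {p : Prop} (h : p) : ind p = 1 := by simp [ind, h]

lemma ind_of_not {p : Prop} (h : ¬p) : ind p = 0 := by simp [ind, h]

lemma ind_nonneg (p : Prop) : 0 ≤ ind p := by
  unfold ind; split_ifs <;> norm_num

lemma ind_le_one (p : Prop) : ind p ≤ 1 := by
  unfold ind; split_ifs <;> norm_num

lemma ind_and (p q : Prop) : ind (p ∧ q) = ind p * ind q := by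
  by_cases hp : p <;> by_cases hq : q <;> simp [hp, hq]

lemma ind_not (p : Prop) : ind (¬p) = 1 - ind p := by
  by_cases hp : p <;> simp [hp]

lemma mean_const [Nonempty X] (c : ℝ) : mean (fun _ : X => c) = c := by
  let _ := Fintype.ofFinite X
  exact Fintype.expect_const c

lemma mean_add (f g : X → ℝ) : mean (fun x => f x + g x) = mean f + mean g :=
  Finset.expect_add_distrib _ _ _

lemma mean_sub (f g : X → ℝ) : mean (fun x => f x - g x) = mean f - mean g :=
  Finset.expect_sub_distrib _ _ _

lemma mean_const_mul (c : ℝ) (f : X → ℝ) : mean (fun x => c * f x) = c * mean f :=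
  (Finset.mul_expect _ _ _).symm

lemma mean_mono {f g : X → ℝ} (h : ∀ x, f x ≤ g x) : mean f ≤ mean g :=
  Finset.expect_le_expect fun x _ => h x

lemma mean_nonneg {f : X → ℝ} (h : ∀ x, 0 ≤ f x) : 0 ≤ mean f :=
  Finset.expect_nonneg fun x _ => h x

lemma mean_nonpos {f : X → ℝ} (h : ∀ x, f x ≤ 0) : mean f ≤ 0 := by
  refine (mean_mono h).trans_eq ?_
  exact Finset.expect_const_zero _

lemma mean_equiv (e : X ≃ Y) (f : Y → ℝ) : mean (fun x => f (e x)) = mean f := by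
  let _ := Fintype.ofFinite X
  let _ := Fintype.ofFinite Y
  exact Fintype.expect_equiv e _ _ fun _ => rfl

lemma mean_comm (f : X → Y → ℝ) :
    mean (fun x => mean fun y => f x y) = mean fun y => mean fun x => f x y := by
  let _ := Fintype.ofFinite X
  let _ := Fintype.ofFinite Y
  exact Finset.expect_comm _ _ _

lemma mean_prod (f : X × Y → ℝ) : mean f = mean fun x => mean fun y => f (x, y) := by
  let _ := Fintype.ofFinite X
  let _ := Fintype.ofFinite Y
  have := Finset.expect_product (Finset.univ : Finset X) (Finset.univ : Finset Y) f
  rw [Finset.univ_product_univ] at this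
  unfold mean
  rw [← this]
  congr!

lemma exists_le_of_le_mean [Nonempty X] {f : X → ℝ} {c : ℝ} (h : c ≤ mean f) : ∃ x, c ≤ f x := by
  let _ := Fintype.ofFinite X
  obtain ⟨x, -, hx⟩ := Finset.exists_le_of_le_expect Finset.univ_nonempty h
  exact ⟨x, hx⟩

lemma mean_eq_sum_div [Fintype X] (f : X → ℝ) : mean f = (∑ x, f x) / Nat.card X := by
  have := Fintype.expect_eq_sum_div_card f
  rw [Nat.card_eq_fintype_card, ← this]
  unfold mean
  congr!

lemma le_card_mul_mean {f : X → ℝ} (h : ∀ x, 0 ≤ f x) (x : X) : f x ≤ Nat.card X * mean f := by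
  let _ := Fintype.ofFinite X
  have : Nonempty X := ⟨x⟩
  have hc : (0 : ℝ) < Nat.card X := by exact_mod_cast Nat.card_pos
  rw [mean_eq_sum_div, mul_div_cancel₀ _ hc.ne']
  exact Finset.single_le_sum (fun y _ => h y) (Finset.mem_univ x)

lemma dens_nonneg (A : Set X) : 0 ≤ dens A := mean_nonneg fun _ => ind_nonneg _

lemma dens_le_one (A : Set X) : dens A ≤ 1 := by
  rcases isEmpty_or_nonempty X with h | h
  · let _ := Fintype.ofFinite X
    simp [dens, mean_eq_sum_div]
  · exact (mean_mono fun _ => ind_le_one _).trans_eq (mean_const 1)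

lemma nonempty_of_dens_pos {A : Set X} (h : 0 < dens A) : A.Nonempty := by
  by_contra hA
  rw [Set.not_nonempty_iff_eq_empty] at hA
  refine h.not_ge (mean_nonpos fun x => ?_)
  simp [hA]

lemma exists_popular {P : W → Y → Prop} {c : ℝ} (hc : 0 < c)
    (h : c ≤ mean fun y => ind (∃ w, P w y)) :
    ∃ w, c / Nat.card W ≤ mean fun y => ind (P w y) := by
  have hW : Nonempty W := by
    by_contra hW
    rw [not_nonempty_iff] at hW
    exact hc.not_ge (h.trans (mean_nonpos fun y => by simp))
  have hcard : (0 : ℝ) < Nat.card W := by exact_mod_cast Nat.card_pos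
  have h1 : c ≤ Nat.card W * mean fun w => mean fun y => ind (P w y) := by
    rw [mean_comm, ← mean_const_mul]
    refine h.trans (mean_mono fun y => ?_)
    by_cases hy : ∃ w, P w y
    · obtain ⟨w, hw⟩ := hy
      refine (ind_le_one _).trans ?_
      rw [← ind_of hw]
      exact le_card_mul_mean (f := fun w => ind (P w y)) (fun _ => ind_nonneg _) w
    · rw [ind_of_not hy]
      exact mul_nonneg hcard.le (mean_nonneg fun _ => ind_nonneg _)
  exact exists_le_of_le_mean ((div_le_iff₀' hcard).2 h1)

lemma mean_mul_ind_range {φ : X → Y} (hφ : Function.Injective φ) (F : Y → ℝ) :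
    mean (fun y => F y * ind (y ∈ Set.range φ)) =
      (Nat.card X / Nat.card Y : ℝ) * mean fun x => F (φ x) := by
  classical
  let _ := Fintype.ofFinite X
  let _ := Fintype.ofFinite Y
  rcases isEmpty_or_nonempty X with hX | hX
  · simp [mean_eq_sum_div]
  have hc : (0 : ℝ) < Nat.card X := by exact_mod_cast Nat.card_pos
  have hs : ∑ y, F y * ind (y ∈ Set.range φ) = ∑ x, F (φ x) := by
    rw [← Finset.sum_image (s := Finset.univ) (g := φ) (f := F) (by intro a _ b _ h; exact hφ h)]
    rw [← Finset.sum_filter_add_sum_filter_not Finset.univ (fun y => y ∈ Set.range φ)]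
    rw [Finset.sum_eq_zero (s := Finset.univ.filter fun y => ¬ y ∈ Set.range φ), add_zero]
    · refine Finset.sum_congr (by ext; simp) fun y hy => ?_
      simp only [Finset.mem_image, Finset.mem_univ, true_and] at hy
      rw [ind_of (show y ∈ Set.range φ from hy), mul_one]
    · intro y hy
      rw [ind_of_not (Finset.mem_filter.1 hy).2, mul_zero]
  rw [mean_eq_sum_div, mean_eq_sum_div, hs]
  field_simp

lemma mean_pi_prod {ι β : Type*} [Fintype ι] [Finite β] (f : ι → β → ℝ) :
    mean (fun x : ι → β => ∏ i, f i (x i)) = ∏ i, mean (f i) := by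
  classical
  let _ := Fintype.ofFinite β
  simp only [mean_eq_sum_div, Finset.prod_div_distrib, Finset.prod_const,
    Finset.card_univ, Nat.card_eq_fintype_card]
  rw [Finset.prod_univ_sum, Fintype.piFinset_univ, Fintype.card_fun, Nat.cast_pow]

end Mean

section Subspace

variable {α β ι η κ ζ ξ : Type}

/-- A word over `β` with variables in `ζ` is proper if every variable occurs in it, so that it
describes a combinatorial subspace of `ι → β` of dimension `ζ`. -/
def IsProper (g : ι → β ⊕ ζ) : Prop := ∀ z, ∃ i, g i = Sum.inr z

/-- Substitution of letters for the variables of a word. -/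
def app (g : ι → β ⊕ ζ) (x : ζ → β) : ι → β := fun i => Sum.elim id x (g i)

/-- Substitution of a word for the variables of another one. -/
def comp (g : ι → β ⊕ ζ) (h : ζ → β ⊕ ξ) : ι → β ⊕ ξ := fun i => Sum.elim Sum.inl h (g i)

lemma app_comp (g : ι → β ⊕ ζ) (h : ζ → β ⊕ ξ) (x : ξ → β) :
    app (comp g h) x = app g (app h x) := by
  funext i
  rcases hg : g i with b | z <;> simp [app, comp, hg]

lemma IsProper.comp {g : ι → β ⊕ ζ} {h : ζ → β ⊕ ξ} (hg : IsProper g) (hh : IsProper h) :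
    IsProper (comp g h) := by
  intro z
  obtain ⟨j, hj⟩ := hh z
  obtain ⟨i, hi⟩ := hg j
  exact ⟨i, by simp [DensityHJ.comp, hi, hj]⟩

lemma IsProper.app_injective {g : ι → β ⊕ ζ} (hg : IsProper g) :
    Function.Injective (app g) := by
  intro x y hxy
  funext z
  obtain ⟨i, hi⟩ := hg z
  simpa [app, hi] using congrFun hxy i

/-- The word on `ι` obtained by joining words on the two parts of a partition of `ι`. -/
def glue (e : η ⊕ κ ≃ ι) (x : η → β) (y : κ → β) : ι → β := fun i => Sum.elim x y (e.symm i)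

lemma glue_swap (e : η ⊕ κ ≃ ι) (x : η → β) (y : κ → β) :
    glue ((Equiv.sumComm κ η).trans e) y x = glue e x y := by
  funext i
  rcases h : e.symm i with a | b <;> simp [glue, h]

/-- The subspace of dimension `η` obtained by fixing the letters in `κ`. -/
def slice (e : η ⊕ κ ≃ ι) (y : κ → β) : ι → β ⊕ η :=
  fun i => Sum.elim Sum.inr (fun k => Sum.inl (y k)) (e.symm i)

lemma app_slice (e : η ⊕ κ ≃ ι) (x : η → β) (y : κ → β) : app (slice e y) x = glue e x y := by
  funext i
  rcases h : e.symm i with a | b <;> simp [glue, app, slice, h]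

lemma isProper_slice (e : η ⊕ κ ≃ ι) (y : κ → β) : IsProper (slice e y) := fun z =>
  ⟨e (Sum.inl z), by simp [slice]⟩

lemma mean_glue [Finite β] [Finite ι] [Finite η] [Finite κ] (e : η ⊕ κ ≃ ι)
    (F : (ι → β) → ℝ) : mean F = mean fun y => mean fun x => F (glue e x y) := by
  rw [mean_comm, ← mean_prod fun p : (η → β) × (κ → β) => F (glue e p.1 p.2)]
  let E : (η → β) × (κ → β) ≃ (ι → β) :=
    (Equiv.sumArrowEquivProdArrow η κ β).symm.trans (e.arrowCongr (Equiv.refl β))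
  exact (mean_equiv E F).symm

lemma exists_split [Finite ι] [Finite η] (h : Nat.card η ≤ Nat.card ι) :
    ∃ m : ℕ, m = Nat.card ι - Nat.card η ∧ Nonempty (η ⊕ Fin m ≃ ι) := by
  refine ⟨_, rfl, ?_⟩
  apply Finite.card_eq.1 ?_
  rw [Nat.card_sum, Nat.card_fin]
  omega

/-- A set of words contains a combinatorial line. Lines are given by words over `Option α`, with
`none` in the place of the variable. -/
def HasLine (A : Set (ι → α)) : Prop :=
  ∃ w : ι → Option α, (∃ i, w i = none) ∧ ∀ a, (fun i => (w i).getD a) ∈ A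

lemma HasLine.of_app {g : ι → β ⊕ ζ} (hg : IsProper g) {A : Set (ι → β)}
    (h : HasLine {x | app g x ∈ A}) : HasLine A := by
  obtain ⟨w, ⟨z, hz⟩, hw⟩ := h
  refine ⟨fun i => Sum.elim some w (g i), ?_, fun a => ?_⟩
  · obtain ⟨i, hi⟩ := hg z
    exact ⟨i, by simp [hi, hz]⟩
  · have := hw a
    rw [Set.mem_ofPred_eq] at this
    convert this using 1
    funext i
    rcases h : g i with b | z <;> simp [app, h]

variable (α) in
/-- The density Hales–Jewett property of the alphabet `α` at density `δ`. -/
def DHJ [Finite α] (δ : ℝ) : Prop :=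
  ∃ N : ℕ, ∀ (ι : Type) [Finite ι], N ≤ Nat.card ι →
    ∀ A : Set (ι → α), δ ≤ dens A → HasLine A

lemma DHJ.of_single [Finite α] [Nonempty α] [Finite η] {δ : ℝ}
    (h : ∀ A : Set (η → α), δ ≤ dens A → HasLine A) : DHJ α δ := by
  refine ⟨Nat.card η, fun ι _ hι A hA => ?_⟩
  obtain ⟨m, -, ⟨e⟩⟩ := exists_split hι
  rw [dens, mean_glue e] at hA
  obtain ⟨y, hy⟩ := exists_le_of_le_mean hA
  refine HasLine.of_app (isProper_slice e y) (h _ ?_)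
  simpa only [dens, Set.mem_ofPred_eq, app_slice] using hy

lemma DHJ.mono [Finite α] {δ δ' : ℝ} (h : DHJ α δ) (hδ : δ ≤ δ') : DHJ α δ' := by
  obtain ⟨N, hN⟩ := h
  exact ⟨N, fun ι _ hι A hA => hN ι hι A (hδ.trans hA)⟩

lemma DHJ.of_equiv [Finite α] [Finite β] (e : α ≃ β) {δ : ℝ} (h : DHJ α δ) : DHJ β δ := by
  obtain ⟨N, hN⟩ := h
  refine ⟨N, fun ι _ hι A hA => ?_⟩
  let E : (ι → α) ≃ (ι → β) := (Equiv.refl ι).arrowCongr e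
  obtain ⟨w, ⟨i, hi⟩, hw⟩ := hN ι hι {x | E x ∈ A} (by
    rw [dens, ← mean_equiv E] at hA
    exact hA)
  refine ⟨fun i => (w i).map e, ⟨i, by simp [hi]⟩, fun b => ?_⟩
  have := hw (e.symm b)
  rw [Set.mem_ofPred_eq] at this
  convert this using 1
  funext j
  rcases h : w j with _ | a <;> simp [E, h]

lemma DHJ.of_subsingleton [Finite α] [Subsingleton α] {δ : ℝ} (hδ : 0 < δ) : DHJ α δ := by
  refine ⟨1, fun ι _ hι A hA => ?_⟩
  obtain ⟨x, hx⟩ := nonempty_of_dens_pos (hδ.trans_le hA)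
  have : Nonempty ι := (Nat.card_pos_iff.1 (by omega)).1
  refine ⟨fun _ => none, ⟨Classical.arbitrary ι, rfl⟩, fun a => ?_⟩
  convert hx using 1

lemma exists_subspace_of_dhj [Finite α] [Nonempty α] (hα : ∀ δ : ℝ, 0 < δ → DHJ α δ) (d : ℕ) :
    ∀ δ : ℝ, 0 < δ → ∃ N : ℕ, ∀ (ι : Type) [Finite ι], N ≤ Nat.card ι →
      ∀ A : Set (ι → α), δ ≤ dens A →
        ∃ g : ι → α ⊕ Fin d, IsProper g ∧ ∀ x, app g x ∈ A := by
  induction d with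
  | zero =>
    refine fun δ hδ => ⟨0, fun ι _ _ A hA => ?_⟩
    obtain ⟨x, hx⟩ := nonempty_of_dens_pos (hδ.trans_le hA)
    exact ⟨fun i => Sum.inl (x i), fun z => z.elim0, fun _ => hx⟩
  | succ d ih =>
    intro δ hδ
    obtain ⟨M, hM⟩ := hα (δ / 2) (by positivity)
    have hL : (0 : ℝ) < Nat.card (Fin M → Option α) := by exact_mod_cast Nat.card_pos
    obtain ⟨N, hN⟩ := ih (δ / 2 / Nat.card (Fin M → Option α)) (by positivity)
    refine ⟨M + N, fun ι _ hι A hA => ?_⟩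
    obtain ⟨m, hm, ⟨e⟩⟩ := exists_split (ι := ι) (η := Fin M) (by simp; omega)
    rw [Nat.card_fin] at hm
    let P : (Fin M → Option α) → (Fin m → α) → Prop := fun w y =>
      (∃ i, w i = none) ∧ ∀ a, glue e (fun i => (w i).getD a) y ∈ A
    have hP : δ / 2 ≤ mean fun y => ind (∃ w, P w y) := by
      have h1 : δ ≤ mean fun y : Fin m → α => δ / 2 + ind (∃ w, P w y) := by
        refine hA.trans ?_
        rw [dens, mean_glue e]
        refine mean_mono fun y => ?_
        by_cases hy : δ / 2 ≤ dens {x : Fin M → α | glue e x y ∈ A}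
        · rw [ind_of (show ∃ w, P w y from hM (Fin M) (by simp) _ hy)]
          have := dens_le_one {x : Fin M → α | glue e x y ∈ A}
          change dens {x : Fin M → α | glue e x y ∈ A} ≤ _
          linarith
        · exact (not_le.1 hy).le.trans (le_add_of_nonneg_right (ind_nonneg _))
      rw [mean_add, mean_const] at h1
      linarith
    obtain ⟨w, hw⟩ := exists_popular (by positivity) hP
    obtain ⟨g, hg, hgA⟩ := hN (Fin m) (by simp; omega) {y | P w y} hw
    obtain ⟨i₀, hi₀⟩ := (hgA fun _ => Classical.arbitrary α).1
    let s : Fin M → α ⊕ Fin (d + 1) := fun i => (w i).elim (Sum.inr (Fin.last d)) Sum.inl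
    let t : Fin m → α ⊕ Fin (d + 1) := fun i => (g i).map id Fin.castSucc
    refine ⟨fun i => Sum.elim s t (e.symm i), fun z => ?_, fun x => ?_⟩
    · refine Fin.lastCases ⟨e (Sum.inl i₀), by simp [s, hi₀]⟩ (fun z => ?_) z
      obtain ⟨i, hi⟩ := hg z
      exact ⟨e (Sum.inr i), by simp [t, hi]⟩
    · convert (hgA fun j => x j.castSucc).2 (x (Fin.last d)) using 1
      funext i
      rcases h : e.symm i with a | b
      · rcases h' : w a with _ | c <;> simp [app, glue, h, s, h']
      · rcases h' : g b with c | z <;> simp [app, glue, h, t, h']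

end Subspace

section Insensitive

variable {α ι η κ ζ : Type}

/-- Replace the letter `none` by the letter `i`. -/
def fill (i : α) (x : ι → Option α) : ι → Option α := fun p => some ((x p).getD i)

/-- Membership in `B` is not affected by interchanging the letters `i` and `none`. -/
def Insensitive (i : α) (B : Set (ι → Option α)) : Prop := ∀ x, fill i x ∈ B ↔ x ∈ B

lemma fill_app_fill (i : α) (g : ι → Option α ⊕ ζ) (x : ζ → Option α) :
    fill i (app g (fill i x)) = fill i (app g x) := by
  funext p
  rcases h : g p with b | z <;> simp [fill, app, h]

lemma Insensitive.preimage_app {i : α} {B : Set (ι → Option α)} (hB : Insensitive i B)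
    (g : ι → Option α ⊕ ζ) : Insensitive i {x | app g x ∈ B} := fun x => by
  change app g (fill i x) ∈ B ↔ app g x ∈ B
  rw [← hB, fill_app_fill, hB]

lemma Insensitive.compl {i : α} {B : Set (ι → Option α)} (hB : Insensitive i B) :
    Insensitive i Bᶜ := fun x => not_congr (hB x)

lemma insensitive_fill (i : α) (A : Set (ι → Option α)) : Insensitive i {x | fill i x ∈ A} :=
  fun _ => Iff.rfl

lemma hasLine_of_fill_mem {A : Set (ι → Option α)} {w : ι → Option α} (hw : w ∈ A)
    (hfill : ∀ i, fill i w ∈ A) (hn : ∃ p, w p = none) : HasLine A := by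
  obtain ⟨p, hp⟩ := hn
  refine ⟨fun q => (w q).map some, ⟨p, by simp [hp]⟩, fun a => ?_⟩
  rcases a with _ | i
  · convert hw using 1
    funext q
    rcases h : w q with _ | b <;> simp [h]
  · convert hfill i using 1
    funext q
    rcases h : w q with _ | b <;> simp [fill, h]

lemma mean_option_map [Finite α] [Nonempty α] [Finite ι] (F : (ι → Option α) → ℝ) :
    mean F =
      mean fun x : ι → Option α => mean fun y : ι → α => F fun p => (x p).map fun _ => y p := by
  have : NeZero (Nat.card α) := ⟨Nat.card_pos.ne'⟩
  let _ : AddCommGroup α := (Finite.equivFin α).addCommGroup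
  have h1 (y : ι → α) : mean (fun x : ι → Option α => F fun p => (x p).map (· + y p)) = mean F :=
    mean_equiv (Equiv.piCongrRight fun p => Equiv.optionCongr (Equiv.addRight (y p))) F
  have h2 (x : ι → Option α) : mean (fun y : ι → α => F fun p => (x p).map (· + y p)) =
      mean fun y : ι → α => F fun p => (x p).map fun _ => y p := by
    rw [← mean_equiv (Equiv.piCongrRight fun p => Equiv.addLeft ((x p).getD 0))
      (fun y : ι → α => F fun p => (x p).map fun _ => y p)]
    congr 1
    funext y
    congr 1
    funext p
    rcases h : x p with _ | a <;> simp [h]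
  simp only [← h2]
  rw [mean_comm]
  simp only [h1, mean_const]

lemma mean_ind_eq_none [Finite α] :
    mean (fun b : Option α => ind (b = none)) = 1 / (Nat.card α + 1) := by
  classical
  let _ := Fintype.ofFinite α
  rw [mean_eq_sum_div, Fintype.sum_option, Finite.card_option]
  simp

lemma exists_subspace_of_insensitive [Finite α] [Nonempty α] (hα : ∀ δ : ℝ, 0 < δ → DHJ α δ)
    (i : α) {γ : ℝ} (hγ : 0 < γ) (d : ℕ) :
    ∃ m : ℕ, ∀ B : Set (Fin m → Option α), Insensitive i B → γ ≤ dens B →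
      ∃ g : Fin m → Option α ⊕ Fin d, IsProper g ∧ ∀ x, app g x ∈ B := by
  classical
  obtain ⟨N, hN⟩ := exists_subspace_of_dhj hα d (γ / 2) (by positivity)
  have hr : (1 / (Nat.card α + 1) : ℝ) < 1 := by
    have : (0 : ℝ) < Nat.card α := by exact_mod_cast Nat.card_pos
    rw [div_lt_one (by positivity)]
    linarith
  obtain ⟨t, ht⟩ := exists_pow_lt_of_lt_one
    (show 0 < γ / 2 / Nat.card (Fin (N + 1)) by simp; positivity) hr
  refine ⟨(N + 1) * t, fun B hB hBγ => ?_⟩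
  let E : Fin (N + 1) × Fin t ≃ Fin ((N + 1) * t) := finProdFinEquiv
  let bad : Fin (N + 1) → (Fin ((N + 1) * t) → Option α) → Prop :=
    fun j x => ∀ p, x (E (j, p)) = none
  have hbad : mean (fun x => ind (∃ j, bad j x)) < γ / 2 := by
    by_contra! h
    obtain ⟨j, hj⟩ := exists_popular (by positivity) h
    refine ht.not_ge (hj.trans_eq ?_)
    have h1 (x : Fin ((N + 1) * t) → Option α) : ind (bad j x) =
        ∏ q, if (E.symm q).1 = j then ind (x q = none) else 1 := by
      by_cases hx : bad j x
      · rw [ind_of hx, eq_comm]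
        refine Finset.prod_eq_one fun q _ => ?_
        split_ifs with hq
        · refine ind_of ?_
          have := hx (E.symm q).2
          rwa [← hq, Prod.mk.eta, Equiv.apply_symm_apply] at this
        · rfl
      · rw [ind_of_not hx, eq_comm]
        simp only [bad, not_forall] at hx
        obtain ⟨p, hp⟩ := hx
        exact Finset.prod_eq_zero (Finset.mem_univ (E (j, p))) (by simp [ind_of_not hp])
    simp only [h1]
    rw [mean_pi_prod fun q (b : Option α) => if (E.symm q).1 = j then ind (b = none) else 1]
    have h2 (q : Fin ((N + 1) * t)) :
        mean (fun b : Option α => if (E.symm q).1 = j then ind (b = none) else 1) =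
          if (E.symm q).1 = j then (1 / (Nat.card α + 1) : ℝ) else 1 := by
      split_ifs
      · exact mean_ind_eq_none
      · exact mean_const 1
    simp only [h2]
    rw [← E.prod_comp]
    simp only [Equiv.symm_apply_apply, Fintype.prod_prod_type]
    simp
  obtain ⟨x, hx⟩ : ∃ x : Fin ((N + 1) * t) → Option α,
      γ / 2 ≤ dens {y : Fin ((N + 1) * t) → α | (fun p => (x p).map fun _ => y p) ∈ B} *
        ind (¬ ∃ j, bad j x) := by
    refine exists_le_of_le_mean ?_
    have h1 : γ ≤ mean fun x : Fin ((N + 1) * t) → Option α =>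
        dens {y : Fin ((N + 1) * t) → α | (fun p => (x p).map fun _ => y p) ∈ B} *
          ind (¬ ∃ j, bad j x) + ind (∃ j, bad j x) := by
      refine hBγ.trans ?_
      rw [dens, mean_option_map]
      refine mean_mono fun x => ?_
      have := dens_le_one {y : Fin ((N + 1) * t) → α | (fun p => (x p).map fun _ => y p) ∈ B}
      by_cases h : ∃ j, bad j x
      · rw [ind_of h, ind_of_not (not_not.2 h), mul_zero, zero_add]
        exact this
      · rw [ind_of_not h, ind_of h, mul_one, add_zero]
        exact le_rfl
    rw [mean_add] at h1
    linarith
  have hgood : ¬ ∃ j, bad j x := by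
    by_contra h
    rw [ind_of_not (not_not.2 h)] at hx
    linarith
  rw [ind_of hgood, mul_one] at hx
  simp only [bad, not_exists, not_forall] at hgood
  choose p hp using hgood
  let e := Equiv.sumCompl fun q => x q ≠ none
  rw [dens, mean_glue e] at hx
  obtain ⟨y, hy⟩ := exists_le_of_le_mean hx
  have hcard : N ≤ Nat.card {q // x q ≠ none} := by
    have := Nat.card_le_card_of_injective
      (fun j : Fin (N + 1) => (⟨E (j, p j), hp j⟩ : {q // x q ≠ none})) (fun j k h => by
        have := E.injective (Subtype.ext_iff.1 h)
        exact (Prod.ext_iff.1 this).1)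
    rw [Nat.card_fin] at this
    omega
  obtain ⟨g, hg, hgB⟩ := hN {q // x q ≠ none} hcard
    {u | (fun q => (x q).map fun _ => glue e u y q) ∈ B} hy
  refine ⟨fun q => if h : x q ≠ none then (g ⟨q, h⟩).map some id else Sum.inl none,
    fun z => ?_, fun z => ?_⟩
  · obtain ⟨q, hq⟩ := hg z
    exact ⟨q, (dif_pos q.2).trans (by rw [hq]; rfl)⟩
  · have h1 := (hB _).2 (hgB fun j => (z j).getD i)
    rw [← hB]
    convert h1 using 1
    funext q
    by_cases h : x q ≠ none
    · have h2 : e.symm q = Sum.inl ⟨q, h⟩ := by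
        rw [Equiv.symm_apply_eq]; rfl
      obtain ⟨a, ha⟩ := Option.ne_none_iff_exists'.1 h
      rcases h3 : g ⟨q, h⟩ with b | b
      · simp [fill, app, glue, h2, h3, ha]
      · simp [fill, app, glue, h2, h3, ha]
    · rw [not_not] at h
      simp [fill, app, h]

end Insensitive

section Partition

variable {α ι η κ ζ : Type} [Finite α]

/-- The average of `f` over every subspace of dimension `d` is nonpositive. -/
def NonposOn (d : ℕ) (f : (ι → α) → ℝ) : Prop :=
  ∀ g : ι → α ⊕ Fin d, IsProper g → mean (fun x => f (app g x)) ≤ 0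

lemma NonposOn.comp_app {d : ℕ} {f : (ι → α) → ℝ} (hf : NonposOn d f) {g : ι → α ⊕ ζ}
    (hg : IsProper g) : NonposOn d fun x => f (app g x) := fun h hh => by
  simpa only [app_comp] using hf _ (hg.comp hh)

lemma mean_mul_ind_le_pow [Nonempty α] {i : α} {γ : ℝ} {d m : ℕ}
    (hm : ∀ B : Set (Fin m → Option α), Insensitive i B → γ ≤ dens B →
      ∃ g : Fin m → Option α ⊕ Fin d, IsProper g ∧ ∀ x, app g x ∈ B) {c : ℝ}
    (hc : c = 1 / Nat.card {g : Fin m → Option α ⊕ Fin d // IsProper g} /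
      Nat.card (Fin m → Option α)) (hc1 : c ≤ 1) (hγ : 0 ≤ γ) (t : ℕ) :
    ∀ (ι : Type) [Finite ι], m * t ≤ Nat.card ι →
      ∀ B : Set (ι → Option α), Insensitive i B → ∀ f : (ι → Option α) → ℝ, (∀ x, f x ≤ 1) →
        NonposOn d f → mean (fun x => f x * ind (x ∈ B)) ≤ γ + (1 - c) ^ t * (dens B - γ) := by
  have hle (ι : Type) [Finite ι] (B : Set (ι → Option α)) (f : (ι → Option α) → ℝ)
      (hf : ∀ x, f x ≤ 1) : mean (fun x => f x * ind (x ∈ B)) ≤ dens B :=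
    mean_mono fun x => by nlinarith [ind_nonneg (x ∈ B), hf x]
  have hc0 : 0 ≤ c := by rw [hc]; positivity
  induction t with
  | zero =>
    intro ι _ _ B _ f hf _
    linarith [hle ι B f hf]
  | succ t ih =>
    intro ι _ hι B hB f hf hfd
    rcases le_or_gt (dens B) γ with hBγ | hBγ
    · have h1 : (1 - c) ^ (t + 1) ≤ 1 := pow_le_one₀ (by linarith) (by linarith)
      nlinarith [hle ι B f hf]
    obtain ⟨n, hn, ⟨e⟩⟩ := exists_split (ι := ι) (η := Fin m) (by
      rw [Nat.card_fin, mul_add] at *; omega)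
    rw [Nat.card_fin] at hn
    let P : {g : Fin m → Option α ⊕ Fin d // IsProper g} → (Fin n → Option α) → Prop :=
      fun w y => ∀ z, glue e (app w.1 z) y ∈ B
    have hP : dens B - γ ≤ mean fun y => ind (∃ w, P w y) := by
      have h1 : dens B ≤ mean fun y : Fin n → Option α => γ + ind (∃ w, P w y) := by
        rw [dens, mean_glue e]
        refine mean_mono fun y => ?_
        change dens {x | glue e x y ∈ B} ≤ _
        by_cases hy : γ ≤ dens {x | glue e x y ∈ B}
        · have hins : Insensitive i {x | glue e x y ∈ B} := by
            simpa only [app_slice] using hB.preimage_app (slice e y)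
          obtain ⟨g, hg, hgB⟩ := hm _ hins hy
          rw [ind_of ⟨⟨g, hg⟩, hgB⟩]
          linarith [dens_le_one {x | glue e x y ∈ B}]
        · linarith [ind_nonneg (∃ w, P w y)]
      rw [mean_add, mean_const] at h1
      linarith
    obtain ⟨w, hw⟩ := exists_popular (by linarith) hP
    let D : Set (Fin m → Option α) := Set.range (app w.1)
    let Y : Set (Fin n → Option α) := {y | P w y}
    let R : (Fin m → Option α) → Set (Fin n → Option α) :=
      fun x => {y | glue e x y ∈ B ∧ ¬(x ∈ D ∧ y ∈ Y)}
    have hsplit (x : Fin m → Option α) (y : Fin n → Option α) :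
        ind (glue e x y ∈ B) = ind (y ∈ R x) + ind (x ∈ D) * ind (y ∈ Y) := by
      rw [← ind_and]
      by_cases h : x ∈ D ∧ y ∈ Y
      · obtain ⟨⟨z, rfl⟩, hy⟩ := h
        rw [ind_of (hy z), ind_of_not fun h' => h'.2 ⟨⟨z, rfl⟩, hy⟩, ind_of ⟨⟨z, rfl⟩, hy⟩,
          zero_add]
      · rw [ind_of_not h, add_zero]
        by_cases h' : glue e x y ∈ B
        · rw [ind_of h', ind_of ⟨h', h⟩]
        · rw [ind_of_not h', ind_of_not fun h'' => h' h''.1]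
    have hD : 1 / Nat.card (Fin m → Option α) ≤ dens D := by
      obtain ⟨x₀⟩ : Nonempty D := ⟨⟨_, ⟨fun _ => none, rfl⟩⟩⟩
      rw [div_le_iff₀' (by exact_mod_cast Nat.card_pos), ← ind_of x₀.2]
      exact le_card_mul_mean (f := fun x => ind (x ∈ D)) (fun _ => ind_nonneg _) x₀.1
    have hdens : (mean fun x => dens (R x)) ≤ dens B - c * (dens B - γ) := by
      have h1 : dens B = (mean fun x => dens (R x)) + dens D * dens Y := by
        rw [dens, mean_glue e, mean_comm]
        simp only [hsplit, mean_add, mean_const_mul]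
        congr 1
        simp only [mul_comm _ (mean fun y => ind (y ∈ Y)), mean_const_mul]
        exact mul_comm _ _
      have h2 : c * (dens B - γ) ≤ dens D * dens Y := by
        have h3 := mul_le_mul hD hw (div_nonneg (by linarith) (by positivity)) (dens_nonneg _)
        refine le_trans (le_of_eq ?_) h3
        rw [hc]
        ring
      linarith
    have hremoved : (mean fun x => mean fun y =>
        f (glue e x y) * (ind (x ∈ D) * ind (y ∈ Y))) ≤ 0 := by
      rw [mean_comm]
      refine mean_nonpos fun y => ?_
      have h1 (x) : f (glue e x y) * (ind (x ∈ D) * ind (y ∈ Y)) =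
          ind (y ∈ Y) * (f (glue e x y) * ind (x ∈ D)) := by ring
      simp only [h1, mean_const_mul]
      rw [mean_mul_ind_range w.2.app_injective fun x => f (glue e x y)]
      refine mul_nonpos_of_nonneg_of_nonpos (ind_nonneg _)
        (mul_nonpos_of_nonneg_of_nonpos (by positivity) ?_)
      have := (hfd.comp_app (isProper_slice e y)) w.1 w.2
      simpa only [app_slice] using this
    have hrest (x : Fin m → Option α) : (mean fun y => f (glue e x y) * ind (y ∈ R x)) ≤
        γ + (1 - c) ^ t * (dens (R x) - γ) := by
      let e' := (Equiv.sumComm (Fin n) (Fin m)).trans e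
      have he' (y : Fin n → Option α) : app (slice e' x) y = glue e x y := by
        rw [app_slice, glue_swap]
      refine ih (Fin n) (by rw [Nat.card_fin, hn, mul_add] at *; omega) (R x) ?_ _
        (fun y => hf _) ?_
      · intro y
        have h1 (x') : glue e x' (fill i y) ∈ B ↔ glue e x' y ∈ B := by
          have := hB.preimage_app (slice ((Equiv.sumComm (Fin n) (Fin m)).trans e) x') y
          change app _ _ ∈ B ↔ app _ _ ∈ B at this
          rwa [app_slice, app_slice, glue_swap, glue_swap] at this
        change (_ ∧ ¬(x ∈ D ∧ ∀ _, _)) ↔ (_ ∧ ¬(x ∈ D ∧ ∀ _, _))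
        simp only [h1]
      · have := hfd.comp_app (isProper_slice e' x)
        simpa only [he'] using this
    calc mean (fun x => f x * ind (x ∈ B))
        = (mean fun x => mean fun y => f (glue e x y) * ind (y ∈ R x)) +
          mean fun x => mean fun y => f (glue e x y) * (ind (x ∈ D) * ind (y ∈ Y)) := by
          rw [mean_glue e, mean_comm]
          simp only [hsplit, mul_add, mean_add]
      _ ≤ (mean fun x => γ + (1 - c) ^ t * (dens (R x) - γ)) + 0 :=
          add_le_add (mean_mono hrest) hremoved
      _ = γ + (1 - c) ^ t * ((mean fun x => dens (R x)) - γ) := by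
          rw [mean_add, mean_const, mean_const_mul, mean_sub, mean_const, add_zero]
      _ ≤ γ + (1 - c) ^ (t + 1) * (dens B - γ) := by
          have h1 : 0 ≤ (1 - c) ^ t := pow_nonneg (by linarith) t
          have h2 := mul_le_mul_of_nonneg_left (sub_le_sub_right hdens γ) h1
          refine add_le_add_right (h2.trans_eq ?_) γ
          ring

lemma mean_mul_ind_le_of_insensitive [Nonempty α] (hα : ∀ δ : ℝ, 0 < δ → DHJ α δ) (i : α)
    {γ : ℝ} (hγ : 0 < γ) (d : ℕ) :
    ∃ N : ℕ, ∀ (ι : Type) [Finite ι], N ≤ Nat.card ι →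
      ∀ B : Set (ι → Option α), Insensitive i B → ∀ f : (ι → Option α) → ℝ, (∀ x, f x ≤ 1) →
        NonposOn d f → mean (fun x => f x * ind (x ∈ B)) ≤ γ := by
  rcases le_or_gt 1 γ with hγ1 | hγ1
  · refine ⟨0, fun ι _ _ B _ f hf _ => le_trans ?_ hγ1⟩
    refine (mean_mono fun x => ?_).trans_eq (mean_const 1)
    nlinarith [ind_nonneg (x ∈ B), ind_le_one (x ∈ B), hf x]
  obtain ⟨m, hm⟩ := exists_subspace_of_insensitive hα i (half_pos hγ) d
  set c : ℝ := 1 / Nat.card {g : Fin m → Option α ⊕ Fin d // IsProper g} /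
      Nat.card (Fin m → Option α) with hc
  have : Nonempty {g : Fin m → Option α ⊕ Fin d // IsProper g} := by
    obtain ⟨g, hg, -⟩ := hm Set.univ (fun x => by simp) (by
      simp only [dens, Set.mem_univ, ind_true, mean_const]; linarith)
    exact ⟨⟨g, hg⟩⟩
  have h1 : (1 : ℝ) ≤ Nat.card {g : Fin m → Option α ⊕ Fin d // IsProper g} := by
    exact_mod_cast Nat.card_pos
  have h2 : (1 : ℝ) ≤ Nat.card (Fin m → Option α) := by exact_mod_cast Nat.card_pos
  have hc0 : 0 < c := by positivity
  have hc1 : c ≤ 1 := by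
    rw [hc, div_div, div_le_one (by positivity)]
    nlinarith
  obtain ⟨t, ht⟩ := exists_pow_lt_of_lt_one (half_pos hγ) (show 1 - c < 1 by linarith)
  refine ⟨m * t, fun ι _ hι B hB f hf hfd => ?_⟩
  refine (mean_mul_ind_le_pow hm hc hc1 (half_pos hγ).le t ι hι B hB f hf hfd).trans ?_
  have h3 : 0 ≤ (1 - c) ^ t := pow_nonneg (by linarith) t
  nlinarith [dens_le_one B]

lemma mean_mul_ind_le_of_forall_insensitive [Nonempty α] (hα : ∀ δ : ℝ, 0 < δ → DHJ α δ)
    (s : Finset α) : ∀ {γ : ℝ}, 0 < γ → ∀ d : ℕ,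
    ∃ N : ℕ, ∀ (ι : Type) [Finite ι], N ≤ Nat.card ι →
      ∀ C : α → Set (ι → Option α), (∀ i, Insensitive i (C i)) →
        ∀ f : (ι → Option α) → ℝ, (∀ x, f x ≤ 1) → NonposOn d f →
          mean (fun x => f x * ind (∀ i ∈ s, x ∈ C i)) ≤ γ := by
  classical
  induction s using Finset.induction_on with
  | empty =>
    refine fun hγ d => ⟨d, fun ι _ hι C _ f _ hfd => le_trans ?_ hγ.le⟩
    obtain ⟨m, -, ⟨e⟩⟩ := exists_split (ι := ι) (η := Fin d) (by simpa using hι)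
    simp only [Finset.notMem_empty, false_imp_iff, implies_true, ind_true, mul_one]
    rw [mean_glue e]
    refine mean_nonpos fun y => ?_
    simpa only [app_slice] using hfd _ (isProper_slice e y)
  | insert j s _ ih =>
    intro γ hγ d
    obtain ⟨M, hM⟩ := ih (half_pos hγ) d
    obtain ⟨N, hN⟩ := mean_mul_ind_le_of_insensitive hα j (half_pos hγ) M
    refine ⟨N, fun ι _ hι C hC f hf hfd => ?_⟩
    have h1 := hN ι hι (C j) (hC j) (fun x => f x * ind (∀ i ∈ s, x ∈ C i) - γ / 2) (fun x => by
      nlinarith [ind_nonneg (∀ i ∈ s, x ∈ C i), ind_le_one (∀ i ∈ s, x ∈ C i), hf x]) (by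
      intro g hg
      rw [mean_sub, mean_const, sub_nonpos]
      exact hM (Fin M) (by simp) (fun i => {x | app g x ∈ C i}) (fun i => (hC i).preimage_app g) _
        (fun x => hf _) (hfd.comp_app hg))
    have h2 (x : ι → Option α) : f x * ind (∀ i ∈ insert j s, x ∈ C i) =
        (f x * ind (∀ i ∈ s, x ∈ C i) - γ / 2) * ind (x ∈ C j) + γ / 2 * ind (x ∈ C j) := by
      rw [Finset.forall_mem_insert, ind_and]
      ring
    simp only [h2, mean_add, mean_const_mul]
    have h3 := dens_le_one (C j)
    unfold dens at h3
    nlinarith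

lemma mean_mul_ind_not_forall_le [Nonempty α] (hα : ∀ δ : ℝ, 0 < δ → DHJ α δ)
    (s : Finset α) : ∀ {γ : ℝ}, 0 < γ → ∀ d : ℕ,
    ∃ N : ℕ, ∀ (ι : Type) [Finite ι], N ≤ Nat.card ι →
      ∀ C : α → Set (ι → Option α), (∀ i, Insensitive i (C i)) →
        ∀ f : (ι → Option α) → ℝ, (∀ x, f x ≤ 1) → NonposOn d f →
          mean (fun x => f x * ind (¬ ∀ i ∈ s, x ∈ C i)) ≤ γ := by
  classical
  induction s using Finset.induction_on with
  | empty =>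
    refine fun hγ d => ⟨0, fun ι _ _ C _ f _ _ => le_trans (mean_nonpos fun x => ?_) hγ.le⟩
    simp
  | insert j s hj ih =>
    intro γ hγ d
    obtain ⟨M, hM⟩ := ih (half_pos hγ) d
    obtain ⟨N, hN⟩ := mean_mul_ind_le_of_forall_insensitive hα (insert j s) (half_pos hγ) d
    refine ⟨max M N, fun ι _ hι C hC f hf hfd => ?_⟩
    have h1 := hM ι (le_of_max_le_left hι) C hC f hf hfd
    have h2 := hN ι (le_of_max_le_right hι) (Function.update C j (C j)ᶜ) (fun i => by
      rcases eq_or_ne i j with rfl | hij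
      · rw [Function.update_self]; exact (hC i).compl
      · rw [Function.update_of_ne hij]; exact hC i) f hf hfd
    have h3 (x : ι → Option α) : f x * ind (¬ ∀ i ∈ insert j s, x ∈ C i) =
        f x * ind (¬ ∀ i ∈ s, x ∈ C i) +
          f x * ind (∀ i ∈ insert j s, x ∈ Function.update C j (C j)ᶜ i) := by
      have h4 : (∀ i ∈ s, x ∈ Function.update C j (C j)ᶜ i) ↔ ∀ i ∈ s, x ∈ C i := by
        refine forall₂_congr fun i hi => ?_
        rw [Function.update_of_ne (ne_of_mem_of_not_mem hi hj)]
      rw [Finset.forall_mem_insert, Finset.forall_mem_insert, h4, Function.update_self, ind_and,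
        Set.mem_compl_iff, ind_not, ind_not, ind_not, ind_and]
      ring
    simp only [h3, mean_add]
    linarith

end Partition

section Increment

variable {α η μ κ ι : Type} [Finite α] [Finite η] [Finite μ] [Finite κ]

/-- Fill the empty places of `a` by the corresponding letters of `x`. -/
def blockFill (a : η × μ → Option α) (x : η → α) : η × μ → Option α :=
  fun p => some ((a p).getD (x p.1))

lemma exists_popular_line [Nonempty α] {δ : ℝ} (hδ : 0 < δ)
    (hη : ∀ A : Set (η → α), δ / 4 ≤ dens A → HasLine A)
    {A : Set ((η × μ) ⊕ κ → Option α)}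
    (hA : ∀ x : η × μ → Option α, δ / 2 ≤ dens {y : κ → Option α | Sum.elim x y ∈ A}) :
    ∃ l : η → Option α, (∃ j, l j = none) ∧
      δ / 4 / Nat.card (η → Option α) ≤ mean fun a : η × μ → Option α =>
        mean fun y : κ → Option α =>
          ind (∀ i, Sum.elim (blockFill a fun j => (l j).getD i) y ∈ A) := by
  let P (l : η → Option α) (z : (η × μ → Option α) × (κ → Option α)) : Prop :=
    (∃ j, l j = none) ∧ ∀ i, Sum.elim (blockFill z.1 fun j => (l j).getD i) z.2 ∈ A
  have h1 : δ / 4 ≤ mean fun z => ind (∃ l, P l z) := by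
    have h2 (z) : dens {x : η → α | Sum.elim (blockFill z.1 x) z.2 ∈ A} - δ / 4 ≤
        ind (∃ l, P l z) := by
      by_cases h : δ / 4 ≤ dens {x : η → α | Sum.elim (blockFill z.1 x) z.2 ∈ A}
      · rw [ind_of (p := ∃ l, P l z) (hη _ h)]
        linarith [dens_le_one {x : η → α | Sum.elim (blockFill z.1 x) z.2 ∈ A}]
      · linarith [ind_nonneg (∃ l, P l z)]
    refine le_trans ?_ (mean_mono h2)
    rw [mean_prod]
    have h3 (a : η × μ → Option α) : δ / 4 ≤ mean fun y : κ → Option α =>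
        dens {x : η → α | Sum.elim (blockFill a x) y ∈ A} - δ / 4 := by
      rw [mean_sub, mean_const]
      unfold dens
      rw [mean_comm]
      have := mean_mono fun x => hA (blockFill a x)
      rw [mean_const] at this
      unfold dens at this
      simp only [Set.mem_ofPred_eq] at this ⊢
      linarith
    exact (mean_const (X := η × μ → Option α) _).symm.trans_le (mean_mono h3)
  obtain ⟨l, hl⟩ := exists_popular (by positivity) h1
  have hj : ∃ j, l j = none := by
    by_contra hj
    have : mean (fun z => ind (P l z)) ≤ 0 := mean_nonpos fun z => by
      rw [ind_of_not fun h => hj h.1]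
    have h0 : 0 < δ / 4 / Nat.card (η → Option α) := by
      have : 0 < Nat.card (η → Option α) := Nat.card_pos
      positivity
    linarith
  refine ⟨l, hj, hl.trans_eq ?_⟩
  rw [mean_prod]
  simp only [P, hj, true_and]

lemma exists_subspace_with_patterns [Nonempty α] {δ : ℝ} (hδ : 0 < δ)
    (hη : ∀ A : Set (η → α), δ / 4 ≤ dens A → HasLine A)
    {A : Set ((η × μ) ⊕ κ → Option α)} {ρ σ : ℝ} (hρ : δ / 2 ≤ ρ) (hσ : 0 ≤ σ)
    (hA : ∀ x : η × μ → Option α, ρ ≤ dens {y : κ → Option α | Sum.elim x y ∈ A}) :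
    ∃ (F : Type) (_ : Finite F) (g : (η × μ) ⊕ κ → Option α ⊕ F),
      Nat.card μ ≤ Nat.card F ∧ IsProper g ∧
      ρ + σ * (δ / 4 / Nat.card (η → Option α)) ≤
        dens {w | app g w ∈ A} + σ * dens {w | ∀ i, app g (fill i w) ∈ A} := by
  classical
  obtain ⟨l, ⟨j, hj⟩, hl⟩ := exists_popular_line hδ hη fun x => hρ.trans (hA x)
  let e := Equiv.sumCompl fun q : η × μ => l q.1 = none
  let g (r : {q : η × μ // ¬ l q.1 = none} → Option α) (y : κ → Option α) :
      (η × μ) ⊕ κ → Option α ⊕ {q : η × μ // l q.1 = none} :=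
    Sum.elim (fun q => if h : l q.1 = none then Sum.inr ⟨q, h⟩
      else Sum.inl ((r ⟨q, h⟩).or (l q.1)))
      fun c => Sum.inl (y c)
  have hfill (r y w i) : app (g r y) (fill i w) =
      Sum.elim (blockFill (glue e w r) fun j => (l j).getD i) y := by
    funext p
    rcases p with q | c
    · by_cases h : l q.1 = none
      · have h2 : e.symm q = Sum.inl ⟨q, h⟩ := by rw [Equiv.symm_apply_eq]; rfl
        simp [app, g, h, fill, blockFill, glue, h2]
      · have h2 : e.symm q = Sum.inr ⟨q, h⟩ := by rw [Equiv.symm_apply_eq]; rfl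
        obtain ⟨a, ha⟩ := Option.ne_none_iff_exists'.1 h
        rcases hr : r ⟨q, h⟩ with _ | b <;> simp [app, g, blockFill, glue, h2, ha, hr]
    · rfl
  have hsplit (r y w) : app (g r y) w = Sum.elim (fun q => app (g r y) w (Sum.inl q)) y := by
    funext p
    rcases p with q | c <;> rfl
  have hfirst : ρ ≤ mean fun r => mean fun y => dens {w | app (g r y) w ∈ A} := by
    refine (mean_const (X := {q : η × μ // ¬ l q.1 = none} → Option α) _).symm.trans_le
      (mean_mono fun r => ?_)
    unfold dens
    rw [mean_comm]
    refine (mean_const (X := {q : η × μ // l q.1 = none} → Option α) _).symm.trans_le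
      (mean_mono fun w => (hA fun q => app (g r (fun _ => none)) w (Sum.inl q)).trans_eq ?_)
    unfold dens
    congr 1
    funext y
    congr 1
    simp only [Set.mem_ofPred_eq]
    rw [hsplit r y w]
    rfl
  have hsecond : δ / 4 / Nat.card (η → Option α) ≤
      mean fun r => mean fun y => dens {w | ∀ i, app (g r y) (fill i w) ∈ A} := by
    refine hl.trans_eq ?_
    rw [mean_glue e]
    congr 1
    funext r
    unfold dens
    rw [mean_comm]
    simp only [hfill, Set.mem_ofPred_eq]
  have hsum : ρ + σ * (δ / 4 / Nat.card (η → Option α)) ≤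
      mean fun z : ({q : η × μ // ¬ l q.1 = none} → Option α) × (κ → Option α) =>
      dens {w | app (g z.1 z.2) w ∈ A} + σ * dens {w | ∀ i, app (g z.1 z.2) (fill i w) ∈ A} := by
    rw [mean_add, mean_const_mul, mean_prod, mean_prod]
    exact add_le_add hfirst (mul_le_mul_of_nonneg_left hsecond hσ)
  obtain ⟨z, hz⟩ := exists_le_of_le_mean hsum
  refine ⟨_, inferInstance, g z.1 z.2, ?_, fun q => ⟨Sum.inl q, ?_⟩, hz⟩
  · exact Nat.card_le_card_of_injective
      (fun p : μ => (⟨(j, p), hj⟩ : {q : η × μ // l q.1 = none})) fun p p' h => by simpa using h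
  · simp [g, q.2]

lemma dens_fill_mem_le [Finite ι] {A : Set (ι → Option α)} (hA : ¬ HasLine A) :
    mean (fun w => ind (w ∈ A ∧ ∀ i, fill i w ∈ A)) ≤
      (1 - 1 / (Nat.card α + 1) : ℝ) ^ Nat.card ι := by
  let _ := Fintype.ofFinite ι
  have h1 : (1 - 1 / (Nat.card α + 1) : ℝ) ^ Nat.card ι =
      mean fun w : ι → Option α => ∏ p, ind (¬ w p = none) := by
    rw [mean_pi_prod fun (_ : ι) (b : Option α) => ind (¬ b = none)]
    simp only [ind_not, mean_sub, mean_const, mean_ind_eq_none, Finset.prod_const,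
      Finset.card_univ, Nat.card_eq_fintype_card]
  rw [h1]
  refine mean_mono fun w => ?_
  by_cases h : w ∈ A ∧ ∀ i, fill i w ∈ A
  · rw [Finset.prod_eq_one]
    · exact ind_le_one _
    · exact fun p _ => ind_of fun hp => hA (hasLine_of_fill_mem h.1 h.2 ⟨p, hp⟩)
  · rw [ind_of_not h]
    exact Finset.prod_nonneg fun p _ => ind_nonneg _

lemma exists_lt_dhj_option [Nonempty α] (hα : ∀ δ : ℝ, 0 < δ → DHJ α δ) {δ : ℝ} (hδ : 0 < δ)
    (h : ∀ δ', δ < δ' → DHJ (Option α) δ') : ∃ δ' < δ, DHJ (Option α) δ' := by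
  obtain ⟨m, hm⟩ := hα (δ / 4) (by positivity)
  set θ := δ / 4 / Nat.card (Fin m → Option α) with hθ
  have hθ0 : 0 < θ := by
    have : 0 < Nat.card (Fin m → Option α) := Nat.card_pos
    positivity
  set t := min (δ * θ / 8) (δ / 2)
  have ht0 : 0 < t := by positivity
  have ht1 : t ≤ δ * θ / 8 := min_le_left _ _
  have ht2 : t ≤ δ / 2 := min_le_right _ _
  obtain ⟨d, hd⟩ := h (δ + t) (by linarith)
  obtain ⟨N, hN⟩ := mean_mul_ind_not_forall_le hα
    (@Finset.univ α (Fintype.ofFinite α)) (show 0 < δ * θ / 2 by positivity) d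
  obtain ⟨n, hn⟩ := exists_pow_lt_of_lt_one ht0
    (show (1 - 1 / (Nat.card α + 1) : ℝ) < 1 by
      have : (0 : ℝ) < 1 / (Nat.card α + 1) := by positivity
      linarith)
  set K := Nat.card (Fin m × Fin (max n N) → Option α)
  have hK : (0 : ℝ) < K := by
    have : 0 < Nat.card (Fin m × Fin (max n N) → Option α) := Nat.card_pos
    exact_mod_cast this
  set t' := t / (2 * K)
  have ht' : 0 < t' := by positivity
  obtain ⟨M, hM⟩ := h (δ + t') (by linarith)
  refine ⟨δ - t', by linarith, DHJ.of_single (η := (Fin m × Fin (max n N)) ⊕ Fin M)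
    fun A hA => ?_⟩
  by_contra hline
  have hx (x : Fin m × Fin (max n N) → Option α) :
      dens {y : Fin M → Option α | Sum.elim x y ∈ A} ≤ δ + t' := by
    by_contra! hx
    refine hline (HasLine.of_app (isProper_slice (Equiv.sumComm _ _) x) ?_)
    simp only [app_slice]
    refine hM _ (by simp) _ (hx.le.trans_eq ?_)
    congr! 4 with y
    funext p
    rcases p with p | p <;> rfl
  have hx' (x : Fin m × Fin (max n N) → Option α) :
      δ - t ≤ dens {y : Fin M → Option α | Sum.elim x y ∈ A} := by
    have h1 := le_card_mul_mean (fun x => sub_nonneg.2 (hx x)) x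
    have h2 : dens A = mean fun x : Fin m × Fin (max n N) → Option α =>
        dens {y : Fin M → Option α | Sum.elim x y ∈ A} := by
      unfold dens
      rw [mean_glue (Equiv.refl _), mean_comm]
      rfl
    rw [mean_sub, mean_const, ← h2] at h1
    have h3 : (K : ℝ) * (δ + t' - dens A) ≤ K * (2 * t') :=
      mul_le_mul_of_nonneg_left (by linarith) hK.le
    have h4 : (K : ℝ) * (2 * t') = t := by
      simp only [t']
      field_simp
    linarith
  obtain ⟨F, _, g, hF, hg, hdens⟩ := exists_subspace_with_patterns hδ (hm (Fin m) (by simp))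
    (show δ / 2 ≤ δ - t by linarith) (show 0 ≤ δ + t by positivity) hx'
  rw [← hθ] at hdens
  rw [Nat.card_fin] at hF
  set B := {w | app g w ∈ A}
  have hB : ¬ HasLine B := fun hB => hline (hB.of_app hg)
  have h1 := hN F ((le_max_right _ _).trans hF) (fun i => {w | fill i w ∈ B})
    (fun i => insensitive_fill i B) (fun w => ind (w ∈ B) - (δ + t))
    (fun w => by linarith [ind_le_one (w ∈ B)]) (fun u hu => by
      rw [mean_sub, mean_const, sub_nonpos]
      by_contra! h1
      exact hB ((hd (Fin d) (by simp) {x | app u x ∈ B} h1.le).of_app hu))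
  have h2 := (dens_fill_mem_le hB).trans (pow_le_pow_of_le_one (by
    have : (1 / (Nat.card α + 1) : ℝ) ≤ 1 := by
      rw [div_le_one (by positivity)]
      linarith [(Nat.card α).cast_nonneg (α := ℝ)]
    linarith) (by
    have : (0 : ℝ) ≤ 1 / (Nat.card α + 1) := by positivity
    linarith) ((le_max_left _ _).trans hF))
  have h3 : mean (fun w => (ind (w ∈ B) - (δ + t)) *
      ind (¬ ∀ i ∈ @Finset.univ α (Fintype.ofFinite α), w ∈ {w | fill i w ∈ B})) =
      dens B - (δ + t) - (mean (fun w => ind (w ∈ B ∧ ∀ i, fill i w ∈ B)) -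
        (δ + t) * dens {w | ∀ i, app g (fill i w) ∈ A}) := by
    unfold dens
    rw [← mean_const_mul, ← mean_sub, ← mean_const (X := F → Option α) (δ + t), ← mean_sub,
      mean_const, ← mean_sub]
    congr 1
    funext w
    simp only [Finset.mem_univ, true_imp_iff, Set.mem_ofPred_eq, ind_not, ind_and, B]
    ring
  rw [h3] at h1
  have h4 : 0 ≤ t * θ := by positivity
  linarith

lemma dhj_option [Nonempty α] (hα : ∀ δ : ℝ, 0 < δ → DHJ α δ) {δ : ℝ} (hδ : 0 < δ) :
    DHJ (Option α) δ := by
  by_contra hbad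
  let S := {δ : ℝ | DHJ (Option α) δ}
  have hne : S.Nonempty := ⟨2, 0, fun ι _ _ A hA => absurd (dens_le_one A) (by linarith)⟩
  have hlow : ∀ δ' ∈ S, δ ≤ δ' := fun δ' h' => by
    by_contra! hlt
    exact hbad (DHJ.mono h' hlt.le)
  have hinf : δ ≤ sInf S := le_csInf hne hlow
  obtain ⟨δ', hlt, hδ'⟩ := exists_lt_dhj_option hα (hδ.trans_le hinf) fun δ' h' => by
    obtain ⟨δ'', h1, h2⟩ := exists_lt_of_csInf_lt hne h'
    exact DHJ.mono h1 h2.le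
  exact hlt.not_ge (csInf_le ⟨δ, hlow⟩ hδ')

/-- The density Hales–Jewett theorem. -/
theorem dhj_fin (k : ℕ) : ∀ δ : ℝ, 0 < δ → DHJ (Fin (k + 1)) δ := by
  induction k with
  | zero =>
    have : Subsingleton (Fin (0 + 1)) := Fin.subsingleton_one
    exact fun δ hδ => DHJ.of_subsingleton hδ
  | succ k ih =>
    exact fun δ hδ => (dhj_option ih hδ).of_equiv (finSuccEquiv (k + 1)).symm

end Increment

section Recurrence

/-- The number of elements of `B` among `1, …, N`. -/
noncomputable def count (B : Set ℕ) (N : ℕ) : ℝ := ∑ n ∈ Finset.range N, ind (n + 1 ∈ B)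

lemma upperDensity_eq (B : Set ℕ) :
    upperDensity B = limsup (fun N : ℕ => count B N / N) atTop := by
  have h (N : ℕ) : ∑ n ∈ Finset.Icc 1 N, Set.indicator B (fun _ => (1 : ℝ)) n = count B N := by
    induction N with
    | zero => simp [count]
    | succ N ih =>
      rw [Finset.sum_Icc_succ_top (by omega), ih, count, count, Finset.sum_range_succ]
      congr 1
  simp only [upperDensity, h]

lemma count_nonneg (B : Set ℕ) (N : ℕ) : 0 ≤ count B N := Finset.sum_nonneg fun _ _ => ind_nonneg _

lemma count_div_le_one (B : Set ℕ) (N : ℕ) : count B N / N ≤ 1 := by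
  refine div_le_one_of_le₀ ?_ N.cast_nonneg
  refine (Finset.sum_le_sum fun _ _ => ind_le_one _).trans_eq ?_
  simp

lemma exists_frequently_le_count {B : Set ℕ} (hB : 0 < upperDensity B) :
    ∃ δ : ℝ, 0 < δ ∧ ∃ᶠ N : ℕ in atTop, δ * N ≤ count B N := by
  refine ⟨upperDensity B / 2, half_pos hB, ?_⟩
  have h : upperDensity B / 2 < limsup (fun N : ℕ => count B N / N) atTop := by
    rw [← upperDensity_eq]
    exact half_lt_self hB
  have h1 := frequently_lt_of_lt_limsup
    (isCoboundedUnder_le_of_le atTop fun N => div_nonneg (count_nonneg B N) N.cast_nonneg) h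
  refine (h1.and_eventually (eventually_gt_atTop 0)).mono fun N ⟨hN, hN0⟩ => ?_
  exact ((lt_div_iff₀ (by exact_mod_cast hN0)).1 hN).le

lemma upperDensity_pos_of_frequently {B : Set ℕ} {δ : ℝ} (hδ : 0 < δ)
    (h : ∃ᶠ N : ℕ in atTop, δ * N ≤ count B N) : 0 < upperDensity B := by
  rw [upperDensity_eq]
  refine hδ.trans_le (le_limsup_of_frequently_le ?_
    (isBoundedUnder_of ⟨1, fun N => count_div_le_one B N⟩))
  refine (h.and_eventually (eventually_gt_atTop 0)).mono fun N ⟨hN, hN0⟩ => ?_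
  exact (le_div_iff₀ (by exact_mod_cast hN0)).2 hN

lemma abs_count_shift_sub_le (B : Set ℕ) (s N : ℕ) : |count {a | a + s ∈ B} N - count B N| ≤ s := by
  induction s with
  | zero => simp
  | succ s ih =>
    have h : count {a | a + (s + 1) ∈ B} N - count {a | a + s ∈ B} N =
        ind (N + 1 + s ∈ B) - ind (0 + 1 + s ∈ B) := by
      rw [count, count, ← Finset.sum_sub_distrib,
        ← Finset.sum_range_sub (fun n => ind (n + 1 + s ∈ B))]
      refine Finset.sum_congr rfl fun n _ => ?_
      simp only [Set.mem_ofPred_eq]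
      congr! 3
      omega
    have h2 : |count {a | a + (s + 1) ∈ B} N - count {a | a + s ∈ B} N| ≤ 1 := by
      rw [h, abs_le]
      constructor <;> linarith [ind_nonneg (N + 1 + s ∈ B), ind_nonneg (0 + 1 + s ∈ B),
        ind_le_one (N + 1 + s ∈ B), ind_le_one (0 + 1 + s ∈ B)]
    have h3 := abs_sub_le (count {a | a + (s + 1) ∈ B} N) (count {a | a + s ∈ B} N) (count B N)
    push_cast
    linarith

lemma exists_upperDensity_pos_of_frequently_le_sum {T : Type} [Fintype T] (B : T → Set ℕ)
    {c C : ℝ} (hc : 0 < c) (h : ∃ᶠ N : ℕ in atTop, c * N - C ≤ ∑ t, count (B t) N) :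
    ∃ t, 0 < upperDensity (B t) := by
  by_contra! hB
  set ε := c / (2 * (Fintype.card T + 1)) with hε
  have hε0 : 0 < ε := by positivity
  have h1 : ∀ᶠ N : ℕ in atTop, ∀ t, count (B t) N ≤ ε * N := by
    rw [eventually_all]
    intro t
    by_contra h1
    refine (hB t).not_gt (upperDensity_pos_of_frequently hε0 ?_)
    exact (not_eventually.1 h1).mono fun N hN => (not_le.1 hN).le
  obtain ⟨N₀, hN₀⟩ := exists_nat_gt (2 * C / c)
  obtain ⟨N, hN, hN1, hN2⟩ := (h.and_eventually (h1.and (eventually_ge_atTop N₀))).exists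
  have h2 : ∑ t, count (B t) N ≤ Fintype.card T * (ε * N) := by
    refine (Finset.sum_le_sum fun t _ => hN1 t).trans_eq ?_
    simp
  have h3 : (Fintype.card T + 1) * ε = c / 2 := by
    rw [hε]; field_simp
  have h4 : 2 * C < N * c := by
    rw [← div_lt_iff₀ hc]
    exact hN₀.trans_le (by exact_mod_cast hN2)
  have h5 : 0 ≤ ε * N := by positivity
  nlinarith

/-- Finite IP recurrence for the set of common differences of progressions of length `k + 1`
occurring in `A` with positive upper density. -/
theorem exists_ip_recurrence (k : ℕ) {A : Set ℕ} (hA : 0 < upperDensity A) :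
    ∃ r : ℕ, ∀ x : Fin r → ℕ, ∃ I : Finset (Fin r), I.Nonempty ∧
      0 < upperDensity {m : ℕ | ∀ j ≤ k, m + j * ∑ i ∈ I, x i ∈ A} := by
  classical
  obtain ⟨δ, hδ, hfreq⟩ := exists_frequently_le_count hA
  obtain ⟨r, hr⟩ := dhj_fin k (δ / 2) (by positivity)
  refine ⟨r, fun x => ?_⟩
  let T := {v : Fin r → Option (Fin (k + 1)) // ∃ i, v i = none}
  let I (v : T) : Finset (Fin r) := {i | v.1 i = none}
  let s (w : Fin r → Fin (k + 1)) : ℕ := ∑ i, (w i : ℕ) * x i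
  let X : ℕ := k * ∑ i, x i
  have hs (w) : s w ≤ X := by
    simp only [s, X, Finset.mul_sum]
    exact Finset.sum_le_sum fun i _ => Nat.mul_le_mul_right _ (by omega)
  have hline (v : T) (j : Fin (k + 1)) : s (fun i => (v.1 i).getD j) =
      s (fun i => (v.1 i).getD 0) + j * ∑ i ∈ I v, x i := by
    simp only [s, I, Finset.mul_sum, Finset.sum_filter, ← Finset.sum_add_distrib]
    refine Finset.sum_congr rfl fun i _ => ?_
    rcases h : v.1 i with _ | b <;> simp
  let B (v : T) : Set ℕ := {m : ℕ | ∀ j ≤ k, m + j * ∑ i ∈ I v, x i ∈ A}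
  suffices ∃ v : T, 0 < upperDensity (B v) by
    obtain ⟨v, hv⟩ := this
    obtain ⟨i, hi⟩ := v.2
    exact ⟨I v, ⟨i, by simp [I, hi]⟩, hv⟩
  refine exists_upperDensity_pos_of_frequently_le_sum B (half_pos hδ)
    (C := X + Fintype.card T * X) (hfreq.mono fun N hN => ?_)
  have h1 (a : ℕ) : dens {w | a + s w ∈ A} ≤
      δ / 2 + ∑ v : T, ind (a + s (fun i => (v.1 i).getD 0) ∈ B v) := by
    have h0 : 0 ≤ ∑ v : T, ind (a + s (fun i => (v.1 i).getD 0) ∈ B v) :=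
      Finset.sum_nonneg fun _ _ => ind_nonneg _
    by_cases h : δ / 2 ≤ dens {w | a + s w ∈ A}
    · obtain ⟨v, hv, hvA⟩ := hr (Fin r) (by simp) _ h
      have h2 := Finset.single_le_sum
        (f := fun v : T => ind (a + s (fun i => (v.1 i).getD 0) ∈ B v))
        (fun _ _ => ind_nonneg _) (Finset.mem_univ ⟨v, hv⟩)
      rw [ind_of] at h2
      · linarith [dens_le_one {w | a + s w ∈ A}]
      · intro j hj
        have h3 := hvA ⟨j, by omega⟩
        rw [Set.mem_ofPred_eq, hline ⟨v, hv⟩ ⟨j, by omega⟩, ← add_assoc] at h3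
        exact h3
    · linarith
  have h2 : count A N - X ≤ ∑ n ∈ Finset.range N, dens {w | n + 1 + s w ∈ A} := by
    have h3 : ∑ n ∈ Finset.range N, dens {w | n + 1 + s w ∈ A} =
        mean fun w => count {a | a + s w ∈ A} N := by
      unfold dens mean count
      rw [Finset.expect_sum_comm]
      rfl
    rw [h3, ← mean_const (X := Fin r → Fin (k + 1)) (count A N - X)]
    refine mean_mono fun w => ?_
    have h4 := (abs_le.1 (abs_count_shift_sub_le A (s w) N)).1
    have h5 : (s w : ℝ) ≤ X := by exact_mod_cast hs w
    linarith
  have h3 : ∑ n ∈ Finset.range N, dens {w | n + 1 + s w ∈ A} ≤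
      δ / 2 * N + ∑ v : T, count {a | a + s (fun i => (v.1 i).getD 0) ∈ B v} N := by
    refine (Finset.sum_le_sum fun n _ => h1 (n + 1)).trans_eq ?_
    rw [Finset.sum_add_distrib, Finset.sum_comm]
    simp [count, mul_comm]
  have h4 : ∑ v : T, count {a | a + s (fun i => (v.1 i).getD 0) ∈ B v} N ≤
      ∑ v : T, (count (B v) N + X) := by
    refine Finset.sum_le_sum fun v _ => ?_
    have h4 := (abs_le.1 (abs_count_shift_sub_le (B v) (s fun i => (v.1 i).getD 0) N)).2
    have h5 : (s (fun i => (v.1 i).getD 0) : ℝ) ≤ X := by exact_mod_cast hs _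
    linarith
  rw [Finset.sum_add_distrib] at h4
  simp only [Finset.sum_const, Finset.card_univ, nsmul_eq_mul] at h4
  linarith

end Recurrence

section Beatty

lemma exists_nat_abs_add_mul_sub_le {δ : ℝ} (hδ : δ ≠ 0) (v : ℝ) :
    ∃ t : ℕ, t ≤ ⌈1 / |δ|⌉₊ ∧ ∃ M : ℤ, |v + t * δ - M| ≤ |δ| := by
  wlog h : 0 < δ generalizing δ v
  · obtain ⟨t, ht, M, hM⟩ := this (neg_ne_zero.2 hδ) (-v)
      (neg_pos.2 (lt_of_le_of_ne (not_lt.1 h) hδ))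
    rw [abs_neg] at ht hM
    refine ⟨t, ht, -M, ?_⟩
    rw [← abs_neg]
    convert hM using 2
    push_cast
    ring
  · rw [abs_of_pos h]
    have h1 : 0 ≤ ((⌈v⌉ : ℝ) - v) / δ := div_nonneg (sub_nonneg.2 (Int.le_ceil v)) h.le
    refine ⟨⌈((⌈v⌉ : ℝ) - v) / δ⌉₊, Nat.ceil_mono ?_, ⌈v⌉, ?_⟩
    · gcongr
      linarith [Int.ceil_lt_add_one v]
    · have h2 := (div_le_iff₀ h).1 (Nat.le_ceil (((⌈v⌉ : ℝ) - v) / δ))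
      have h3 := mul_lt_mul_of_pos_right (Nat.ceil_lt_add_one h1) h
      rw [add_mul, div_mul_cancel₀ _ h.ne'] at h3
      rw [abs_le]
      constructor <;> linarith

/-- The return times of an irrational rotation to an interval have bounded gaps. -/
lemma exists_window_abs_mul_sub_lt {α : ℝ} (hα : Irrational α) (c : ℝ) {η : ℝ} (hη : 0 < η) :
    ∃ L : ℕ, ∀ n : ℕ, ∃ y : ℕ, n < y ∧ y ≤ n + L ∧ ∃ m : ℤ, |y * α - m - c| < η := by
  obtain ⟨n, hn⟩ := exists_nat_one_div_lt hη
  obtain ⟨k, hk, -, hkn⟩ := Real.exists_nat_abs_mul_sub_round_le α (Nat.succ_pos n)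
  set δ := k * α - round (k * α) with hδ
  have hδ0 : δ ≠ 0 := by
    have h1 : Irrational (k * α) := hα.natCast_mul hk.ne'
    exact sub_ne_zero.2 (h1.ne_int _)
  have hδη : |δ| < η := by
    refine (hkn.trans ?_).trans_lt hn
    gcongr
    linarith
  refine ⟨1 + ⌈1 / |δ|⌉₊ * k, fun N => ?_⟩
  obtain ⟨t, ht, M, hM⟩ := exists_nat_abs_add_mul_sub_le hδ0 ((N + 1) * α - c)
  refine ⟨N + 1 + t * k, by omega, ?_, M + t * round (k * α), ?_⟩
  · have := Nat.mul_le_mul_right k ht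
    omega
  · refine lt_of_eq_of_lt ?_ (hM.trans_lt hδη)
    congr 1
    push_cast
    rw [hδ]
    ring

/-- For large `y`, multiplication by `y` brings a substantial part of a set of positive outer
measure close to the integers. -/
lemma exists_forall_volume_inter_ne_zero {E : Set ℝ} (hE : volume E ≠ 0) {ε : ℝ} (hε : 0 < ε) :
    ∃ X : ℕ, ∀ y : ℕ, X ≤ y → volume (E ∩ {α | ∃ m : ℤ, |y * α - m| < ε}) ≠ 0 := by
  wlog hε2 : ε ≤ 1 / 2 generalizing ε
  · obtain ⟨X, hX⟩ := this (ε := 1 / 2) (by norm_num) le_rfl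
    refine ⟨X, fun y hy h => hX y hy (measure_mono_null ?_ h)⟩
    rintro α ⟨h1, m, hm⟩
    exact ⟨h1, m, hm.trans (not_le.1 hε2)⟩
  have : (ae (volume.restrict E)).NeBot := by
    rw [ae_neBot]
    exact fun h => hE (Measure.restrict_eq_zero.1 h)
  obtain ⟨x, hx⟩ := (Besicovitch.ae_tendsto_measure_inter_div volume E).exists
  have h1 : ENNReal.ofReal (1 - ε) < 1 := by
    rw [ENNReal.ofReal_lt_one]
    linarith
  have h2 : Tendsto (fun y : ℕ => (1 : ℝ) / y) atTop (nhdsWithin 0 (Set.Ioi 0)) := by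
    refine tendsto_nhdsWithin_iff.2 ⟨tendsto_one_div_atTop_nhds_zero_nat, ?_⟩
    filter_upwards [eventually_gt_atTop 0] with y hy
    have : (0 : ℝ) < y := by exact_mod_cast hy
    exact one_div_pos.2 this
  obtain ⟨X, hX⟩ := eventually_atTop.1 ((h2.eventually (hx.eventually (lt_mem_nhds h1))).and
    (eventually_gt_atTop 0))
  refine ⟨X, fun y hy h0 => ?_⟩
  obtain ⟨h3, hy0⟩ := hX y hy
  have hy0' : (0 : ℝ) < y := by exact_mod_cast hy0
  refine h3.not_ge ?_
  set m := round (y * x)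
  set J := Set.Ioo ((m - ε) / y) ((m + ε) / y)
  have hmx := abs_le.1 (abs_sub_round (y * x))
  have hJ : J ⊆ Metric.closedBall x (1 / y) := by
    rintro z ⟨hz1, hz2⟩
    rw [div_lt_iff₀ hy0'] at hz1
    rw [lt_div_iff₀ hy0'] at hz2
    have h4 : |z - x| * y = |(z - x) * y| := by rw [abs_mul, abs_of_pos hy0']
    rw [Metric.mem_closedBall, Real.dist_eq, le_div_iff₀ hy0', h4, abs_le]
    constructor <;> linarith
  have hEJ : volume (E ∩ J) = 0 := by
    refine measure_mono_null ?_ h0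
    rintro z ⟨hz, hz1, hz2⟩
    rw [div_lt_iff₀ hy0'] at hz1
    rw [lt_div_iff₀ hy0'] at hz2
    refine ⟨hz, m, ?_⟩
    rw [abs_lt]
    constructor <;> linarith
  have hvJ : volume J = ENNReal.ofReal (2 * ε / y) := by
    rw [Real.volume_Ioo]
    congr 1
    ring
  have hvB : volume (Metric.closedBall x (1 / (y : ℝ))) = ENNReal.ofReal (2 / y) := by
    rw [Real.volume_closedBall]
    congr 1
    ring
  refine ENNReal.div_le_of_le_mul ?_
  calc volume (E ∩ Metric.closedBall x (1 / y))
      ≤ volume (E ∩ J) + volume (Metric.closedBall x (1 / y) \ J) := by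
        refine (measure_mono ?_).trans (measure_union_le _ _)
        rintro z ⟨hz1, hz2⟩
        by_cases hz : z ∈ J
        exacts [Or.inl ⟨hz1, hz⟩, Or.inr ⟨hz2, hz⟩]
    _ = ENNReal.ofReal (1 - ε) * volume (Metric.closedBall x (1 / (y : ℝ))) := by
        rw [hEJ, zero_add, measure_sdiff hJ measurableSet_Ioo.nullMeasurableSet
          (by rw [hvJ]; exact ENNReal.ofReal_ne_top), hvJ, hvB,
          ← ENNReal.ofReal_sub _ (by positivity), ← ENNReal.ofReal_mul (by linarith)]
        congr 1
        ring

/-- The rotations `α` for which the return times to `(p, q)` in `R` have unbounded gaps. -/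
def UnboundedGaps (R : Set ℕ) (p q : ℝ) : Set ℝ :=
  {α | ∀ w : ℕ, ∃ n : ℕ, ∀ d ∈ R, n < d → d ≤ n + w → ∀ m : ℤ, ¬ (p < d * α - m ∧ d * α - m < q)}

lemma exists_sum_notMem {R : Set ℕ} {p q : ℝ} (hpq : p < q) {E : Set ℝ} (hE : volume E ≠ 0)
    (hbad : E ⊆ UnboundedGaps R p q) (hirr : ∀ α ∈ E, Irrational α) (n : ℕ) :
    ∀ ε : ℝ, 0 < ε → ∃ x : ℕ → ℕ,
      (∀ I ⊆ Finset.range n, I.Nonempty → ∑ i ∈ I, x i ∉ R) ∧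
      volume (E ∩ {α | ∀ I ⊆ Finset.range n,
        ∃ m : ℤ, |((∑ i ∈ I, x i : ℕ) : ℝ) * α - m| < ε}) ≠ 0 := by
  induction n with
  | zero =>
    refine fun ε hε => ⟨0, by simp, ?_⟩
    convert hE using 2
    rw [Set.inter_eq_left]
    exact fun α _ I _ => ⟨0, by simpa using hε⟩
  | succ n ih =>
    intro ε hε
    obtain ⟨x, hxR, hx⟩ := ih (min (ε / 2) ((q - p) / 4)) (by
      have := sub_pos.2 hpq
      positivity)
    set E' := E ∩ {α | ∀ I ⊆ Finset.range n,
      ∃ m : ℤ, |((∑ i ∈ I, x i : ℕ) : ℝ) * α - m| < min (ε / 2) ((q - p) / 4)}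
    obtain ⟨X, hX⟩ := exists_forall_volume_inter_ne_zero hx (half_pos hε)
    obtain ⟨α, hαE, hα⟩ := nonempty_of_measure_ne_zero hx
    obtain ⟨L, hL⟩ := exists_window_abs_mul_sub_lt (hirr α hαE) ((p + q) / 2)
      (show 0 < (q - p) / 4 by linarith)
    set W := ∑ i ∈ Finset.range n, x i
    obtain ⟨N, hN⟩ := hbad hαE (X + L + W)
    obtain ⟨y, hy1, hy2, m, hm⟩ := hL (N + X)
    have hsum {I : Finset ℕ} (hI : I ⊆ Finset.range n) :
        ∑ i ∈ I, Function.update x n y i = ∑ i ∈ I, x i :=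
      Finset.sum_congr rfl fun i hi => Function.update_of_ne
        (Finset.mem_range.1 (hI hi)).ne _ _
    have hcases {I : Finset ℕ} (hI : I ⊆ Finset.range (n + 1)) :
        I ⊆ Finset.range n ∨ ∃ I' ⊆ Finset.range n,
          ∑ i ∈ I, Function.update x n y i = y + ∑ i ∈ I', x i := by
      by_cases hn : n ∈ I
      · have h1 : I.erase n ⊆ Finset.range n := by
          intro i hi
          have h2 := Finset.mem_range.1 (hI (Finset.mem_of_mem_erase hi))
          have h3 := Finset.ne_of_mem_erase hi
          exact Finset.mem_range.2 (by omega)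
        refine Or.inr ⟨I.erase n, h1, ?_⟩
        rw [← Finset.add_sum_erase I _ hn, hsum h1, Function.update_self]
      · refine Or.inl fun i hi => ?_
        have h2 := Finset.mem_range.1 (hI hi)
        have h3 : i ≠ n := fun h => hn (h ▸ hi)
        exact Finset.mem_range.2 (by omega)
    refine ⟨Function.update x n y, fun I hI hne => ?_, ?_⟩
    · rcases hcases hI with h | ⟨I', hI', h⟩
      · rw [hsum h]
        exact hxR I h hne
      · rw [h]
        intro hR
        obtain ⟨m', hm'⟩ := hα I' hI'
        have hW : ∑ i ∈ I', x i ≤ W := Finset.sum_le_sum_of_subset hI'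
        refine hN _ hR (by omega) (by omega) (m + m') ?_
        have h1 := abs_lt.1 (hm'.trans_le (min_le_right _ _))
        have h2 := abs_lt.1 hm
        rw [Nat.cast_add, add_mul, Int.cast_add]
        constructor <;> linarith
    · intro h0
      refine hX y (by omega) (measure_mono_null ?_ h0)
      rintro β ⟨⟨hβE, hβ⟩, m, hm⟩
      refine ⟨hβE, fun I hI => ?_⟩
      rcases hcases hI with h | ⟨I', hI', h⟩
      · obtain ⟨m', hm'⟩ := hβ I h
        rw [hsum h]
        exact ⟨m', by linarith [hm'.trans_le (min_le_left _ _)]⟩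
      · obtain ⟨m', hm'⟩ := hβ I' hI'
        refine ⟨m + m', ?_⟩
        have h1 := abs_lt.1 (hm'.trans_le (min_le_left _ _))
        have h2 := abs_lt.1 hm
        rw [h, Nat.cast_add, add_mul, Int.cast_add, abs_lt]
        constructor <;> linarith

lemma volume_unboundedGaps_eq_zero {R : Set ℕ} {r : ℕ}
    (hR : ∀ x : Fin r → ℕ, ∃ I : Finset (Fin r), I.Nonempty ∧ ∑ i ∈ I, x i ∈ R)
    {p q : ℝ} (hpq : p < q) : volume (UnboundedGaps R p q) = 0 := by
  by_contra h0
  have hirr : volume {α : ℝ | Irrational α}ᶜ = 0 := by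
    refine Set.Countable.measure_zero ((Set.countable_range ((↑) : ℚ → ℝ)).mono ?_) _
    intro α hα
    exact not_not.1 hα
  have hE : volume (UnboundedGaps R p q ∩ {α : ℝ | Irrational α}) ≠ 0 := by
    rwa [measure_inter_conull hirr]
  obtain ⟨x, hx, -⟩ := exists_sum_notMem hpq hE Set.inter_subset_left (fun α hα => hα.2) r 1 one_pos
  obtain ⟨I, hI, hIR⟩ := hR fun i => x i
  refine hx (I.map Fin.valEmbedding) ?_ (hI.map) (by simpa using hIR)
  intro i hi
  obtain ⟨j, -, rfl⟩ := Finset.mem_map.1 hi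
  simp

lemma syndetic_of_notMem_unboundedGaps {R : Set ℕ} {θ γ p q : ℝ} (hθ : 0 < θ)
    (hp : γ * θ⁻¹ - θ⁻¹ < p) (hq : q < γ * θ⁻¹) (hbad : θ⁻¹ ∉ UnboundedGaps R p q) :
    Syndetic {n : ℕ | ∃ d ∈ R, ⌊θ * n + γ⌋ = (d : ℤ)} := by
  simp only [UnboundedGaps, Set.mem_ofPred_eq, not_forall, not_exists, not_not] at hbad
  obtain ⟨w, hw⟩ := hbad
  set α := θ⁻¹
  have hα : 0 < α := inv_pos.2 hθ
  have hθα : θ * α = 1 := mul_inv_cancel₀ hθ.ne'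
  refine ⟨⌈|p| + |q| + (w + 1) * α⌉₊ + 1, by omega, fun n => ?_⟩
  obtain ⟨d, hdR, hd1, hd2, m, hm1, hm2⟩ := hw ⌈(n + |q|) * θ⌉₊
  have h1 : (n + |q|) * θ < d := (Nat.lt_of_ceil_lt hd1)
  have h2 : (d : ℝ) < (n + |q|) * θ + 1 + w := by
    have h2 : (d : ℝ) ≤ ⌈(n + |q|) * θ⌉₊ + w := by exact_mod_cast hd2
    have h3 := Nat.ceil_lt_add_one (show 0 ≤ (n + |q|) * θ by positivity)
    linarith
  have h3 : n + |q| < d * α := by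
    have := mul_lt_mul_of_pos_right h1 hα
    rwa [mul_assoc, hθα, mul_one] at this
  have h4 : d * α < n + |q| + (w + 1) * α := by
    have := mul_lt_mul_of_pos_right h2 hα
    have h5 : ((n + |q|) * θ + 1 + w) * α = (n + |q|) * (θ * α) + (w + 1) * α := by ring
    rw [h5, hθα] at this
    linarith
  have h5 : (n : ℤ) < m := by
    have : (n : ℝ) < m := by linarith [le_abs_self q]
    exact_mod_cast this
  lift m to ℕ using by omega
  have h6 : (m : ℝ) ≤ n + (⌈|p| + |q| + (w + 1) * α⌉₊ + 1) := by
    have := Nat.le_ceil (|p| + |q| + (w + 1) * α)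
    push_cast at hm1
    linarith [neg_abs_le p]
  refine ⟨m, ⟨d, hdR, ?_⟩, by omega, by exact_mod_cast h6⟩
  push_cast at hm1 hm2
  have h7 : θ * ((d - γ) * α) < θ * m := mul_lt_mul_of_pos_left (by linarith) hθ
  have h8 : θ * m < θ * ((d - γ + 1) * α) := mul_lt_mul_of_pos_left (by linarith) hθ
  have h9 (u : ℝ) : θ * (u * α) = u := by rw [mul_left_comm, hθα, mul_one]
  rw [h9] at h7 h8
  rw [Int.floor_eq_iff]
  push_cast
  constructor <;> linarith

lemma ae_inv_notMem {N : Set ℝ} (hN : volume N = 0) :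
    ∀ᵐ θ ∂(volume.restrict (Set.Ioi (0 : ℝ))), θ⁻¹ ∉ N := by
  rw [ae_restrict_iff' measurableSet_Ioi]
  have h : volume ((fun x : ℝ => x⁻¹) '' (N ∩ Set.Ioi 0)) = 0 :=
    addHaar_image_eq_zero_of_differentiableOn_of_addHaar_eq_zero volume
      (fun x hx => (differentiableAt_inv hx.2.ne').differentiableWithinAt)
      (measure_mono_null Set.inter_subset_left hN)
  refine measure_mono_null (fun θ hθ => ?_) h
  simp only [Set.mem_compl_iff, Set.mem_ofPred_eq, Classical.not_imp, not_not] at hθ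
  exact ⟨θ⁻¹, ⟨hθ.2, Set.mem_Ioi.2 (inv_pos.2 hθ.1)⟩, inv_inv θ⟩

end Beatty

end DensityHJ

/-- for a set `A` of positive upper density, a.e. `θ > 0` and every `γ`,
there is a syndetic set `S` of `n`'s such that the set of starting points `m` of
`(k+1)`-term APs in `A` with common difference `⌊θn+γ⌋` has positive upper density. -/
theorem syndetically_many_beatty_common_differences
    (k : ℕ) (hk : 1 ≤ k) (A : Set ℕ) (hA : 0 < upperDensity A) :
    ∀ᵐ θ ∂(MeasureTheory.volume.restrict (Set.Ioi (0 : ℝ))), ∀ γ : ℝ,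
      ∃ S : Set ℕ, Syndetic S ∧
        ∀ n ∈ S, 1 ≤ ⌊θ * (n : ℝ) + γ⌋ →
          0 < upperDensity
            {m : ℕ | ∀ j : ℕ, j ≤ k → m + j * (⌊θ * (n : ℝ) + γ⌋).toNat ∈ A} := by
  obtain ⟨r, hr⟩ := DensityHJ.exists_ip_recurrence k hA
  set R : Set ℕ := {d | 0 < upperDensity {m : ℕ | ∀ j ≤ k, m + j * d ∈ A}}
  have hnull : MeasureTheory.volume
      (⋃ (p : ℚ) (q : ℚ) (_ : p < q), DensityHJ.UnboundedGaps R p q) = 0 := by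
    simp only [MeasureTheory.measure_iUnion_null_iff]
    intro p q hpq
    exact DensityHJ.volume_unboundedGaps_eq_zero hr (by exact_mod_cast hpq)
  filter_upwards [DensityHJ.ae_inv_notMem hnull,
    MeasureTheory.ae_restrict_mem measurableSet_Ioi] with θ hθ hθ0 γ
  have hα : 0 < θ⁻¹ := inv_pos.2 hθ0
  obtain ⟨p, hp1, hp2⟩ := exists_rat_btwn (show γ * θ⁻¹ - θ⁻¹ < γ * θ⁻¹ by linarith)
  obtain ⟨q, hq1, hq2⟩ := exists_rat_btwn hp2
  refine ⟨{n : ℕ | ∃ d ∈ R, ⌊θ * n + γ⌋ = (d : ℤ)},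
    DensityHJ.syndetic_of_notMem_unboundedGaps hθ0 hp1 hq2 fun h => hθ ?_, ?_⟩
  · simp only [Set.mem_iUnion]
    exact ⟨p, q, by exact_mod_cast hq1, h⟩
  · rintro n ⟨d, hd, hn⟩ -
    rw [hn]
    exact hd
end

section
/- Let θ > 1 be irrational, let γ ∈ ℝ, let W ≥ 1 be an integer and b ∈ ℤ. Then the set {n ∈ ℕ : n ≡ b (mod W) and n = ⌊θm+γ⌋ for some m ∈ ℤ} has natural density 1/(θW); that is, (1/N)·|{n ≤ N : n ≡ b (mod W) and n ∈ {⌊θm+γ⌋ : m ∈ ℤ}}| → 1/(θW) as N → ∞. -/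
open MeasureTheory Filter Finset

/-- If `a N` differs from `L * N` by at most `ε N + O_ε(1)` for every `ε > 0`,
then `a N / N` tends to `L`. -/
theorem tendsto_div_of_forall_abs_sub_le {a : ℕ → ℝ} {L : ℝ}
    (h : ∀ ε > 0, ∃ C : ℝ, ∀ N : ℕ, |a N - L * N| ≤ ε * N + C) :
    Tendsto (fun N : ℕ => a N / (N : ℝ)) atTop (nhds L) := by
  rw [Metric.tendsto_atTop]
  intro ε hε
  obtain ⟨C, hC⟩ := h (ε / 2) (by positivity)
  obtain ⟨M, hM⟩ := exists_nat_gt (2 * C / ε)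
  refine ⟨M + 1, fun N hN => ?_⟩
  have hMN : (M : ℝ) + 1 ≤ N := by exact_mod_cast hN
  have hN0 : (0 : ℝ) < N := by
    have : (0 : ℝ) ≤ M := M.cast_nonneg
    linarith
  have hCN : 2 * C < ε * N := by
    rw [div_lt_iff₀ hε] at hM
    nlinarith
  have key : a N / N - L = (a N - L * N) / N := by field_simp
  rw [Real.dist_eq, key, abs_div, abs_of_pos hN0, div_lt_iff₀ hN0]
  linarith [hC N]

/-- The sum of the fractional parts of `x + k α` over `k < K`. -/
noncomputable def sumFract (α : ℝ) (K : ℕ) (x : ℝ) : ℝ :=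
  ∑ k ∈ Finset.range K, Int.fract (x + k * α)

theorem sumFract_add_int (α : ℝ) (K : ℕ) (x : ℝ) (i : ℤ) :
    sumFract α K (x + i) = sumFract α K x := by
  refine Finset.sum_congr rfl fun k _ => ?_
  rw [add_right_comm, Int.fract_add_intCast]

theorem sumFract_add_le (α : ℝ) (K : ℕ) (x : ℝ) {h : ℝ} (hh : 0 ≤ h) :
    sumFract α K (x + h) ≤ sumFract α K x + h * K := by
  have hterm : ∀ k ∈ Finset.range K,
      Int.fract (x + h + k * α) ≤ Int.fract (x + k * α) + h := by
    intro k _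
    have hmono : ⌊x + k * α⌋ ≤ ⌊x + h + k * α⌋ := Int.floor_mono (by linarith)
    have hmono' : (⌊x + k * α⌋ : ℝ) ≤ ⌊x + h + k * α⌋ := by exact_mod_cast hmono
    unfold Int.fract
    linarith
  calc sumFract α K (x + h) ≤ ∑ k ∈ Finset.range K, (Int.fract (x + k * α) + h) :=
        Finset.sum_le_sum hterm
    _ = sumFract α K x + h * K := by
        simp [sumFract, Finset.sum_add_distrib, mul_comm]

theorem abs_sumFract_add_sub_le_one (α : ℝ) (K : ℕ) (x : ℝ) :
    |sumFract α K (x + α) - sumFract α K x| ≤ 1 := by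
  have key : sumFract α K (x + α) - sumFract α K x
      = Int.fract (x + K * α) - Int.fract x := by
    unfold sumFract
    rw [← Finset.sum_sub_distrib]
    convert Finset.sum_range_sub (fun k : ℕ => Int.fract (x + k * α)) K using 3
    · push_cast
      congr 1
      ring
    · simp
  rw [key, abs_le]
  constructor <;>
  linarith [Int.fract_nonneg x, Int.fract_lt_one x, Int.fract_nonneg (x + K * α),
    Int.fract_lt_one (x + K * α)]

theorem abs_sumFract_add_nat_mul_sub_le (α : ℝ) (K : ℕ) (x : ℝ) (j : ℕ) :
    |sumFract α K (x + j * α) - sumFract α K x| ≤ j := by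
  induction j with
  | zero => simp
  | succ j ih =>
    have h1 := abs_sumFract_add_sub_le_one α K (x + j * α)
    have h2 : x + ((j + 1 : ℕ) : ℝ) * α = x + j * α + α := by push_cast; ring
    rw [h2]
    push_cast
    rw [abs_le] at *
    constructor <;> linarith [h1.1, h1.2, ih.1, ih.2]

theorem abs_sumFract_add_int_mul_sub_le (α : ℝ) (K : ℕ) (x : ℝ) (j : ℤ) :
    |sumFract α K (x + j * α) - sumFract α K x| ≤ j.natAbs := by
  obtain ⟨n, rfl | rfl⟩ := j.eq_nat_or_neg
  · simpa using abs_sumFract_add_nat_mul_sub_le α K x n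
  · have h := abs_sumFract_add_nat_mul_sub_le α K (x + ((-n : ℤ) : ℝ) * α) n
    rw [abs_sub_comm] at h
    simpa using h

theorem exists_sumFract_le {α : ℝ} (hα : Irrational α) (x y : ℝ) {ε : ℝ} (hε : 0 < ε) :
    ∃ C : ℝ, ∀ K : ℕ, sumFract α K y ≤ sumFract α K x + ε * K + C := by
  have hd : Dense (AddSubgroup.closure {α, (1 : ℝ)} : Set ℝ) :=
    dense_addSubgroupClosure_pair_iff.2 (by simpa using hα)
  obtain ⟨z, hz, hzmem⟩ := hd.exists_mem_open (isOpen_Ioo (a := y - x - ε) (b := y - x))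
    ⟨y - x - ε / 2, by constructor <;> linarith⟩
  obtain ⟨j, i, rfl⟩ := AddSubgroup.mem_closure_pair.1 hz
  simp only [zsmul_eq_mul, mul_one] at hzmem
  obtain ⟨h1, h2⟩ := hzmem
  refine ⟨j.natAbs, fun K => ?_⟩
  have hy : y = x + j * α + i + (y - x - (j * α + i)) := by ring
  have h3 := sumFract_add_le α K (x + j * α + i) (h := y - x - (j * α + i)) (by linarith)
  rw [← hy, sumFract_add_int] at h3
  have h4 := (abs_le.1 (abs_sumFract_add_int_mul_sub_le α K x j)).2
  have h5 : (y - x - (j * α + i)) * K ≤ ε * K :=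
    mul_le_mul_of_nonneg_right (by linarith) K.cast_nonneg
  linarith

theorem exists_abs_sumFract_sub_le {α : ℝ} (hα : Irrational α) (x y : ℝ) {ε : ℝ}
    (hε : 0 < ε) :
    ∃ C : ℝ, ∀ K : ℕ, |sumFract α K y - sumFract α K x| ≤ ε * K + C := by
  obtain ⟨C₁, h₁⟩ := exists_sumFract_le hα x y hε
  obtain ⟨C₂, h₂⟩ := exists_sumFract_le hα y x hε
  refine ⟨max C₁ C₂, fun K => abs_le.2 ⟨?_, ?_⟩⟩
  · linarith [h₂ K, le_max_right C₁ C₂]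
  · linarith [h₁ K, le_max_left C₁ C₂]

/-- Membership in a Beatty sequence, expressed as a difference of floors. -/
theorem indicator_beatty_eq {θ : ℝ} (hθ : 1 < θ) (γ : ℝ) (n : ℕ) :
    Set.indicator {n : ℕ | ∃ m : ℤ, (n : ℤ) = ⌊θ * (m : ℝ) + γ⌋} (fun _ => (1 : ℝ)) n
      = 1 / θ + (Int.fract ((γ - n - 1) / θ) - Int.fract ((γ - n) / θ)) := by
  have hθ0 : 0 < θ := by linarith
  have hdiff : (γ - n) / θ = (γ - n - 1) / θ + 1 / θ := by ring
  have hinv : 1 / θ < 1 := by rw [div_lt_one hθ0]; exact hθ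
  have hinv0 : 0 < 1 / θ := by positivity
  have hle : ⌊(γ - n - 1) / θ⌋ ≤ ⌊(γ - n) / θ⌋ := Int.floor_mono (by linarith)
  have hlt : ⌊(γ - n) / θ⌋ ≤ ⌊(γ - n - 1) / θ⌋ + 1 := by
    rw [← Int.floor_add_one]
    exact Int.floor_mono (by linarith)
  have hiff : (∃ m : ℤ, (n : ℤ) = ⌊θ * (m : ℝ) + γ⌋) ↔
      ⌊(γ - n - 1) / θ⌋ < ⌊(γ - n) / θ⌋ := by
    have hm : ∀ m : ℤ, (n : ℤ) = ⌊θ * (m : ℝ) + γ⌋ ↔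
        -m ≤ ⌊(γ - n) / θ⌋ ∧ ⌊(γ - n - 1) / θ⌋ < -m := by
      intro m
      rw [eq_comm, Int.floor_eq_iff, Int.le_floor, Int.floor_lt, le_div_iff₀ hθ0,
        div_lt_iff₀ hθ0]
      push_cast
      constructor <;> rintro ⟨h1, h2⟩ <;> constructor <;> linarith
    constructor
    · rintro ⟨m, h⟩
      have := (hm m).1 h
      omega
    · intro h
      exact ⟨-⌊(γ - n) / θ⌋, (hm _).2 (by omega)⟩
  have hfr : 1 / θ + (Int.fract ((γ - n - 1) / θ) - Int.fract ((γ - n) / θ))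
      = (⌊(γ - n) / θ⌋ : ℝ) - ⌊(γ - n - 1) / θ⌋ := by
    unfold Int.fract
    linarith
  rw [hfr]
  by_cases hmem : ∃ m : ℤ, (n : ℤ) = ⌊θ * (m : ℝ) + γ⌋
  · rw [Set.indicator_of_mem (by exact hmem)]
    have : ⌊(γ - n) / θ⌋ = ⌊(γ - n - 1) / θ⌋ + 1 := by
      have := hiff.1 hmem
      omega
    rw [this]
    push_cast
    ring
  · rw [Set.indicator_of_notMem (by exact hmem)]
    have : ⌊(γ - n) / θ⌋ = ⌊(γ - n - 1) / θ⌋ := by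
      rw [hiff] at hmem
      omega
    rw [this, sub_self]

/-- A sum over a union of complete residue systems of a function supported on one residue class. -/
theorem sum_range_mul_eq_sum_residue {W r : ℕ} (hr : r < W) (f : ℕ → ℝ)
    (hf : ∀ n, n % W ≠ r → f n = 0) (K : ℕ) :
    ∑ n ∈ Finset.range (W * K), f n = ∑ k ∈ Finset.range K, f (r + W * k) := by
  induction K with
  | zero => simp
  | succ K ih =>
    rw [Nat.mul_succ, Finset.sum_range_add, ih, Finset.sum_range_succ]
    congr 1
    rw [Finset.sum_eq_single_of_mem r (Finset.mem_range.2 hr), add_comm]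
    intro i hi hir
    apply hf
    rwa [Nat.mul_add_mod, Nat.mod_eq_of_lt (Finset.mem_range.1 hi)]

theorem abs_sum_Icc_sub_sum_range_mul_div_le {W : ℕ} (hW : 1 ≤ W) {f : ℕ → ℝ}
    (h0 : ∀ n, 0 ≤ f n) (h1 : ∀ n, f n ≤ 1) (N : ℕ) :
    |∑ n ∈ Finset.Icc 1 N, f n - ∑ n ∈ Finset.range (W * (N / W)), f n| ≤ W + 1 := by
  have hIcc : ∑ n ∈ Finset.range (N + 1), f n = ∑ n ∈ Finset.Icc 1 N, f n + f 0 := by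
    rw [Finset.sum_range_succ', Finset.range_eq_Ico, Finset.sum_Ico_add' f 0 N 1]
    rfl
  have hlen : N + 1 = W * (N / W) + (N % W + 1) := by
    have := Nat.div_add_mod N W
    omega
  have hmod : ((N % W + 1 : ℕ) : ℝ) ≤ W := by
    exact_mod_cast Nat.mod_lt N hW
  rw [hlen, Finset.sum_range_add] at hIcc
  have htail0 : 0 ≤ ∑ i ∈ Finset.range (N % W + 1), f (W * (N / W) + i) :=
    Finset.sum_nonneg fun _ _ => h0 _
  have htail1 : ∑ i ∈ Finset.range (N % W + 1), f (W * (N / W) + i)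
      ≤ ((N % W + 1 : ℕ) : ℝ) := by
    simpa using Finset.sum_le_card_nsmul (Finset.range (N % W + 1))
      (fun i => f (W * (N / W) + i)) 1 fun _ _ => h1 _
  rw [abs_le]
  constructor <;> linarith [h0 0, h1 0]

/-- for irrational `θ > 1`, `γ ∈ ℝ`, `W ≥ 1` and `b ∈ ℤ`, the set of
naturals congruent to `b` mod `W` which belong to the Beatty sequence
`{⌊θm+γ⌋ : m ∈ ℤ}` has natural density `1/(θW)`. -/
theorem beatty_arith_prog_density
    (θ γ : ℝ) (hθ : 1 < θ) (hθirr : Irrational θ)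
    (W : ℕ) (hW : 1 ≤ W) (b : ℤ) :
    Filter.Tendsto
      (fun N : ℕ =>
        (∑ n ∈ Finset.Icc 1 N,
            Set.indicator
              {n : ℕ | (W : ℤ) ∣ ((n : ℤ) - b) ∧ ∃ m : ℤ, (n : ℤ) = ⌊θ * (m : ℝ) + γ⌋}
              (fun _ => (1 : ℝ)) n) / (N : ℝ))
      Filter.atTop (nhds (1 / (θ * W))) := by
  have hθ0 : 0 < θ := by linarith
  have hW0 : (0 : ℝ) < W := by exact_mod_cast hW
  set f : ℕ → ℝ := Set.indicator
    {n : ℕ | (W : ℤ) ∣ ((n : ℤ) - b) ∧ ∃ m : ℤ, (n : ℤ) = ⌊θ * (m : ℝ) + γ⌋}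
    (fun _ => (1 : ℝ))
  have hf0 : ∀ n, 0 ≤ f n := fun n => Set.indicator_nonneg (fun _ _ => zero_le_one) n
  have hf1 : ∀ n, f n ≤ 1 := fun n => Set.indicator_le_self' (fun _ _ => zero_le_one) n
  have hWne : (W : ℤ) ≠ 0 := by omega
  obtain ⟨r, hr⟩ := Int.eq_ofNat_of_zero_le (Int.emod_nonneg b hWne)
  have hrW : r < W := by
    have := Int.emod_lt_of_pos b (show (0 : ℤ) < W by omega)
    omega
  have hres : ∀ n : ℕ, (W : ℤ) ∣ (n : ℤ) - b ↔ n % W = r := by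
    intro n
    rw [← Int.modEq_iff_dvd, Int.ModEq, hr]
    omega
  have hfres : ∀ n, n % W ≠ r → f n = 0 := fun n hn =>
    Set.indicator_of_notMem (fun h => hn ((hres n).1 h.1)) _
  set α : ℝ := -(W / θ) with hα
  have hαirr : Irrational α := by
    have h : Irrational ((W : ℝ) / θ) := hθirr.natCast_div (by omega)
    exact h.neg
  have hblock : ∀ K : ℕ, ∑ k ∈ Finset.range K, f (r + W * k)
      = K / θ + (sumFract α K ((γ - r - 1) / θ) - sumFract α K ((γ - r) / θ)) := by
    intro K
    have hterm : ∀ k ∈ Finset.range K, f (r + W * k) = 1 / θ +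
        (Int.fract ((γ - r - 1) / θ + k * α) - Int.fract ((γ - r) / θ + k * α)) := by
      intro k _
      have hk : (W : ℤ) ∣ ((r + W * k : ℕ) : ℤ) - b := by
        rw [hres, Nat.add_mul_mod_self_left, Nat.mod_eq_of_lt hrW]
      have e1 : (γ - r - 1) / θ + k * α = (γ - (r + W * k : ℕ) - 1) / θ := by
        rw [hα]; push_cast; ring
      have e2 : (γ - r) / θ + k * α = (γ - (r + W * k : ℕ)) / θ := by
        rw [hα]; push_cast; ring
      rw [e1, e2, ← indicator_beatty_eq hθ]
      exact Set.indicator_eq_indicator (and_iff_right hk) rfl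
    rw [Finset.sum_congr rfl hterm, Finset.sum_add_distrib, Finset.sum_sub_distrib]
    simp [sumFract, div_eq_mul_inv]
  refine tendsto_div_of_forall_abs_sub_le fun ε hε => ?_
  obtain ⟨C, hC⟩ := exists_abs_sumFract_sub_le hαirr ((γ - r) / θ) ((γ - r - 1) / θ) hε
  refine ⟨C + (W + 1) + 1 / θ, fun N => ?_⟩
  have hsum := abs_sum_Icc_sub_sum_range_mul_div_le hW hf0 hf1 N
  rw [sum_range_mul_eq_sum_residue hrW f hfres, hblock] at hsum
  have hK := hC (N / W)
  have hKN : ((N / W : ℕ) : ℝ) ≤ N / W := Nat.cast_div_le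
  have hKN' : (N : ℝ) / W ≤ (N / W : ℕ) + 1 := by
    rw [div_le_iff₀ hW0]
    have := Nat.lt_div_mul_add (a := N) (b := W) hW
    have h : N ≤ (N / W + 1) * W := by rw [add_mul, one_mul]; exact this.le
    exact_mod_cast h
  have hKle : ε * ((N / W : ℕ) : ℝ) ≤ ε * N :=
    mul_le_mul_of_nonneg_left (by exact_mod_cast Nat.div_le_self N W) hε.le
  have e : 1 / (θ * W) * N = (N / W) / θ := by field_simp
  have hd1 : ((N / W : ℕ) : ℝ) / θ ≤ (N / W) / θ := by gcongr
  have hd2 : ((N : ℝ) / W) / θ ≤ ((N / W : ℕ) : ℝ) / θ + 1 / θ := by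
    rw [← add_div]; gcongr
  have hp : 0 < 1 / θ := by positivity
  rw [e]
  rw [abs_le] at hsum hK ⊢
  constructor <;> linarith [hsum.1, hsum.2, hK.1, hK.2]
end
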